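/- arXiv:1711.10480 — 2 statements merged into one kernel-verified Lean document; each statement's English description precedes it below -/
import Mathlib

section
/- Let 1/3 < σ < 1 and let ν be real such that σn − ν − 1/2 is not a nonpositive integer for any natural number n and such that k_s := (k − ν − 1/2)/σ is not an integer for any natural number k. Then for every real R > 0 there exist constants C > 0 and Z₀ > 0 such that for all real z ≥ Z₀, with x = z²/4: | (z/2)^{−ν−1} L_ν(z; −σ) − (1/π) Σ_{k : k+1 ≤ R} (−1)^{k+1} Γ(k + 1/2) x^{−k−1} / Γ(ν + 3/2 + σ(k+1)) − (1/σ) Σ_{k : k_s ≤ R} x^{−k_s} / (k! · Γ(3/2 − k_s)) | ≤ C x^{−R}. That is, as z → +∞, L_ν(z;−σ) has the purely algebraic asymptotic expansion (z/2)^{−ν−1} L_ν(z;−σ) ∼ (1/π)Σ_{k≥0} (−x)^{−k−1}Γ(k+1/2)/Γ(ν+3/2+σ(k+1)) + (1/σ)Σ_{k≥0} x^{−k_s}/(k! Γ(3/2−k_s)). -/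
open Filter Topology

/-- The generalised Struve function
`L_ν(z;a) = (z/2)^{ν+1} Σ_{n≥0} (z/2)^{2n} / (Γ(n+3/2) Γ(an+ν+3/2))`,
with principal branch power and the entire reciprocal Gamma function
(`Complex.Gamma` vanishes at the poles, so division realises `1/Γ`). -/
noncomputable def struveL (ν a : ℝ) (z : ℂ) : ℂ :=
  (z / 2) ^ ((ν : ℂ) + 1) *
    ∑' n : ℕ, (z / 2) ^ (2 * n) /
      (Complex.Gamma ((n : ℂ) + 3 / 2) *
        Complex.Gamma ((a : ℂ) * (n : ℂ) + (ν : ℂ) + 3 / 2))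

namespace StruveAux

open MeasureTheory Set

/-! ### Generic integrability and integration by parts on `(0,∞)` -/

lemma integrableOn_of_bounds {E : Type*} [NormedAddCommGroup E] {g : ℝ → E} {p q C D : ℝ}
    (hm : AEStronglyMeasurable g (volume.restrict (Ioi 0)))
    (hp : -1 < p) (hq : q < -1)
    (h0 : ∀ t, 0 < t → t ≤ 1 → ‖g t‖ ≤ C * t ^ p)
    (h1 : ∀ t, 1 ≤ t → ‖g t‖ ≤ D * t ^ q) : IntegrableOn g (Ioi 0) := by
  have hsplit : Ioi (0:ℝ) = Ioc 0 1 ∪ Ioi 1 := (Ioc_union_Ioi_eq_Ioi zero_le_one).symm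
  rw [hsplit]
  apply IntegrableOn.union
  · have : IntegrableOn (fun t : ℝ => C * t ^ p) (Ioc 0 1) := by
      have h := (intervalIntegral.integrableOn_Ioo_rpow_iff (s := p) (t := 1) one_pos).2 hp
      rw [← integrableOn_Ioc_iff_integrableOn_Ioo] at h
      exact h.const_mul C
    refine Integrable.mono' this (hm.mono_measure (Measure.restrict_mono Ioc_subset_Ioi_self le_rfl)) ?_
    filter_upwards [ae_restrict_mem measurableSet_Ioc] with t ht using h0 t ht.1 ht.2
  · have : IntegrableOn (fun t : ℝ => D * t ^ q) (Ioi 1) :=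
      (integrableOn_Ioi_rpow_of_lt hq one_pos).const_mul D
    refine Integrable.mono' this (hm.mono_measure (Measure.restrict_mono
      (Ioi_subset_Ioi zero_le_one) le_rfl)) ?_
    filter_upwards [ae_restrict_mem measurableSet_Ioi] with t ht using h1 t (le_of_lt ht)

lemma tendsto_zero_rpow_right {p : ℝ} (hp : 0 < p) :
    Tendsto (fun t : ℝ => t ^ p) (𝓝[>] 0) (𝓝 0) := by
  have := (Real.continuousAt_rpow_const 0 p (Or.inr hp.le)).tendsto
  rw [Real.zero_rpow hp.ne'] at this
  exact this.mono_left nhdsWithin_le_nhds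

lemma tendsto_zero_rpow_atTop {p : ℝ} (hp : p < 0) :
    Tendsto (fun t : ℝ => t ^ p) atTop (𝓝 0) := by
  have := tendsto_rpow_neg_atTop (y := -p) (by linarith)
  simpa using this

lemma ibp {E : Type*} [NormedAddCommGroup E] [NormedSpace ℝ E] [CompleteSpace E]
    {g g' : ℝ → E} {s p q C D : ℝ}
    (hc : ContinuousOn g (Ioi 0))
    (hd : ∀ t, 0 < t → t ≠ 1 → HasDerivAt g (g' t) t)
    (hp : 0 < p + s) (hq : q + s < 0)
    (h0 : ∀ t, 0 < t → t ≤ 1 → ‖g t‖ ≤ C * t ^ p)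
    (h1 : ∀ t, 1 ≤ t → ‖g t‖ ≤ D * t ^ q)
    (hi : IntegrableOn (fun t : ℝ => t ^ s • g' t) (Ioi 0)) :
    s • ∫ t in Ioi (0:ℝ), t ^ (s - 1) • g t = - ∫ t in Ioi (0:ℝ), t ^ s • g' t := by
  have hcr : ∀ a : ℝ, ContinuousOn (fun t : ℝ => t ^ a) (Ioi 0) := fun a t ht =>
    (Real.continuousAt_rpow_const t a (Or.inl (ne_of_gt ht))).continuousWithinAt
  have hgi : IntegrableOn (fun t : ℝ => t ^ (s - 1) • g t) (Ioi 0) := by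
    apply integrableOn_of_bounds (p := p + s - 1) (q := q + s - 1) (C := C) (D := D)
    · exact ((hcr _).smul hc).aestronglyMeasurable measurableSet_Ioi
    · linarith
    · linarith
    · intro t ht ht1
      rw [norm_smul, Real.norm_of_nonneg (by positivity)]
      calc t ^ (s - 1) * ‖g t‖ ≤ t ^ (s - 1) * (C * t ^ p) := by gcongr; exact h0 t ht ht1
        _ = C * t ^ (p + s - 1) := by
          rw [show p + s - 1 = (s - 1) + p by ring, Real.rpow_add ht]; ring
    · intro t ht1
      have ht : 0 < t := by linarith
      rw [norm_smul, Real.norm_of_nonneg (by positivity)]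
      calc t ^ (s - 1) * ‖g t‖ ≤ t ^ (s - 1) * (D * t ^ q) := by gcongr; exact h1 t ht1
        _ = D * t ^ (q + s - 1) := by
          rw [show q + s - 1 = (s - 1) + q by ring, Real.rpow_add ht]; ring
  set F : ℝ → E := fun t => t ^ s • g t with hF
  set F' : ℝ → E := fun t => t ^ s • g' t + s • (t ^ (s - 1) • g t) with hF'
  have hFd : ∀ t, 0 < t → t ≠ 1 → HasDerivAt F (F' t) t := by
    intro t ht ht1
    have := (Real.hasDerivAt_rpow_const (p := s) (Or.inl ht.ne')).smul (hd t ht ht1)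
    simp only [hF', smul_smul]
    exact this
  have hFc : ContinuousOn F (Ioi 0) := (hcr s).smul hc
  have hFi : IntegrableOn F' (Ioi 0) := hi.add (hgi.smul s)
  have hl0 : Tendsto F (𝓝[>] 0) (𝓝 0) := by
    refine squeeze_zero_norm' (a := fun t => C * t ^ (p + s)) ?_ ?_
    · filter_upwards [Ioc_mem_nhdsGT (zero_lt_one (α := ℝ))] with t ht
      rw [hF]; simp only
      rw [norm_smul, Real.norm_of_nonneg (Real.rpow_nonneg ht.1.le _), add_comm p s, Real.rpow_add ht.1]
      have := h0 t ht.1 ht.2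
      have := mul_le_mul_of_nonneg_left this (Real.rpow_nonneg ht.1.le s)
      linarith
    · simpa using (tendsto_zero_rpow_right hp).const_mul C
  have hl1 : Tendsto F atTop (𝓝 0) := by
    refine squeeze_zero_norm' (a := fun t => D * t ^ (q + s)) ?_ ?_
    · filter_upwards [eventually_ge_atTop 1] with t ht
      have htp : 0 < t := by linarith
      rw [hF]; simp only
      rw [norm_smul, Real.norm_of_nonneg (Real.rpow_nonneg htp.le _), add_comm q s, Real.rpow_add htp]
      have := h1 t ht
      have := mul_le_mul_of_nonneg_left this (Real.rpow_nonneg htp.le s)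
      linarith
    · simpa using (tendsto_zero_rpow_atTop hq).const_mul D
  have hF1 : ContinuousAt F 1 := hFc.continuousAt (Ioi_mem_nhds one_pos)
  have e1 : ∫ t in (0:ℝ)..1, F' t = F 1 - 0 := by
    apply intervalIntegral.integral_eq_sub_of_hasDerivAt_of_tendsto zero_lt_one
      (fun x hx => hFd x hx.1 hx.2.ne) _ hl0 (hF1.tendsto.mono_left nhdsWithin_le_nhds)
    rw [intervalIntegrable_iff_integrableOn_Ioc_of_le zero_le_one]
    exact hFi.mono_set Ioc_subset_Ioi_self
  have e2 : ∫ t in Ioi (1:ℝ), F' t = 0 - F 1 :=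
    integral_Ioi_of_hasDerivAt_of_tendsto hF1.continuousWithinAt
      (fun x hx => hFd x (lt_trans one_pos hx) (ne_of_gt hx))
      (hFi.mono_set (Ioi_subset_Ioi zero_le_one)) hl1
  have e3 : ∫ t in Ioi (0:ℝ), F' t = 0 := by
    rw [← Ioc_union_Ioi_eq_Ioi (zero_le_one (α := ℝ)), setIntegral_union
      (Ioc_disjoint_Ioi le_rfl) measurableSet_Ioi (hFi.mono_set Ioc_subset_Ioi_self)
      (hFi.mono_set (Ioi_subset_Ioi zero_le_one)), e2, ← intervalIntegral.integral_of_le zero_le_one,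
      e1]
    simp
  have e4 : ∫ t in Ioi (0:ℝ), F' t = (∫ t in Ioi (0:ℝ), t ^ s • g' t) +
      s • ∫ t in Ioi (0:ℝ), t ^ (s - 1) • g t := by
    rw [← integral_smul]
    exact integral_add hi (hgi.smul s)
  rw [e4] at e3
  exact eq_neg_of_add_eq_zero_right e3

/-! ### The exponential function with its Taylor polynomial removed -/

/-- `exp(-μ t)` minus the first `K` Taylor terms. -/
noncomputable def fT (μ : ℂ) (K : ℕ) (t : ℝ) : ℂ :=
  Complex.exp (-(μ * t)) - ∑ k ∈ Finset.range K, (-(μ * t)) ^ k / (k.factorial : ℂ)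

lemma fT_succ (μ : ℂ) (K : ℕ) (t : ℝ) :
    fT μ K t = fT μ (K + 1) t + (-(μ * t)) ^ K / (K.factorial : ℂ) := by
  simp only [fT, Finset.sum_range_succ]; ring

lemma fT_continuous (μ : ℂ) (K : ℕ) : Continuous (fT μ K) := by
  unfold fT; fun_prop

lemma hasDerivAt_neg_mul (μ : ℂ) (t : ℝ) :
    HasDerivAt (fun t : ℝ => -(μ * (t : ℂ))) (-μ) t := by
  have := ((Complex.ofRealCLM.hasDerivAt (x := t)).const_mul μ).neg
  simp only [Complex.ofRealCLM_apply, Complex.ofReal_one, mul_one] at this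
  exact this

lemma fT_hasDerivAt (μ : ℂ) (K : ℕ) (t : ℝ) :
    HasDerivAt (fT μ (K + 1)) (-μ * fT μ K t) t := by
  have h0 := hasDerivAt_neg_mul μ t
  have h1 := h0.cexp
  have h2 : ∀ k ∈ Finset.range (K + 1), HasDerivAt (fun t : ℝ => (-(μ * (t : ℂ))) ^ k / (k.factorial : ℂ))
      ((k : ℂ) * (-(μ * t)) ^ (k - 1) * (-μ) / (k.factorial : ℂ)) t := fun k _ =>
    (h0.pow k).div_const _
  have h3 := h1.sub (HasDerivAt.fun_sum h2)
  refine h3.congr_deriv ?_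
  rw [Finset.sum_range_succ', fT]
  simp only [Nat.cast_zero, zero_mul, zero_div, add_zero]
  rw [mul_sub, Finset.mul_sum]
  congr 1
  · ring
  · apply Finset.sum_congr rfl
    intro k _
    rw [Nat.factorial_succ]
    have : (k.factorial : ℂ) ≠ 0 := by exact_mod_cast k.factorial_ne_zero
    have : ((k : ℂ) + 1) ≠ 0 := by exact_mod_cast k.succ_ne_zero
    push_cast
    field_simp

lemma norm_exp_neg_mul (μ : ℂ) (t : ℝ) : ‖Complex.exp (-(μ * t))‖ = Real.exp (-(μ.re * t)) := by
  rw [Complex.norm_exp]; simp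

lemma fT_bound_nat (μ : ℂ) (hμ : 0 < μ.re) (K : ℕ) :
    ∃ C : ℝ, 0 ≤ C ∧ ∀ t : ℝ, 0 < t → ‖fT μ K t‖ ≤ C * t ^ K := by
  refine ⟨‖μ‖ ^ K * Real.exp ‖μ‖ + (1 + ∑ k ∈ Finset.range K, ‖μ‖ ^ k / (k.factorial : ℝ)),
    by positivity, ?_⟩
  intro t ht
  rcases le_total t 1 with h | h
  · have := Complex.norm_exp_sub_sum_le_norm_mul_exp (-(μ * t)) K
    rw [norm_neg, norm_mul, Complex.norm_real, Real.norm_of_nonneg ht.le] at this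
    refine this.trans ?_
    rw [mul_pow, add_mul]
    have h2 : Real.exp (‖μ‖ * t) ≤ Real.exp ‖μ‖ := by
      apply Real.exp_le_exp.2; nlinarith [norm_nonneg μ]
    have : 0 ≤ (1 + ∑ k ∈ Finset.range K, ‖μ‖ ^ k / (k.factorial : ℝ)) * t ^ K := by positivity
    calc _ ≤ ‖μ‖ ^ K * t ^ K * Real.exp ‖μ‖ := by gcongr
      _ ≤ _ := by linarith
  · have ha : ‖fT μ K t‖ ≤ t ^ K + ∑ k ∈ Finset.range K, ‖μ‖ ^ k / (k.factorial : ℝ) * t ^ K := by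
      unfold fT
      refine (norm_sub_le _ _).trans (add_le_add ?_ ((norm_sum_le _ _).trans
        (Finset.sum_le_sum fun k hk => ?_)))
      · rw [norm_exp_neg_mul]
        calc Real.exp (-(μ.re * t)) ≤ 1 := Real.exp_le_one_iff.2 (by nlinarith)
          _ ≤ t ^ K := one_le_pow₀ h
      · rw [norm_div, norm_pow, norm_neg, norm_mul, Complex.norm_real, Real.norm_of_nonneg ht.le,
          mul_pow, Complex.norm_natCast, mul_div_right_comm]
        gcongr
        exact (Finset.mem_range.1 hk).le
    rw [← Finset.sum_mul] at ha
    have : 0 ≤ ‖μ‖ ^ K * Real.exp ‖μ‖ * t ^ K := by positivity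
    nlinarith

lemma rpow_mul_exp_bounded {a p : ℝ} (ha : 0 < a) (hp : 0 ≤ p) :
    ∃ C : ℝ, 0 ≤ C ∧ ∀ t : ℝ, 0 < t → t ^ p * Real.exp (-(a * t)) ≤ C := by
  obtain ⟨n, hn⟩ := exists_nat_ge p
  refine ⟨1 + n.factorial / a ^ n, by positivity, fun t ht => ?_⟩
  have h1 : (a * t) ^ n / n.factorial ≤ Real.exp (a * t) :=
    Real.pow_div_factorial_le_exp _ (by positivity) n
  have h2 : t ^ n * Real.exp (-(a * t)) ≤ n.factorial / a ^ n := by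
    rw [Real.exp_neg, ← div_eq_mul_inv, div_le_div_iff₀ (Real.exp_pos _) (by positivity)]
    rw [div_le_iff₀ (by positivity), mul_pow] at h1
    linarith
  have h3 : t ^ p ≤ 1 + t ^ n := by
    rcases le_total t 1 with h | h
    · have := Real.rpow_le_one ht.le h hp
      have : 0 ≤ t ^ n := by positivity
      linarith
    · have := Real.rpow_le_rpow_of_exponent_le h hn
      rw [Real.rpow_natCast] at this; linarith
  have h4 : Real.exp (-(a * t)) ≤ 1 := Real.exp_le_one_iff.2 (by nlinarith)
  calc _ ≤ (1 + t ^ n) * Real.exp (-(a * t)) := by gcongr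
    _ ≤ _ := by linarith

lemma fT_bound (μ : ℂ) (hμ : 0 < μ.re) (K : ℕ) (p : ℝ) (hp : p ≤ K)
    (hp' : K = 0 ∨ (K : ℝ) - 1 ≤ p) :
    ∃ C : ℝ, 0 ≤ C ∧ ∀ t : ℝ, 0 < t → ‖fT μ K t‖ ≤ C * t ^ p := by
  rcases K with _ | K
  · obtain ⟨C, hC, h⟩ := rpow_mul_exp_bounded hμ (p := -p) (by simp at hp; linarith)
    refine ⟨C, hC, fun t ht => ?_⟩
    have := h t ht
    rw [Real.rpow_neg ht.le, inv_mul_le_iff₀ (by positivity)] at this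
    simp only [fT, Finset.range_zero, Finset.sum_empty, sub_zero]
    rw [norm_exp_neg_mul]; linarith
  · have hp'' : (K : ℝ) ≤ p := by
      rcases hp' with h | h
      · simp at h
      · push_cast at h; linarith
    obtain ⟨C1, hC1, h1⟩ := fT_bound_nat μ hμ (K + 1)
    obtain ⟨C2, hC2, h2⟩ := fT_bound_nat μ hμ K
    have hT : ∀ t : ℝ, 0 < t → ‖fT μ (K+1) t‖ ≤ (C2 + ‖μ‖ ^ K) * t ^ K := by
      intro t ht
      have : fT μ (K+1) t = fT μ K t - (-(μ * t)) ^ K / (K.factorial : ℂ) := by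
        rw [fT_succ μ K t]; ring
      rw [this]
      refine (norm_sub_le _ _).trans ?_
      rw [norm_div, norm_pow, norm_neg, norm_mul, Complex.norm_real, Real.norm_of_nonneg ht.le,
          mul_pow, Complex.norm_natCast, add_mul]
      refine add_le_add (h2 t ht) (div_le_self (by positivity) ?_)
      exact_mod_cast K.factorial_pos
    refine ⟨C1 + (C2 + ‖μ‖ ^ K), by positivity, fun t ht => ?_⟩
    have hpos : 0 < t ^ p := by positivity
    rcases le_total t 1 with h | h
    · have : t ^ (K + 1) ≤ t ^ p := by
        rw [← Real.rpow_natCast]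
        exact Real.rpow_le_rpow_of_exponent_ge ht h hp
      calc _ ≤ C1 * t ^ (K + 1) := h1 t ht
        _ ≤ C1 * t ^ p := by gcongr
        _ ≤ _ := by
          have : 0 ≤ (C2 + ‖μ‖ ^ K) * t ^ p := by positivity
          linarith
    · have : t ^ K ≤ t ^ p := by
        rw [← Real.rpow_natCast]
        exact Real.rpow_le_rpow_of_exponent_le h hp''
      calc _ ≤ (C2 + ‖μ‖ ^ K) * t ^ K := hT t ht
        _ ≤ (C2 + ‖μ‖ ^ K) * t ^ p := by gcongr
        _ ≤ _ := by
          have : 0 ≤ C1 * t ^ p := by positivity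
          linarith

lemma continuousOn_rpow_Ioi (a : ℝ) : ContinuousOn (fun t : ℝ => t ^ a) (Ioi 0) := fun t ht =>
    (Real.continuousAt_rpow_const t a (Or.inl (ne_of_gt ht))).continuousWithinAt

lemma fT_integrable (μ : ℂ) (hμ : 0 < μ.re) (K : ℕ) (s : ℝ) (h1 : 0 < s + K)
    (h2 : K = 0 ∨ s + K - 1 < 0) :
    IntegrableOn (fun t : ℝ => t ^ (s - 1) • fT μ K t) (Ioi 0) := by
  obtain ⟨C, hC, hb⟩ := fT_bound μ hμ K K le_rfl (Or.inr (by linarith))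
  obtain ⟨q, hq1, hq2, hq3⟩ : ∃ q : ℝ, q ≤ K ∧ (K = 0 ∨ (K : ℝ) - 1 ≤ q) ∧ q + s < 0 := by
    rcases h2 with h | h
    · subst h; exact ⟨-s - 1, by simp at h1 ⊢; linarith, Or.inl rfl, by linarith⟩
    · exact ⟨K - 1, by linarith, Or.inr le_rfl, by linarith⟩
  obtain ⟨D, hD, hb'⟩ := fT_bound μ hμ K q hq1 hq2
  have key : ∀ (A r t : ℝ), 0 < t → ‖fT μ K t‖ ≤ A * t ^ r →
      ‖t ^ (s - 1) • fT μ K t‖ ≤ A * t ^ (r + s - 1) := by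
    intro A r t ht h
    rw [norm_smul, Real.norm_of_nonneg (by positivity), show r + s - 1 = (s - 1) + r by ring,
      Real.rpow_add ht]
    calc _ ≤ t ^ (s - 1) * (A * t ^ r) := by gcongr
      _ = _ := by ring
  refine integrableOn_of_bounds (p := K + s - 1) (q := q + s - 1) (C := C) (D := D) ?_
    (by linarith) (by linarith) (fun t ht _ => key _ _ t ht (hb t ht))
    (fun t ht => key _ _ t (by linarith) (hb' t (by linarith)))
  exact ((continuousOn_rpow_Ioi _).smul (fT_continuous μ K).continuousOn).aestronglyMeasurable
    measurableSet_Ioi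

lemma fT_zero (μ : ℂ) (t : ℝ) : fT μ 0 t = Complex.exp (-(μ * t)) := by simp [fT]

lemma fT_ibp_zero (μ : ℂ) (hμ : 0 < μ.re) (s : ℝ) (hs : 0 < s) :
    s • ∫ t in Ioi (0:ℝ), t ^ (s - 1) • fT μ 0 t = μ * ∫ t in Ioi (0:ℝ), t ^ s • fT μ 0 t := by
  obtain ⟨C, hC, hb⟩ := fT_bound μ hμ 0 0 (by simp) (Or.inl rfl)
  obtain ⟨D, hD, hb'⟩ := fT_bound μ hμ 0 (-s-1) (by simp; linarith) (Or.inl rfl)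
  have hi := fT_integrable μ hμ 0 (s + 1) (by simp; linarith) (Or.inl rfl)
  simp only [add_sub_cancel_right] at hi
  rw [ibp (g := fT μ 0) (g' := fun t => -μ * fT μ 0 t) (p := 0) (q := -s - 1) (C := C) (D := D)
    (fT_continuous μ 0).continuousOn ?_ (by linarith) (by linarith) (fun t ht _ => hb t ht)
    (fun t ht => hb' t (by linarith))]
  · rw [← integral_const_mul, ← integral_neg]
    congr 1; ext t; simp only [Complex.real_smul]; ring
  · have := hi.const_mul (-μ)
    refine this.congr (Eventually.of_forall fun t => ?_)
    simp only [Complex.real_smul]; ring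
  · intro t _ _
    have h0 := hasDerivAt_neg_mul μ t
    have h1 := h0.cexp
    have : fT μ 0 = fun t : ℝ => Complex.exp (-(μ * t)) := by ext t; exact fT_zero μ t
    rw [this]
    exact h1.congr_deriv (by ring)

/-- `e^{iφ}` -/
noncomputable def ex (φ : ℝ) : ℂ := Complex.exp (φ * Complex.I)

lemma ex_re (φ : ℝ) : (ex φ).re = Real.cos φ := by simp [ex, Complex.exp_ofReal_mul_I_re]

lemma norm_ex (φ : ℝ) : ‖ex φ‖ = 1 := by simp [ex, Complex.norm_exp_ofReal_mul_I]

lemma ex_hasDerivAt (φ : ℝ) : HasDerivAt ex (Complex.I * ex φ) φ := by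
  have h0 : HasDerivAt (fun t : ℝ => (t : ℂ) * Complex.I) (1 * Complex.I) φ :=
    (Complex.ofRealCLM.hasDerivAt (x := φ)).mul_const Complex.I
  have h1 := h0.cexp
  exact h1.congr_deriv (by simp [ex]; ring)

lemma ex_add (a b : ℝ) : ex (a + b) = ex a * ex b := by
  simp [ex, ← Complex.exp_add, add_mul]

lemma cos_pos_of_abs {φ : ℝ} (hφ : |φ| < Real.pi / 2) : 0 < Real.cos φ :=
  Real.cos_pos_of_mem_Ioo ⟨(abs_lt.1 hφ).1, (abs_lt.1 hφ).2⟩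

lemma rotGamma_hasDerivAt (φ s : ℝ) (hφ : |φ| < Real.pi / 2) (hs : 0 < s) :
    HasDerivAt (fun ψ => ∫ t in Ioi (0:ℝ), t ^ (s - 1) • fT (ex ψ) 0 t)
      (∫ t in Ioi (0:ℝ), t ^ (s - 1) • (-(Complex.I * ex φ * t) * fT (ex φ) 0 t)) φ := by
  have hc := cos_pos_of_abs hφ
  have hN : {ψ : ℝ | Real.cos φ / 2 < Real.cos ψ} ∈ 𝓝 φ :=
    (isOpen_lt continuous_const Real.continuous_cos).mem_nhds
      (show Real.cos φ / 2 < Real.cos φ by linarith)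
  have hmeas : ∀ ψ, AEStronglyMeasurable (fun t : ℝ => t ^ (s - 1) • fT (ex ψ) 0 t)
      (volume.restrict (Ioi 0)) := fun ψ =>
    ((continuousOn_rpow_Ioi _).smul (fT_continuous _ 0).continuousOn).aestronglyMeasurable
      measurableSet_Ioi
  refine (hasDerivAt_integral_of_dominated_loc_of_deriv_le
    (F' := fun ψ t => t ^ (s - 1) • (-(Complex.I * ex ψ * t) * fT (ex ψ) 0 t))
    (bound := fun t => t ^ s * Real.exp (-(Real.cos φ / 2) * t ^ (1:ℝ)))
    hN (Eventually.of_forall hmeas) ?_ ?_ ?_ ?_ ?_).2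
  · exact fT_integrable (ex φ) (by rw [ex_re]; exact hc) 0 s (by simpa using hs) (Or.inl rfl)
  · refine ((continuousOn_rpow_Ioi _).smul (ContinuousOn.mul ?_
      (fT_continuous _ 0).continuousOn)).aestronglyMeasurable measurableSet_Ioi
    fun_prop
  · filter_upwards [ae_restrict_mem measurableSet_Ioi] with t ht ψ hψ
    have ht' : 0 < t := ht
    rw [norm_smul, norm_mul, norm_neg, norm_mul, norm_mul, Complex.norm_I, norm_ex, Complex.norm_real,
      fT_zero, norm_exp_neg_mul, ex_re, Real.norm_of_nonneg ht'.le,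
      Real.norm_of_nonneg (by positivity), Real.rpow_one]
    have : t ^ s = t ^ (s - 1) * t := by
      rw [← Real.rpow_add_one ht'.ne']; simp
    rw [this, one_mul, one_mul, mul_assoc]
    have h1 : Real.exp (-(Real.cos ψ * t)) ≤ Real.exp (-(Real.cos φ / 2) * t) := by
      apply Real.exp_le_exp.2
      have : Real.cos φ / 2 < Real.cos ψ := hψ
      nlinarith
    gcongr
  · exact integrableOn_rpow_mul_exp_neg_mul_rpow (by linarith) one_pos (by linarith)
  · refine Eventually.of_forall fun t ψ _ => ?_
    have h1 : HasDerivAt (fun ψ : ℝ => -(ex ψ * t)) (-(Complex.I * ex ψ * t)) ψ :=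
      ((ex_hasDerivAt ψ).mul_const (t : ℂ)).neg
    have h2 := h1.cexp.const_smul (t ^ (s - 1))
    simp only [fT_zero]
    refine h2.congr_deriv ?_
    rw [mul_comm (Complex.exp _)]

lemma rotGamma_zero (φ s : ℝ) (hφ : |φ| < Real.pi / 2) (hs : 0 < s) :
    ∫ t in Ioi (0:ℝ), t ^ (s - 1) • fT (ex φ) 0 t = Real.Gamma s * ex (-(φ * s)) := by
  set A : ℝ → ℂ := fun ψ => ∫ t in Ioi (0:ℝ), t ^ (s - 1) • fT (ex ψ) 0 t with hA
  have hd : ∀ ψ ∈ Ioo (-(Real.pi / 2)) (Real.pi / 2),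
      HasDerivAt (fun ψ => A ψ * ex (ψ * s)) 0 ψ := by
    intro ψ hψ
    have hψ' : |ψ| < Real.pi / 2 := abs_lt.2 hψ
    have h1 := rotGamma_hasDerivAt ψ s hψ' hs
    have h2 : ∫ t in Ioi (0:ℝ), t ^ (s - 1) • (-(Complex.I * ex ψ * t) * fT (ex ψ) 0 t) =
        -Complex.I * (s * A ψ) := by
      have h3 := fT_ibp_zero (ex ψ) (by rw [ex_re]; exact cos_pos_of_abs hψ') s hs
      rw [Complex.real_smul] at h3
      rw [hA]; simp only
      rw [h3, ← mul_assoc, ← integral_const_mul]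
      refine setIntegral_congr_fun measurableSet_Ioi fun t ht => ?_
      have ht' : 0 < t := ht
      have : t ^ s = t ^ (s - 1) * t := by
        rw [← Real.rpow_add_one ht'.ne']; simp
      simp only [Complex.real_smul, this]
      push_cast; ring
    rw [h2] at h1
    have h4 : HasDerivAt (fun ψ : ℝ => ψ * s) s ψ := by simpa using (hasDerivAt_id ψ).mul_const s
    have h5 := (ex_hasDerivAt (ψ * s)).scomp ψ h4
    refine (h1.mul h5).congr_deriv ?_
    simp only [Complex.real_smul, Function.comp, hA]
    ring
  have hconst := IsOpen.is_const_of_deriv_eq_zero (f := fun ψ => A ψ * ex (ψ * s))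
    (isOpen_Ioo) (isPreconnected_Ioo (a := -(Real.pi/2)) (b := Real.pi/2))
    (fun ψ hψ => (hd ψ hψ).differentiableAt.differentiableWithinAt)
    (fun ψ hψ => (hd ψ hψ).deriv) (abs_lt.1 hφ)
    (show (0:ℝ) ∈ _ from ⟨by linarith [Real.pi_pos], by linarith [Real.pi_pos]⟩)
  have hA0 : A 0 = Real.Gamma s := by
    rw [Real.Gamma_eq_integral hs, ← integral_complex_ofReal, hA]
    refine setIntegral_congr_fun measurableSet_Ioi fun t ht => ?_
    simp [fT_zero, ex]
    ring
  have hinv : ex (φ * s) * ex (-(φ * s)) = 1 := by rw [← ex_add]; simp [ex]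
  have : ex (0 * s) = 1 := by simp [ex]
  rw [this, mul_one, hA0] at hconst
  rw [← hconst, mul_assoc, hinv, mul_one]

/-- Cauchy–Saalschütz -/
lemma rotGamma (φ : ℝ) (hφ : |φ| < Real.pi / 2) (K : ℕ) : ∀ s : ℝ, 0 < s + K →
    (K = 0 ∨ s + K - 1 < 0) →
    ∫ t in Ioi (0:ℝ), t ^ (s - 1) • fT (ex φ) K t = Real.Gamma s * ex (-(φ * s)) := by
  have hμ : 0 < (ex φ).re := by rw [ex_re]; exact cos_pos_of_abs hφ
  induction K with
  | zero => intro s hs _; exact rotGamma_zero φ s hφ (by simpa using hs)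
  | succ K ih =>
    intro s h1 h2
    have h2' : s + K < 0 := by
      rcases h2 with h | h
      · simp at h
      · push_cast at h; linarith
    push_cast at h1
    have hs : s < 0 := by have : (0:ℝ) ≤ K := K.cast_nonneg; linarith
    have h3 : K = 0 ∨ (s + 1) + K - 1 < 0 := Or.inr (by linarith)
    have h4 : 0 < (s + 1) + K := by linarith
    have ih' := ih (s + 1) h4 h3
    have hi := fT_integrable (ex φ) hμ K (s + 1) h4 h3
    simp only [add_sub_cancel_right] at hi ih'
    obtain ⟨C, hC, hb⟩ := fT_bound (ex φ) hμ (K + 1) (K + 1) (by simp) (Or.inr (by simp))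
    obtain ⟨D, hD, hb'⟩ := fT_bound (ex φ) hμ (K + 1) K (by simp) (Or.inr (by simp))
    have := ibp (g := fT (ex φ) (K + 1)) (g' := fun t => -(ex φ) * fT (ex φ) K t)
      (s := s) (p := K + 1) (q := K) (C := C) (D := D)
      (fT_continuous _ _).continuousOn (fun t _ _ => fT_hasDerivAt _ K t) (by linarith) (by linarith)
      (fun t ht _ => hb t ht) (fun t ht => hb' t (by linarith)) (by
        have := hi.const_mul (-(ex φ))
        refine this.congr (Eventually.of_forall fun t => ?_)
        simp only [Complex.real_smul]; ring)
    have h5 : ∫ t in Ioi (0:ℝ), t ^ s • (-(ex φ) * fT (ex φ) K t) =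
        -(ex φ) * (Real.Gamma (s + 1) * ex (-(φ * (s + 1)))) := by
      rw [← ih', ← integral_const_mul]
      congr 1; ext t; simp only [Complex.real_smul]; ring
    rw [h5, Real.Gamma_add_one hs.ne, Complex.real_smul] at this
    have hsc : (s : ℂ) ≠ 0 := by exact_mod_cast hs.ne
    apply mul_left_cancel₀ hsc
    rw [this, show -(φ * s) = -(φ * (s + 1)) + φ by ring, ex_add]
    push_cast; ring

lemma rotGamma_scaled (φ s y : ℝ) (hφ : |φ| < Real.pi / 2) (hs : 0 < s) (hy : 0 < y) :
    ∫ t in Ioi (0:ℝ), t ^ (s - 1) • Complex.exp (-(ex φ * y * t)) =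
      Real.Gamma s * ex (-(φ * s)) * (y ^ (-s) : ℝ) := by
  have h := integral_comp_mul_left_Ioi (fun t : ℝ => t ^ (s - 1) • fT (ex φ) 0 t) 0 hy
  rw [mul_zero, rotGamma_zero φ s hφ hs] at h
  have h2 : ∫ t in Ioi (0:ℝ), (y * t) ^ (s - 1) • fT (ex φ) 0 (y * t) =
      (y ^ (s - 1) : ℝ) * ∫ t in Ioi (0:ℝ), t ^ (s - 1) • Complex.exp (-(ex φ * y * t)) := by
    rw [← integral_const_mul]
    refine setIntegral_congr_fun measurableSet_Ioi fun t ht => ?_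
    have ht' : 0 < t := ht
    simp only [fT_zero, Complex.real_smul, Real.mul_rpow hy.le ht'.le]
    push_cast
    rw [← mul_assoc (ex φ)]; ring
  rw [h2, Complex.real_smul] at h
  have h3 : (y ^ (s - 1) : ℝ) ≠ 0 := by positivity
  have h3' : ((y ^ (s - 1) : ℝ) : ℂ) ≠ 0 := by exact_mod_cast h3
  apply mul_left_cancel₀ h3'
  have h4 : y⁻¹ = y ^ (s - 1) * y ^ (-s) := by
    rw [← Real.rpow_add hy, show s - 1 + -s = -1 by ring, Real.rpow_neg_one]
  rw [h, h4]
  push_cast; ring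

/-! ### The beta kernel with its Taylor polynomial removed -/

lemma inv_Gamma (z : ℝ) : (Real.Gamma z)⁻¹ = z * (Real.Gamma (z + 1))⁻¹ := by
  rcases eq_or_ne z 0 with h | h
  · simp [h, Real.Gamma_zero]
  · rw [Real.Gamma_add_one h, mul_inv, ← mul_assoc, mul_inv_cancel₀ h, one_mul]

noncomputable def pc (c : ℝ) (k : ℕ) : ℝ := (-1) ^ k / (k.factorial : ℝ) * (Real.Gamma (c - 1 - k))⁻¹

noncomputable def wB (c u : ℝ) : ℝ := if u < 1 then (1 - u) ^ (c - 2) * (Real.Gamma (c - 1))⁻¹ else 0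

noncomputable def wT (c : ℝ) (M : ℕ) (u : ℝ) : ℝ := wB c u - ∑ k ∈ Finset.range M, pc c k * u ^ k

lemma wT_succ (c : ℝ) (M : ℕ) (u : ℝ) : wT c M u = wT c (M + 1) u + pc c M * u ^ M := by
  simp only [wT, Finset.sum_range_succ]; ring

lemma pc_succ (c : ℝ) (k : ℕ) : pc (c + 1) (k + 1) * ((k : ℝ) + 1) = - pc c k := by
  unfold pc
  rw [show c + 1 - 1 - ((k + 1 : ℕ) : ℝ) = c - 1 - k by push_cast; ring, Nat.factorial_succ]
  have : (k.factorial : ℝ) ≠ 0 := by exact_mod_cast k.factorial_ne_zero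
  have : ((k : ℝ) + 1) ≠ 0 := by positivity
  push_cast
  field_simp
  ring

lemma pc_rel (c : ℝ) (k : ℕ) : pc c (k + 1) - pc c k = (c - 1) * pc (c + 1) (k + 1) := by
  unfold pc
  rw [show c + 1 - 1 - ((k + 1 : ℕ) : ℝ) = c - 1 - k by push_cast; ring, Nat.factorial_succ,
    inv_Gamma (c - 1 - ((k + 1 : ℕ) : ℝ)),
    show c - 1 - ((k + 1 : ℕ) : ℝ) + 1 = c - 1 - k by push_cast; ring]
  have : (k.factorial : ℝ) ≠ 0 := by exact_mod_cast k.factorial_ne_zero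
  have : ((k : ℝ) + 1) ≠ 0 := by positivity
  push_cast
  field_simp
  ring

lemma wB_hasDerivAt (c u : ℝ) (hu : u ≠ 1) : HasDerivAt (wB (c + 1)) (-wB c u) u := by
  rcases lt_or_gt_of_ne hu with h | h
  · have h1 : HasDerivAt (fun u : ℝ => 1 - u) (-1) u := by simpa using (hasDerivAt_id u).const_sub 1
    have h2 := (h1.rpow_const (p := c + 1 - 2) (Or.inl (by linarith : (1:ℝ) - u ≠ 0))).mul_const
      (Real.Gamma (c + 1 - 1))⁻¹
    have h3 : wB (c + 1) =ᶠ[𝓝 u] fun u => (1 - u) ^ (c + 1 - 2) * (Real.Gamma (c + 1 - 1))⁻¹ := by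
      filter_upwards [Iio_mem_nhds h] with v hv
      have : v < 1 := hv
      simp [wB, this]
    refine (h2.congr_of_eventuallyEq h3).congr_deriv ?_
    rw [wB, if_pos h, inv_Gamma (c - 1)]
    rw [show c + 1 - 2 - 1 = c - 2 by ring, show c - 1 + 1 = c by ring, show c + 1 - 1 = c by ring]
    ring
  · have h3 : wB (c + 1) =ᶠ[𝓝 u] fun _ => 0 := by
      filter_upwards [Ioi_mem_nhds h] with v hv
      have : ¬ v < 1 := not_lt.2 (le_of_lt hv)
      simp [wB, this]
    refine ((hasDerivAt_const u (0:ℝ)).congr_of_eventuallyEq h3).congr_deriv ?_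
    simp [wB, not_lt.2 h.le]

lemma wT_hasDerivAt (c : ℝ) (M : ℕ) (u : ℝ) (hu : u ≠ 1) :
    HasDerivAt (wT (c + 1) (M + 1)) (-wT c M u) u := by
  have h2 : ∀ k ∈ Finset.range (M + 1), HasDerivAt (fun u : ℝ => pc (c + 1) k * u ^ k)
      (pc (c + 1) k * ((k : ℝ) * u ^ (k - 1))) u := fun k _ =>
    (hasDerivAt_pow k u).const_mul _
  refine ((wB_hasDerivAt c u hu).sub (HasDerivAt.fun_sum h2)).congr_deriv ?_
  rw [Finset.sum_range_succ', wT]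
  simp only [Nat.cast_zero, zero_mul, mul_zero, add_zero]
  rw [neg_sub, sub_eq_add_neg (- wB c u), add_comm, ← sub_eq_add_neg]
  congr 1
  rw [← Finset.sum_neg_distrib]
  apply Finset.sum_congr rfl
  intro k _
  have := pc_succ c k
  rw [Nat.add_sub_cancel]; push_cast
  rw [← mul_assoc, this]; ring

lemma wT_zero_at (c : ℝ) (M : ℕ) : wT c (M + 1) 0 = 0 := by
  rw [wT, Finset.sum_range_succ']
  simp [wB, pc]

lemma wT_bound_small (M : ℕ) : ∀ c : ℝ, ∃ C : ℝ, 0 ≤ C ∧ ∀ u : ℝ, 0 ≤ u → u ≤ 1 / 2 →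
    |wT c M u| ≤ C * u ^ M := by
  induction M with
  | zero =>
    intro c
    have hc : ContinuousOn (fun u : ℝ => (1 - u) ^ (c - 2) * (Real.Gamma (c - 1))⁻¹) (Icc 0 (1/2)) := by
      apply ContinuousOn.mul _ continuousOn_const
      apply ContinuousOn.rpow_const (by fun_prop)
      intro u hu; left; linarith [hu.2]
    obtain ⟨C, hC⟩ := isCompact_Icc.exists_bound_of_continuousOn hc
    refine ⟨|C|, abs_nonneg _, fun u h0 h1 => ?_⟩
    have := hC u ⟨h0, h1⟩
    have hu : u < 1 := by linarith
    simp only [wT, wB, hu, if_true, Finset.range_zero, Finset.sum_empty, sub_zero, pow_zero, mul_one]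
    exact (this.trans (le_abs_self C))
  | succ M ih =>
    intro c
    obtain ⟨C, hC, h⟩ := ih (c - 1)
    refine ⟨C, hC, fun u h0 h1 => ?_⟩
    have hd : ∀ v ∈ Icc 0 u, HasDerivWithinAt (wT c (M + 1)) (-wT (c - 1) M v) (Icc 0 u) v := by
      intro v hv
      have := wT_hasDerivAt (c - 1) M v (by linarith [hv.2])
      rw [sub_add_cancel] at this
      exact this.hasDerivWithinAt
    have := Convex.norm_image_sub_le_of_norm_hasDerivWithin_le (C := C * u ^ M) hd
      (fun v hv => by
        rw [norm_neg, Real.norm_eq_abs]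
        refine (h v hv.1 (hv.2.trans h1)).trans ?_
        have := hv.1
        have := hv.2
        gcongr) (convex_Icc 0 u) (left_mem_Icc.2 h0) (right_mem_Icc.2 h0)
    rw [wT_zero_at, sub_zero, sub_zero, Real.norm_eq_abs, Real.norm_of_nonneg h0] at this
    rw [pow_succ, ← mul_assoc]; exact this

lemma wT_bound_large (c : ℝ) (M : ℕ) : ∃ C : ℝ, 0 ≤ C ∧ ∀ u : ℝ, 1 ≤ u →
    |wT c (M + 1) u| ≤ C * u ^ M := by
  refine ⟨∑ k ∈ Finset.range (M + 1), |pc c k|, by positivity, fun u hu => ?_⟩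
  rw [wT, wB, if_neg (not_lt.2 hu), zero_sub, abs_neg, Finset.sum_mul]
  refine (Finset.abs_sum_le_sum_abs _ _).trans (Finset.sum_le_sum fun k hk => ?_)
  rw [abs_mul, abs_of_nonneg (by positivity : (0:ℝ) ≤ u ^ k)]
  have : k ≤ M := Nat.lt_succ_iff.1 (Finset.mem_range.1 hk)
  gcongr

lemma wT_zero_large (c u : ℝ) (hu : 1 ≤ u) : wT c 0 u = 0 := by
  simp [wT, wB, not_lt.2 hu]

lemma wB_continuous (c : ℝ) (hc : 2 < c) : Continuous (wB c) := by
  have : wB c = fun u => (max (1 - u) 0) ^ (c - 2) * (Real.Gamma (c - 1))⁻¹ := by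
    ext u
    unfold wB
    split_ifs with h
    · rw [max_eq_left (by linarith)]
    · rw [max_eq_right (by linarith), Real.zero_rpow (by linarith), zero_mul]
  rw [this]
  apply Continuous.mul _ continuous_const
  apply Continuous.rpow_const (by fun_prop)
  intro u; right; linarith

lemma wT_continuous (c : ℝ) (hc : 2 < c) (M : ℕ) : Continuous (wT c M) := by
  unfold wT
  exact (wB_continuous c hc).sub (by fun_prop)

lemma wT_bound_unit (c : ℝ) (hc : 2 < c) (M : ℕ) : ∃ C : ℝ, 0 ≤ C ∧ ∀ u : ℝ, 0 < u → u ≤ 1 →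
    |wT c M u| ≤ C * u ^ M := by
  obtain ⟨C1, hC1, h1⟩ := wT_bound_small M c
  obtain ⟨C2, h2⟩ := (isCompact_Icc (a := (0:ℝ)) (b := 1)).exists_bound_of_continuousOn
    (wT_continuous c hc M).continuousOn
  refine ⟨C1 + |C2| * 2 ^ M, by positivity, fun u h0 hu => ?_⟩
  have hpos : 0 ≤ u ^ M := by positivity
  rw [add_mul]
  rcases le_total u (1/2) with h | h
  · have := h1 u h0.le h
    have : 0 ≤ |C2| * 2 ^ M * u ^ M := by positivity
    linarith
  · have h3 := (h2 u ⟨h0.le, hu⟩).trans (le_abs_self C2)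
    rw [Real.norm_eq_abs] at h3
    have h4 : 1 ≤ (2:ℝ) ^ M * u ^ M := by
      rw [← mul_pow]; exact one_le_pow₀ (by linarith)
    have : 0 ≤ C1 * u ^ M := by positivity
    nlinarith [abs_nonneg C2]

lemma wB_measurable (c : ℝ) : Measurable (wB c) := by
  unfold wB
  apply Measurable.ite measurableSet_Iio _ measurable_const
  fun_prop

lemma wT_measurable (c : ℝ) (M : ℕ) : Measurable (wT c M) := by
  unfold wT
  exact (wB_measurable c).sub (by fun_prop)

lemma wT_integrableOn_mid (c : ℝ) (hc : 1 < c) (M : ℕ) : IntegrableOn (wT c M) (Icc (1/2) 1) := by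
  unfold wT
  apply Integrable.sub
  · have h1 : IntervalIntegrable (fun u : ℝ => (1 - u) ^ (c - 2)) volume (1 - 1/2) (1 - 0) := by
      have := (intervalIntegral.intervalIntegrable_rpow' (a := 0) (b := 1/2) (r := c - 2) (by linarith))
      exact (this.comp_sub_left 1).symm
    rw [show (1:ℝ) - 1/2 = 1/2 by norm_num, sub_zero,
      intervalIntegrable_iff_integrableOn_Icc_of_le (by norm_num)] at h1
    have h2 := h1.mul_const |(Real.Gamma (c - 1))⁻¹|
    refine Integrable.mono' h2 (wB_measurable c).aestronglyMeasurable ?_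
    filter_upwards [ae_restrict_mem measurableSet_Icc] with u hu
    have : 0 ≤ (1 - u) ^ (c - 2) := Real.rpow_nonneg (by linarith [hu.2]) _
    rw [Real.norm_eq_abs, wB]
    split_ifs with h
    · rw [abs_mul, abs_of_nonneg this]
    · simp only [abs_zero]; positivity
  · apply Continuous.integrableOn_Icc; fun_prop

lemma wT_integrable (c : ℝ) (hc : 1 < c) (M : ℕ) (s : ℝ) (hs : s < M + 1) (hs' : M = 0 ∨ (M : ℝ) < s) :
    IntegrableOn (fun u : ℝ => u ^ (-s) • wT c M u) (Ioi 0) := by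
  have hm : Measurable (fun u : ℝ => u ^ (-s) • wT c M u) := by
    have := wT_measurable c M
    simp only [smul_eq_mul]
    fun_prop
  have hsplit : Ioi (0:ℝ) = Ioc 0 (1/2) ∪ Icc (1/2) 1 ∪ Ioi 1 := by
    ext u; simp only [mem_Ioi, mem_union, mem_Ioc, mem_Icc]
    constructor
    · intro h; by_cases h1 : u ≤ 1/2
      · exact Or.inl (Or.inl ⟨h, h1⟩)
      · by_cases h2 : u ≤ 1
        · exact Or.inl (Or.inr ⟨by linarith, h2⟩)
        · exact Or.inr (by linarith)
    · rintro ((h | h) | h) <;> linarith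
  rw [hsplit]
  refine IntegrableOn.union (IntegrableOn.union ?_ ?_) ?_
  · obtain ⟨C, hC, hb⟩ := wT_bound_small M c
    have h := (intervalIntegral.integrableOn_Ioo_rpow_iff (s := M - s) (t := 1/2) (by norm_num)).2
      (by linarith)
    rw [← integrableOn_Ioc_iff_integrableOn_Ioo] at h
    refine Integrable.mono' (h.const_mul C) hm.aestronglyMeasurable ?_
    filter_upwards [ae_restrict_mem measurableSet_Ioc] with u hu
    have hu0 := hu.1
    rw [norm_smul, Real.norm_of_nonneg (by positivity), Real.norm_eq_abs, sub_eq_neg_add,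
      Real.rpow_add hu0, Real.rpow_natCast]
    calc _ ≤ u ^ (-s) * (C * u ^ M) := by gcongr; exact hb u hu.1.le hu.2
      _ = _ := by ring
  · simp only [smul_eq_mul]
    refine IntegrableOn.continuousOn_mul ?_ (wT_integrableOn_mid c hc M) isCompact_Icc
    exact (continuousOn_rpow_Ioi (-s)).mono fun u hu => lt_of_lt_of_le (by norm_num) hu.1
  · rcases M with _ | M
    · refine (integrableOn_zero).congr_fun (fun u hu => ?_) measurableSet_Ioi
      rw [wT_zero_large c u (le_of_lt hu), smul_zero]
    · have hs'' : (M : ℝ) + 1 < s := by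
        rcases hs' with h | h
        · simp at h
        · push_cast at h; exact h
      obtain ⟨C, hC, hb⟩ := wT_bound_large c M
      have h := (integrableOn_Ioi_rpow_of_lt (a := M - s) (c := 1) (by linarith) one_pos)
      refine Integrable.mono' (h.const_mul C) hm.aestronglyMeasurable ?_
      filter_upwards [ae_restrict_mem measurableSet_Ioi] with u hu
      have hu1 : 1 < u := hu
      have hu0 : 0 < u := by linarith
      rw [norm_smul, Real.norm_of_nonneg (by positivity), Real.norm_eq_abs, sub_eq_neg_add,
        Real.rpow_add hu0, Real.rpow_natCast]
      calc _ ≤ u ^ (-s) * (C * u ^ M) := by gcongr; exact hb u hu1.le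
        _ = _ := by ring

lemma wInt_zero (c : ℝ) (hc : 1 < c) (s : ℝ) (hs : s < 1) :
    ∫ u in Ioi (0:ℝ), u ^ (-s) • wT c 0 u = Real.Gamma (1 - s) * (Real.Gamma (c - s))⁻¹ := by
  have h1 : ∫ u in Ioi (0:ℝ), u ^ (-s) • wT c 0 u =
      ∫ u in (0:ℝ)..1, u ^ (-s) * (1 - u) ^ (c - 2) * (Real.Gamma (c - 1))⁻¹ := by
    have hi := wT_integrable c hc 0 s (by simpa using hs) (Or.inl rfl)
    rw [← Ioc_union_Ioi_eq_Ioi (zero_le_one (α := ℝ)), setIntegral_union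
      (Ioc_disjoint_Ioi le_rfl) measurableSet_Ioi (hi.mono_set Ioc_subset_Ioi_self)
      (hi.mono_set (Ioi_subset_Ioi zero_le_one)),
      setIntegral_eq_zero_of_forall_eq_zero (t := Ioi 1)
        (fun u hu => by rw [wT_zero_large c u (le_of_lt hu), smul_zero]), add_zero,
      intervalIntegral.integral_of_le zero_le_one, integral_Ioc_eq_integral_Ioo,
      integral_Ioc_eq_integral_Ioo]
    refine setIntegral_congr_fun measurableSet_Ioo fun u hu => ?_
    simp [wT, wB, hu.2, mul_assoc]
  have h2 := Complex.betaIntegral_eq_Gamma_mul_div ((1 - s : ℝ) : ℂ) ((c - 1 : ℝ) : ℂ)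
    (by rw [Complex.ofReal_re]; linarith) (by rw [Complex.ofReal_re]; linarith)
  have h3 : Complex.betaIntegral ((1 - s : ℝ) : ℂ) ((c - 1 : ℝ) : ℂ) =
      ((∫ u in (0:ℝ)..1, u ^ (-s) * (1 - u) ^ (c - 2) : ℝ) : ℂ) := by
    rw [Complex.betaIntegral, ← intervalIntegral.integral_ofReal]
    refine intervalIntegral.integral_congr fun u hu => ?_
    rw [uIcc_of_le zero_le_one] at hu
    simp only [Complex.ofReal_mul]
    rw [Complex.ofReal_cpow hu.1, Complex.ofReal_cpow (by linarith [hu.2])]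
    push_cast
    congr 2 <;> ring
  rw [h3, ← Complex.ofReal_add, Complex.Gamma_ofReal, Complex.Gamma_ofReal, Complex.Gamma_ofReal,
    show 1 - s + (c - 1) = c - s by ring] at h2
  have h4 : (∫ u in (0:ℝ)..1, u ^ (-s) * (1 - u) ^ (c - 2)) =
    Real.Gamma (1 - s) * Real.Gamma (c - 1) / Real.Gamma (c - s) := by exact_mod_cast h2
  rw [h1, intervalIntegral.integral_mul_const, h4]
  have : Real.Gamma (c - 1) ≠ 0 := (Real.Gamma_pos_of_pos (by linarith)).ne'
  field_simp

lemma wT_rel (c : ℝ) (hc : 1 < c) (M : ℕ) (u : ℝ) (hu : u ≠ 1) :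
    wT c (M + 1) u - u * wT c M u = (c - 1) * wT (c + 1) (M + 1) u := by
  have h1 : wB c u - u * wB c u = (c - 1) * wB (c + 1) u := by
    unfold wB
    split_ifs with h
    · have h2 := inv_Gamma (c - 1)
      rw [show c + 1 - 2 = c - 2 + 1 by ring, Real.rpow_add_one (by linarith), h2,
        show c + 1 - 1 = c - 1 + 1 by ring]
      ring
    · simp
  have h2 : ∑ k ∈ Finset.range (M + 1), pc c k * u ^ k - u * ∑ k ∈ Finset.range M, pc c k * u ^ k =
      (c - 1) * ∑ k ∈ Finset.range (M + 1), pc (c + 1) k * u ^ k := by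
    rw [Finset.sum_range_succ', Finset.sum_range_succ', mul_add, Finset.mul_sum, Finset.mul_sum,
      add_sub_right_comm, ← Finset.sum_sub_distrib]
    congr 1
    · apply Finset.sum_congr rfl
      intro k _
      linear_combination (u ^ (k + 1)) * pc_rel c k
    · have h2 := inv_Gamma (c - 1)
      simp only [pc, pow_zero, Nat.factorial_zero, Nat.cast_one, Nat.cast_zero, sub_zero, mul_one, div_one, one_mul]
      rw [h2, show c + 1 - 1 = c - 1 + 1 by ring]
  unfold wT
  rw [mul_sub, mul_sub, ← h1, ← h2]; ring

lemma wInt (c : ℝ) (hc : 1 < c) (M : ℕ) : ∀ s : ℝ, (M : ℝ) < s → s < M + 1 →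
    ∫ u in Ioi (0:ℝ), u ^ (-s) • wT c M u = Real.Gamma (1 - s) * (Real.Gamma (c - s))⁻¹ := by
  induction M with
  | zero => intro s _ h; exact wInt_zero c hc s (by simpa using h)
  | succ M ih =>
    intro s h1 h2
    push_cast at h1 h2
    have hM : (0:ℝ) ≤ M := M.cast_nonneg
    have ih' := ih (s - 1) (by linarith) (by linarith)
    have hi1 := wT_integrable c hc (M + 1) s (by push_cast; linarith) (Or.inr (by push_cast; linarith))
    have hi2 := wT_integrable c hc M (s - 1) (by linarith) (Or.inr (by linarith))
    obtain ⟨C, hC, hb⟩ := wT_bound_unit (c + 1) (by linarith) (M + 1)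
    obtain ⟨D, hD, hb'⟩ := wT_bound_large (c + 1) M
    have hibp := ibp (g := wT (c + 1) (M + 1)) (g' := fun u => - wT c M u) (s := 1 - s)
      (p := M + 1) (q := M) (C := C) (D := D)
      (wT_continuous (c + 1) (by linarith) _).continuousOn
      (fun u _ hu => wT_hasDerivAt c M u hu) (by linarith) (by linarith)
      (fun u h0 h1 => by
        rw [Real.norm_eq_abs]; have := hb u h0 h1
        rw [← Real.rpow_natCast] at this; push_cast at this; exact this)
      (fun u h1 => by
        rw [Real.norm_eq_abs]; have := hb' u h1
        rw [← Real.rpow_natCast] at this; exact this)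
      (by
        refine hi2.neg.congr (Eventually.of_forall fun u => ?_)
        simp)
    have e1 : ∫ u in Ioi (0:ℝ), u ^ (1 - s) • (- wT c M u) =
        - ∫ u in Ioi (0:ℝ), u ^ (-(s - 1)) • wT c M u := by
      rw [← integral_neg]; congr 1; ext u; simp
    have e2 : (c - 1) * ∫ u in Ioi (0:ℝ), u ^ (1 - s - 1) • wT (c + 1) (M + 1) u =
        (∫ u in Ioi (0:ℝ), u ^ (-s) • wT c (M + 1) u) -
          ∫ u in Ioi (0:ℝ), u ^ (-(s - 1)) • wT c M u := by
      rw [← integral_sub hi1 hi2, ← integral_const_mul]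
      apply integral_congr_ae
      have hne : ∀ᵐ u ∂(volume.restrict (Ioi (0:ℝ))), u ≠ 1 :=
        ae_restrict_of_ae (Measure.ae_ne volume 1)
      filter_upwards [ae_restrict_mem measurableSet_Ioi, hne] with u hu hu1
      have hu0 : 0 < u := hu
      simp only [smul_eq_mul]
      rw [show 1 - s - 1 = -s by ring, show -(s - 1) = -s + 1 by ring, Real.rpow_add_one hu0.ne']
      have := wT_rel c hc M u hu1
      linear_combination (-u ^ (-s)) * this
    rw [e1, neg_neg, ih', smul_eq_mul] at hibp
    rw [ih'] at e2
    have hs1 : 1 - s ≠ 0 := by linarith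
    rw [show 1 - (s - 1) = (1 - s) + 1 by ring, Real.Gamma_add_one hs1,
      show c - (s - 1) = c - s + 1 by ring] at hibp e2
    rw [inv_Gamma (c - s)]
    have e3 : ∫ u in Ioi (0:ℝ), u ^ (1 - s - 1) • wT (c + 1) (M + 1) u =
        Real.Gamma (1 - s) * (Real.Gamma (c - s + 1))⁻¹ := by
      apply mul_left_cancel₀ hs1
      rw [hibp]; ring
    rw [e3] at e2
    linear_combination -e2

/-! ### The function `G` -/

noncomputable def gI (φ δ σ b : ℝ) (K : ℕ) (y t : ℝ) : ℂ :=
  t ^ (b - 1) • (fT (ex φ) K t * Complex.exp (-(ex δ * y * (t ^ σ : ℝ))))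

noncomputable def G (φ δ σ b : ℝ) (K : ℕ) (y : ℝ) : ℂ :=
  ∫ t in Ioi (0:ℝ), gI φ δ σ b K y t

lemma norm_exp_neg_mul_mul (δ y v : ℝ) :
    ‖Complex.exp (-(ex δ * y * v))‖ = Real.exp (-(Real.cos δ * y) * v) := by
  rw [mul_assoc, ← Complex.ofReal_mul, norm_exp_neg_mul, ex_re]
  congr 1; ring

lemma gI_measurable (φ δ σ b : ℝ) (K : ℕ) :
    Measurable (fun p : ℝ × ℝ => gI φ δ σ b K p.1 p.2) := by
  unfold gI
  have := (fT_continuous (ex φ) K).measurable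
  fun_prop

lemma gI_bound (φ δ σ b : ℝ) (hφ : |φ| < Real.pi / 2) (K : ℕ) (r : ℝ)
    (h1 : σ * r ≤ K + b) (h2 : K = 0 ∨ (K : ℝ) - 1 + b ≤ σ * r) :
    ∃ C : ℝ, 0 ≤ C ∧ ∀ y t : ℝ, 0 < t →
      ‖gI φ δ σ b K y t‖ ≤ C * (t ^ (σ * r - 1) * Real.exp (-(Real.cos δ * y) * t ^ σ)) := by
  have hμ : 0 < (ex φ).re := by rw [ex_re]; exact cos_pos_of_abs hφ
  obtain ⟨C, hC, hb⟩ := fT_bound (ex φ) hμ K (σ * r - b) (by linarith)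
    (h2.imp id fun h => by linarith)
  refine ⟨C, hC, fun y t ht => ?_⟩
  rw [gI, norm_smul, norm_mul, norm_exp_neg_mul_mul, Real.norm_of_nonneg (by positivity),
    show σ * r - 1 = (b - 1) + (σ * r - b) by ring, Real.rpow_add ht]
  have := hb t ht
  calc _ ≤ t ^ (b - 1) * (C * t ^ (σ * r - b) * Real.exp (-(Real.cos δ * y) * t ^ σ)) := by gcongr
    _ = _ := by ring

lemma gI_integrable' (φ δ σ b : ℝ) (hφ : |φ| < Real.pi / 2) (hδ : |δ| < Real.pi / 2) (hσ : 0 < σ)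
    (K : ℕ) (r : ℝ) (hr : 0 < r)
    (h1 : σ * r ≤ K + b) (h2 : K = 0 ∨ (K : ℝ) - 1 + b ≤ σ * r) (y : ℝ) (hy : 0 < y) :
    IntegrableOn (gI φ δ σ b K y) (Ioi 0) := by
  obtain ⟨C, hC, hb⟩ := gI_bound φ δ σ b hφ K r h1 h2
  have hc := cos_pos_of_abs hδ
  have h := integrableOn_rpow_mul_exp_neg_mul_rpow (p := σ) (s := σ * r - 1) (b := Real.cos δ * y)
    (by nlinarith) hσ (by positivity)
  refine Integrable.mono' (h.const_mul C)
    ((gI_measurable φ δ σ b K).comp measurable_prodMk_left).aestronglyMeasurable ?_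
  filter_upwards [ae_restrict_mem measurableSet_Ioi] with t ht
  exact hb y t ht

lemma gI_integrable (φ δ σ b : ℝ) (hφ : |φ| < Real.pi / 2) (hδ : |δ| < Real.pi / 2) (hσ : 0 < σ)
    (hb : 0 < b) (K : ℕ) (y : ℝ) (hy : 0 < y) :
    IntegrableOn (gI φ δ σ b K y) (Ioi 0) := by
  have e : σ * ((K + b) / σ) = K + b := by field_simp
  exact gI_integrable' φ δ σ b hφ hδ hσ K ((K + b) / σ) (by positivity) e.le
    (Or.inr (by rw [e]; linarith)) y hy

lemma G_bound (φ δ σ b : ℝ) (hφ : |φ| < Real.pi / 2) (hδ : |δ| < Real.pi / 2) (hσ : 0 < σ)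
    (K : ℕ) (r : ℝ) (hr : 0 < r)
    (h1 : σ * r ≤ K + b) (h2 : K = 0 ∨ (K : ℝ) - 1 + b ≤ σ * r) :
    ∃ C : ℝ, 0 ≤ C ∧ ∀ y : ℝ, 0 < y → ‖G φ δ σ b K y‖ ≤ C * y ^ (-r) := by
  obtain ⟨C, hC, hb⟩ := gI_bound φ δ σ b hφ K r h1 h2
  have hc := cos_pos_of_abs hδ
  have hG := (Real.Gamma_pos_of_pos hr).le
  refine ⟨C * (Real.cos δ ^ (-r) * (1 / σ) * Real.Gamma r), by positivity, fun y hy => ?_⟩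
  have hq : -1 < σ * r - 1 := by nlinarith
  have h := integrableOn_rpow_mul_exp_neg_mul_rpow (p := σ) (s := σ * r - 1) (b := Real.cos δ * y)
    hq hσ (by positivity)
  have h' := integral_rpow_mul_exp_neg_mul_rpow (p := σ) (q := σ * r - 1) (b := Real.cos δ * y)
    hσ hq (by positivity)
  have e1 : (σ * r - 1 + 1) / σ = r := by field_simp; ring
  have e2 : -(σ * r - 1 + 1) / σ = -r := by rw [neg_div, e1]
  rw [e1, e2, Real.mul_rpow hc.le hy.le] at h'
  have h3 : ‖G φ δ σ b K y‖ ≤ ∫ t in Ioi (0:ℝ),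
      C * (t ^ (σ * r - 1) * Real.exp (-(Real.cos δ * y) * t ^ σ)) := by
    refine norm_integral_le_of_norm_le (h.const_mul C) ?_
    filter_upwards [ae_restrict_mem measurableSet_Ioi] with t ht
    exact hb y t ht
  rw [integral_const_mul, h'] at h3
  refine h3.trans (le_of_eq ?_)
  ring

lemma G_measurable (φ δ σ b : ℝ) (K : ℕ) : StronglyMeasurable (G φ δ σ b K) := by
  unfold G
  exact (gI_measurable φ δ σ b K).stronglyMeasurable.integral_prod_right

lemma G_step (φ δ σ b : ℝ) (hφ : |φ| < Real.pi / 2) (hδ : |δ| < Real.pi / 2) (hσ : 0 < σ)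
    (hb : 0 < b) (K : ℕ) (y : ℝ) (hy : 0 < y) :
    G φ δ σ b K y = G φ δ σ b (K + 1) y +
      ((-(ex φ)) ^ K / (K.factorial : ℂ)) * ((1 / σ : ℝ) * (Real.Gamma ((K + b) / σ) *
        ex (-(δ * ((K + b) / σ))))) * (y ^ (-((K + b) / σ)) : ℝ) := by
  have hi1 := gI_integrable φ δ σ b hφ hδ hσ hb K y hy
  have hi2 := gI_integrable φ δ σ b hφ hδ hσ hb (K + 1) y hy
  rw [add_comm (G φ δ σ b (K + 1) y), ← sub_eq_iff_eq_add]
  unfold G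
  rw [← integral_sub hi1 hi2]
  have hs : 0 < (K + b) / σ := by positivity
  have h1 := rotGamma_scaled δ ((K + b) / σ) y hδ hs hy
  rw [← integral_comp_rpow_Ioi_of_pos hσ] at h1
  have h2 : ∫ t in Ioi (0:ℝ), (gI φ δ σ b K y t - gI φ δ σ b (K + 1) y t) =
      ((-(ex φ)) ^ K / (K.factorial : ℂ)) * (1 / σ : ℝ) *
      ∫ x in Ioi (0:ℝ), (σ * x ^ (σ - 1)) • (x ^ σ) ^ ((K + b) / σ - 1) •
        Complex.exp (-(ex δ * y * (x ^ σ : ℝ))) := by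
    rw [← integral_const_mul]
    refine setIntegral_congr_fun measurableSet_Ioi fun t ht => ?_
    have ht' : 0 < t := ht
    have e1 : (t ^ σ) ^ ((K + b) / σ - 1) = t ^ (b - 1) * t ^ K * (t ^ (σ - 1))⁻¹ := by
      rw [← Real.rpow_mul ht'.le, ← Real.rpow_natCast, ← Real.rpow_neg ht'.le, ← Real.rpow_add ht',
        ← Real.rpow_add ht']
      congr 1
      field_simp
      ring
    have e2 : (t ^ (σ - 1) : ℝ) ≠ 0 := by positivity
    simp only [gI, fT_succ (ex φ) K t, Complex.real_smul, e1]
    have e3 : ((t ^ (σ - 1) : ℝ) : ℂ) ≠ 0 := by exact_mod_cast e2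
    have e4 : (σ : ℂ) ≠ 0 := by exact_mod_cast hσ.ne'
    rw [← neg_mul, mul_pow]
    push_cast
    field_simp
    ring
  rw [h2, h1]
  ring

lemma G_mellin (φ δ σ b : ℝ) (hφ : |φ| < Real.pi / 2) (hδ : |δ| < Real.pi / 2)
    (K M : ℕ) (h1 : σ * (M + 1) < K + b) (h2 : K = 0 ∨ (K : ℝ) - 1 + b < σ * (M + 1)) :
    ∫ y in Ioi (0:ℝ), ((y ^ M : ℝ) : ℂ) * G φ δ σ b K y =
      (M.factorial : ℂ) * ex (-(δ * (M + 1))) *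
        (Real.Gamma (b - σ * (M + 1)) * ex (-(φ * (b - σ * (M + 1))))) := by
  have hμ : 0 < (ex φ).re := by rw [ex_re]; exact cos_pos_of_abs hφ
  have hc := cos_pos_of_abs hδ
  set s := b - σ * (M + 1) with hs
  have hrot := rotGamma φ hφ K s (by linarith) (h2.imp id fun h => by linarith)
  have hint := fT_integrable (ex φ) hμ K s (by linarith) (h2.imp id fun h => by linarith)
  set F : ℝ → ℝ → ℂ := fun t y => ((y ^ M : ℝ) : ℂ) * gI φ δ σ b K y t with hF
  have hFm : Measurable (Function.uncurry F) := by
    have h := (gI_measurable φ δ σ b K).comp measurable_swap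
    have h' : Measurable (fun p : ℝ × ℝ => (((p.2 ^ M : ℝ)) : ℂ)) := by fun_prop
    exact h'.mul h
  have hcnorm : ∀ t : ℝ, 0 < t → ∀ y : ℝ, 0 < y → ‖F t y‖ =
      (t ^ (b - 1) * ‖fT (ex φ) K t‖) * (y ^ (M : ℝ) * Real.exp (-(Real.cos δ * t ^ σ) * y ^ (1:ℝ))) := by
    intro t ht y hy
    simp only [hF, gI]
    rw [norm_mul, norm_smul, norm_mul, norm_exp_neg_mul_mul, Complex.norm_real,
      Real.norm_of_nonneg (by positivity), Real.norm_of_nonneg (by positivity), Real.rpow_natCast,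
      Real.rpow_one, show -(Real.cos δ * y) * t ^ σ = -(Real.cos δ * t ^ σ) * y by ring]
    ring
  have hnt : ∀ t : ℝ, 0 < t → t ^ (b - 1) * (t ^ σ) ^ (-((M : ℝ) + 1)) = t ^ (s - 1) := by
    intro t ht
    rw [← Real.rpow_mul ht.le, ← Real.rpow_add ht, hs]; congr 1; ring
  have hM : (-1:ℝ) < M := by have : (0:ℝ) ≤ M := M.cast_nonneg; linarith
  have hFi : Integrable (Function.uncurry F)
      ((volume.restrict (Ioi (0:ℝ))).prod (volume.restrict (Ioi (0:ℝ)))) := by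
    rw [integrable_prod_iff hFm.aestronglyMeasurable]
    constructor
    · filter_upwards [ae_restrict_mem measurableSet_Ioi] with t ht
      have ht' : 0 < t := ht
      have h := (integrableOn_rpow_mul_exp_neg_mul_rpow (p := 1) (s := M)
        (b := Real.cos δ * t ^ σ) hM one_pos (by positivity)).const_mul
        (t ^ (b - 1) * ‖fT (ex φ) K t‖)
      refine Integrable.mono' h (hFm.comp measurable_prodMk_left).aestronglyMeasurable ?_
      filter_upwards [ae_restrict_mem measurableSet_Ioi] with y hy
      exact (hcnorm t ht y hy).le
    · have h := hint.norm.const_mul (Real.cos δ ^ (-((M : ℝ) + 1)) * Real.Gamma (M + 1))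
      refine h.congr ?_
      filter_upwards [ae_restrict_mem measurableSet_Ioi] with t ht
      have ht' : 0 < t := ht
      have e : ∫ y in Ioi (0:ℝ), ‖F t y‖ = ∫ y in Ioi (0:ℝ),
          (t ^ (b - 1) * ‖fT (ex φ) K t‖) *
            (y ^ (M : ℝ) * Real.exp (-(Real.cos δ * t ^ σ) * y ^ (1:ℝ))) :=
        setIntegral_congr_fun measurableSet_Ioi fun y hy => hcnorm t ht y hy
      simp only [Function.uncurry]
      rw [e, integral_const_mul, integral_rpow_mul_exp_neg_mul_rpow one_pos hM (by positivity),
        norm_smul, Real.norm_of_nonneg (by positivity), ← hnt t ht', div_one, div_one, div_one,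
        Real.mul_rpow hc.le (by positivity)]
      ring
  have hswap := integral_integral_swap hFi
  have e1 : ∀ y : ℝ, ∫ t in Ioi (0:ℝ), F t y = ((y ^ M : ℝ) : ℂ) * G φ δ σ b K y := by
    intro y; simp only [hF, G]; rw [integral_const_mul]
  simp only [e1] at hswap
  rw [← hswap, ← hrot, ← integral_const_mul]
  refine setIntegral_congr_fun measurableSet_Ioi fun t ht => ?_
  have ht' : 0 < t := ht
  have h3 := rotGamma_scaled δ (M + 1) (t ^ σ) hδ (by linarith) (by positivity)
  rw [Real.Gamma_nat_eq_factorial] at h3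
  have e2 : ∫ y in Ioi (0:ℝ), F t y = (t ^ (b - 1) : ℝ) * fT (ex φ) K t *
      ∫ y in Ioi (0:ℝ), y ^ ((M : ℝ) + 1 - 1) • Complex.exp (-(ex δ * (t ^ σ : ℝ) * y)) := by
    rw [← integral_const_mul]
    refine setIntegral_congr_fun measurableSet_Ioi fun y hy => ?_
    simp only [hF, gI, add_sub_cancel_right, Real.rpow_natCast, Complex.real_smul]
    rw [mul_right_comm (ex δ)]
    ring
  rw [e2, h3, ← hnt t ht', Complex.real_smul]
  push_cast
  ring

lemma rpow_le_linear (σ a y : ℝ) (hσ1 : σ < 1) (hσ : 0 < σ) (ha : 0 < a) (hy : 0 < y) :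
    ∃ C : ℝ, ∀ t : ℝ, 0 < t → y * t ^ σ ≤ a * t + C := by
  set T := (y / a) ^ (1 / (1 - σ)) with hT
  have hT0 : 0 < T := by positivity
  have hT1 : T ^ (1 - σ) = y / a := by
    rw [hT, ← Real.rpow_mul (by positivity), one_div, inv_mul_cancel₀ (by linarith), Real.rpow_one]
  refine ⟨y * T ^ σ, fun t ht => ?_⟩
  rcases le_total t T with h | h
  · have : t ^ σ ≤ T ^ σ := Real.rpow_le_rpow ht.le h hσ.le
    nlinarith [mul_pos ha ht]
  · have h1 : T ^ (1 - σ) ≤ t ^ (1 - σ) := Real.rpow_le_rpow hT0.le h (by linarith)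
    have h2 : t = t ^ σ * t ^ (1 - σ) := by rw [← Real.rpow_add ht]; simp
    rw [hT1, div_le_iff₀ ha] at h1
    have h3 : 0 < t ^ σ := by positivity
    have h4 : y * t ^ σ ≤ a * t := by
      calc y * t ^ σ ≤ (t ^ (1 - σ) * a) * t ^ σ := by gcongr
        _ = a * (t ^ σ * t ^ (1 - σ)) := by ring
        _ = a * t := by rw [← h2]
    have : 0 < y * T ^ σ := by positivity
    linarith

lemma G_series (φ δ σ b : ℝ) (hφ : |φ| < Real.pi / 2) (hσ : 0 < σ) (hσ1 : σ < 1)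
    (hb : 0 < b) (y : ℝ) (hy : 0 < y) :
    HasSum (fun n : ℕ => (-(ex δ * y)) ^ n / (n.factorial : ℂ) *
      (Real.Gamma (b + σ * n) * ex (-(φ * (b + σ * n))))) (G φ δ σ b 0 y) := by
  have hc := cos_pos_of_abs hφ
  obtain ⟨C, hC⟩ := rpow_le_linear σ (Real.cos φ / 2) y hσ1 hσ (by linarith) hy
  have hμ : 0 < (ex φ).re := by rw [ex_re]; exact cos_pos_of_abs hφ
  set F : ℕ → ℝ → ℂ := fun n t => (-(ex δ * y)) ^ n / (n.factorial : ℂ) *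
    (t ^ (b + σ * n - 1) • fT (ex φ) 0 t) with hF
  have hFint : ∀ n, ∫ t in Ioi (0:ℝ), F n t = (-(ex δ * y)) ^ n / (n.factorial : ℂ) *
      (Real.Gamma (b + σ * n) * ex (-(φ * (b + σ * n)))) := by
    intro n
    simp only [hF]
    rw [integral_const_mul, rotGamma φ hφ 0 (b + σ * n) (by simp; positivity) (Or.inl rfl)]
  simp only [← hFint]
  have hFn : ∀ n, ∀ t : ℝ, 0 < t → F n t = gI φ 0 σ b 0 0 t *
      ((-(ex δ * y * (t ^ σ : ℝ))) ^ n / (n.factorial : ℂ)) := by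
    intro n t ht
    simp only [hF, gI]
    rw [show b + σ * n - 1 = (b - 1) + σ * n by ring, Real.rpow_add ht, Real.rpow_mul ht.le,
      Real.rpow_natCast]
    simp only [Complex.real_smul]
    rw [← neg_mul (ex δ * y), mul_pow]
    push_cast
    simp
    ring
  have hnorm0 : ∀ t : ℝ, 0 < t → ‖gI φ 0 σ b 0 0 t‖ = t ^ (b - 1) * Real.exp (-(Real.cos φ * t)) := by
    intro t ht
    rw [gI, norm_smul, fT_zero, norm_mul, norm_exp_neg_mul, ex_re, Real.norm_of_nonneg (by positivity)]
    simp
  have hsum : ∀ v : ℝ, HasSum (fun n : ℕ => v ^ n / (n.factorial : ℝ)) (Real.exp v) := by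
    intro v; rw [Real.exp_eq_exp_ℝ]; exact NormedSpace.expSeries_div_hasSum_exp v
  have hsumC : ∀ v : ℂ, HasSum (fun n : ℕ => v ^ n / (n.factorial : ℂ)) (Complex.exp v) := by
    intro v; rw [Complex.exp_eq_exp_ℂ]; exact NormedSpace.expSeries_div_hasSum_exp v
  refine hasSum_integral_of_dominated_convergence
    (fun n t => (t ^ (b - 1) * Real.exp (-(Real.cos φ * t))) * ((y * t ^ σ) ^ n / (n.factorial : ℝ)))
    ?_ ?_ ?_ ?_ ?_
  · intro n
    exact (fT_integrable (ex φ) hμ 0 (b + σ * n) (by simp; positivity)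
      (Or.inl rfl)).aestronglyMeasurable.const_mul _
  · intro n
    filter_upwards [ae_restrict_mem measurableSet_Ioi] with t ht
    have ht' : 0 < t := ht
    rw [hFn n t ht, norm_mul, hnorm0 t ht, norm_div, norm_pow, norm_neg, norm_mul, norm_mul, norm_ex,
      Complex.norm_real, Complex.norm_real, Real.norm_of_nonneg hy.le,
      Real.norm_of_nonneg (by positivity), one_mul, Complex.norm_natCast]
  · exact Eventually.of_forall fun t => (hsum _).summable.mul_left _
  · have e : (fun t : ℝ => ∑' n : ℕ, (t ^ (b - 1) * Real.exp (-(Real.cos φ * t))) *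
        ((y * t ^ σ) ^ n / (n.factorial : ℝ))) = fun t =>
        (t ^ (b - 1) * Real.exp (-(Real.cos φ * t))) * Real.exp (y * t ^ σ) := by
      ext t; rw [tsum_mul_left, (hsum _).tsum_eq]
    rw [e]
    have h := (integrableOn_rpow_mul_exp_neg_mul_rpow (p := 1) (s := b - 1)
        (b := Real.cos φ / 2) (by linarith) one_pos (by positivity)).const_mul (Real.exp C)
    refine Integrable.mono' h (by fun_prop) ?_
    filter_upwards [ae_restrict_mem measurableSet_Ioi] with t ht
    have ht' : 0 < t := ht
    rw [Real.norm_of_nonneg (by positivity), mul_assoc, ← Real.exp_add, mul_left_comm, ← Real.exp_add,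
      Real.rpow_one]
    refine mul_le_mul_of_nonneg_left (Real.exp_le_exp.2 ?_) (by positivity)
    have := hC t ht'
    linarith
  · filter_upwards [ae_restrict_mem measurableSet_Ioi] with t ht
    have h := (hsumC (-(ex δ * y * (t ^ σ : ℝ)))).mul_left (gI φ 0 σ b 0 0 t)
    simp only [hFn _ t ht]
    have e : gI φ δ σ b 0 y t = gI φ 0 σ b 0 0 t * Complex.exp (-(ex δ * y * (t ^ σ : ℝ))) := by
      simp only [gI, Complex.real_smul]; simp; ring
    rw [e]; exact h

/-! ### The function `J` and the walk -/

noncomputable def J (φ δ σ b c : ℝ) (K M : ℕ) (x : ℝ) : ℂ :=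
  ∫ u in Ioi (0:ℝ), ((wT c M u : ℝ) : ℂ) * G φ δ σ b K (x * u)

def Adm (σ b : ℝ) (K M : ℕ) : Prop :=
  σ * M < K + b ∧ (K = 0 ∨ (K : ℝ) - 1 + b < σ * (M + 1))

lemma Adm.exists_r {σ b : ℝ} (hσ : 0 < σ) {K M : ℕ} (h : Adm σ b K M) :
    ∃ r : ℝ, (M : ℝ) < r ∧ r < M + 1 ∧ σ * r ≤ K + b ∧ (K = 0 ∨ (K : ℝ) - 1 + b ≤ σ * r) := by
  obtain ⟨h1, h2⟩ := h
  rcases h2 with h2 | h2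
  · obtain ⟨r, hr1, hr2⟩ := exists_between (a₁ := (M : ℝ)) (a₂ := min ((M : ℝ) + 1) ((K + b) / σ))
      (lt_min (by linarith) (by rw [lt_div_iff₀ hσ]; linarith))
    have h3 := (lt_min_iff.1 hr2).2
    rw [lt_div_iff₀ hσ] at h3
    exact ⟨r, hr1, (lt_min_iff.1 hr2).1, by linarith, Or.inl h2⟩
  · obtain ⟨r, hr1, hr2⟩ := exists_between (a₁ := max (M : ℝ) ((K - 1 + b) / σ))
      (a₂ := min ((M : ℝ) + 1) ((K + b) / σ))
      (max_lt (lt_min (by linarith) (by rw [lt_div_iff₀ hσ]; linarith))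
        (lt_min (by rw [div_lt_iff₀ hσ]; linarith) (by gcongr; linarith)))
    have h3 := (lt_min_iff.1 hr2).2
    have h4 := (max_lt_iff.1 hr1).2
    rw [lt_div_iff₀ hσ] at h3
    rw [div_lt_iff₀ hσ] at h4
    exact ⟨r, (max_lt_iff.1 hr1).1, (lt_min_iff.1 hr2).1, by linarith, Or.inr (by linarith)⟩

section
variable (φ δ σ b c : ℝ)

lemma JI_measurable (K M : ℕ) (x : ℝ) :
    Measurable (fun u : ℝ => ((wT c M u : ℝ) : ℂ) * G φ δ σ b K (x * u)) := by
  have h1 := (G_measurable φ δ σ b K).measurable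
  have h2 := wT_measurable c M
  fun_prop

lemma JI_bound (hφ : |φ| < Real.pi / 2) (hδ : |δ| < Real.pi / 2) (hσ : 0 < σ)
    (hc : 1 < c) (K M : ℕ) (r : ℝ) (hr1 : (M : ℝ) < r)
    (h1 : σ * r ≤ K + b) (h2 : K = 0 ∨ (K : ℝ) - 1 + b ≤ σ * r) :
    ∃ C : ℝ, 0 ≤ C ∧ ∀ x : ℝ, 0 < x → ∀ u : ℝ, 0 < u →
      ‖((wT c M u : ℝ) : ℂ) * G φ δ σ b K (x * u)‖ ≤ (C * x ^ (-r)) * ‖u ^ (-r) • wT c M u‖ := by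
  have hM : (0:ℝ) ≤ M := M.cast_nonneg
  obtain ⟨C, hC, hb⟩ := G_bound φ δ σ b hφ hδ hσ K r (by linarith) h1 h2
  refine ⟨C, hC, fun x hx u hu => ?_⟩
  have := hb (x * u) (by positivity)
  rw [Real.mul_rpow hx.le hu.le] at this
  rw [norm_mul, Complex.norm_real, norm_smul, Real.norm_of_nonneg (by positivity : 0 ≤ u ^ (-r))]
  calc _ ≤ ‖wT c M u‖ * (C * (x ^ (-r) * u ^ (-r))) := by gcongr
    _ = _ := by ring

lemma JI_integrable (hφ : |φ| < Real.pi / 2) (hδ : |δ| < Real.pi / 2) (hσ : 0 < σ)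
    (hc : 1 < c) (K M : ℕ) (h : Adm σ b K M) (x : ℝ) (hx : 0 < x) :
    IntegrableOn (fun u : ℝ => ((wT c M u : ℝ) : ℂ) * G φ δ σ b K (x * u)) (Ioi 0) := by
  obtain ⟨r, hr1, hr2, h1, h2⟩ := h.exists_r hσ
  obtain ⟨C, hC, hb⟩ := JI_bound φ δ σ b c hφ hδ hσ hc K M r hr1 h1 h2
  have hi := wT_integrable c hc M r hr2 (Or.inr hr1)
  refine Integrable.mono' (hi.norm.const_mul (C * x ^ (-r)))
    (JI_measurable φ δ σ b c K M x).aestronglyMeasurable ?_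
  filter_upwards [ae_restrict_mem measurableSet_Ioi] with u hu
  exact hb x hx u hu

lemma J_bound (hφ : |φ| < Real.pi / 2) (hδ : |δ| < Real.pi / 2) (hσ : 0 < σ)
    (hc : 1 < c) (K M : ℕ) (r : ℝ) (hr1 : (M : ℝ) < r) (hr2 : r < M + 1)
    (h1 : σ * r ≤ K + b) (h2 : K = 0 ∨ (K : ℝ) - 1 + b ≤ σ * r) :
    ∃ C : ℝ, 0 ≤ C ∧ ∀ x : ℝ, 0 < x → ‖J φ δ σ b c K M x‖ ≤ C * x ^ (-r) := by
  obtain ⟨C, hC, hb⟩ := JI_bound φ δ σ b c hφ hδ hσ hc K M r hr1 h1 h2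
  have hi := wT_integrable c hc M r hr2 (Or.inr hr1)
  refine ⟨C * ∫ u in Ioi (0:ℝ), ‖u ^ (-r) • wT c M u‖, ?_, fun x hx => ?_⟩
  · exact mul_nonneg hC (integral_nonneg fun u => norm_nonneg _)
  · have := norm_integral_le_of_norm_le (hi.norm.const_mul (C * x ^ (-r)))
      (f := fun u : ℝ => ((wT c M u : ℝ) : ℂ) * G φ δ σ b K (x * u)) (by
      filter_upwards [ae_restrict_mem measurableSet_Ioi] with u hu
      exact hb x hx u hu)
    rw [integral_const_mul] at this
    exact this.trans (le_of_eq (by ring))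

noncomputable def coA (k : ℕ) : ℂ := ((-(ex φ)) ^ k / (k.factorial : ℂ)) * ((1 / σ : ℝ) *
  (Real.Gamma ((k + b) / σ) * ex (-(δ * ((k + b) / σ))))) *
  ((Real.Gamma (1 - (k + b) / σ) * (Real.Gamma (c - (k + b) / σ))⁻¹ : ℝ) : ℂ)

noncomputable def coB (m : ℕ) : ℂ := (pc c m : ℂ) * ((m.factorial : ℂ) * ex (-(δ * (m + 1))) *
        (Real.Gamma (b - σ * (m + 1)) * ex (-(φ * (b - σ * (m + 1))))))

lemma J_stepK (hφ : |φ| < Real.pi / 2) (hδ : |δ| < Real.pi / 2) (hσ : 0 < σ)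
    (hc : 1 < c) (hb : 0 < b) (K M : ℕ) (h1 : σ * M < K + b) (h2 : K + b < σ * (M + 1)) (x : ℝ) (hx : 0 < x) :
    J φ δ σ b c K M x = J φ δ σ b c (K + 1) M x +
      coA φ δ σ b c K * (x ^ (-((K + b) / σ)) : ℝ) := by
  have a1 : Adm σ b K M := ⟨h1, Or.inr (by linarith)⟩
  have a2 : Adm σ b (K + 1) M := ⟨by push_cast; linarith, Or.inr (by push_cast; linarith)⟩
  have i1 := JI_integrable φ δ σ b c hφ hδ hσ hc K M a1 x hx
  have i2 := JI_integrable φ δ σ b c hφ hδ hσ hc (K + 1) M a2 x hx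
  rw [add_comm (J φ δ σ b c (K + 1) M x), ← sub_eq_iff_eq_add]
  have hw := wInt c hc M ((K + b) / σ) (by rw [lt_div_iff₀ hσ]; linarith)
    (by rw [div_lt_iff₀ hσ]; linarith)
  unfold J coA
  rw [← integral_sub i1 i2, ← hw, ← integral_complex_ofReal, mul_right_comm, ← integral_const_mul]
  refine setIntegral_congr_fun measurableSet_Ioi fun u hu => ?_
  have hu' : 0 < u := hu
  rw [G_step φ δ σ b hφ hδ hσ hb K (x * u) (by positivity), Real.mul_rpow hx.le hu'.le, smul_eq_mul]
  push_cast
  ring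

lemma J_stepM (hφ : |φ| < Real.pi / 2) (hδ : |δ| < Real.pi / 2) (hσ : 0 < σ)
    (hc : 1 < c) (K M : ℕ) (h1 : σ * (M + 1) < K + b) (h2 : K = 0 ∨ (K : ℝ) - 1 + b < σ * (M + 1))
    (x : ℝ) (hx : 0 < x) :
    J φ δ σ b c K M x = J φ δ σ b c K (M + 1) x +
      coB φ δ σ b c M * (x ^ (-((M : ℝ) + 1)) : ℝ) := by
  have a1 : Adm σ b K M := ⟨by nlinarith, h2⟩
  have a2 : Adm σ b K (M + 1) := ⟨by push_cast; linarith, h2.imp id fun h => by push_cast; nlinarith⟩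
  have i1 := JI_integrable φ δ σ b c hφ hδ hσ hc K M a1 x hx
  have i2 := JI_integrable φ δ σ b c hφ hδ hσ hc K (M + 1) a2 x hx
  rw [add_comm (J φ δ σ b c K (M + 1) x), ← sub_eq_iff_eq_add]
  have hw := G_mellin φ δ σ b hφ hδ K M h1 h2
  have hcv := integral_comp_mul_left_Ioi (fun y : ℝ => ((y ^ M : ℝ) : ℂ) * G φ δ σ b K y) 0 hx
  rw [mul_zero, hw, Complex.real_smul] at hcv
  unfold J coB
  rw [← integral_sub i1 i2]
  have e : ∫ u in Ioi (0:ℝ), (((wT c M u : ℝ) : ℂ) * G φ δ σ b K (x * u) -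
      ((wT c (M + 1) u : ℝ) : ℂ) * G φ δ σ b K (x * u)) =
      (pc c M : ℂ) * ((x ^ M)⁻¹ : ℝ) *
        ∫ u in Ioi (0:ℝ), (((x * u) ^ M : ℝ) : ℂ) * G φ δ σ b K (x * u) := by
    rw [← integral_const_mul]
    refine setIntegral_congr_fun measurableSet_Ioi fun u hu => ?_
    have hxc : (x : ℂ) ≠ 0 := by exact_mod_cast hx.ne'
    rw [wT_succ c M u]
    push_cast
    rw [mul_pow]
    field_simp
    ring
  rw [e, hcv, Real.rpow_neg hx.le, Real.rpow_add_one hx.ne', Real.rpow_natCast, mul_inv]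
  push_cast
  ring

lemma walk (hφ : |φ| < Real.pi / 2) (hδ : |δ| < Real.pi / 2) (hσ : 0 < σ)
    (hc : 1 < c) (hb : 0 < b) (hres : ∀ k m : ℕ, (k : ℝ) + b ≠ σ * (m + 1)) (x : ℝ) (hx : 0 < x) (n : ℕ) :
    ∀ K M : ℕ, K + M = n → Adm σ b K M →
    J φ δ σ b c 0 0 x = J φ δ σ b c K M x +
      ∑ k ∈ Finset.range K, coA φ δ σ b c k * (x ^ (-((k + b) / σ)) : ℝ) +
      ∑ m ∈ Finset.range M, coB φ δ σ b c m * (x ^ (-((m : ℝ) + 1)) : ℝ) := by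
  induction n with
  | zero =>
    intro K M h _
    obtain ⟨rfl, rfl⟩ : K = 0 ∧ M = 0 := by omega
    simp
  | succ n ih =>
    intro K M h hA
    by_cases hK : ∃ K', K = K' + 1 ∧ σ * M < K' + b
    · obtain ⟨K, rfl, hK⟩ := hK
      have h2 : (K : ℝ) + b < σ * (M + 1) := by
        rcases hA.2 with h' | h'
        · simp at h'
        · push_cast at h'; linarith
      rw [ih K M (by omega) ⟨hK, Or.inr (by linarith)⟩,
        J_stepK φ δ σ b c hφ hδ hσ hc hb K M hK h2 x hx, Finset.sum_range_succ]
      ring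
    · have h2 : K = 0 ∨ (K : ℝ) - 1 + b ≤ σ * M := by
        rcases K with _ | K
        · exact Or.inl rfl
        · right
          by_contra h'
          apply hK
          refine ⟨K, rfl, ?_⟩
          push_cast at h'; linarith
      rcases M with _ | M
      · exfalso
        rcases h2 with h2 | h2
        · omega
        · have : (1:ℝ) ≤ K := by exact_mod_cast (by omega : 1 ≤ K)
          simp at h2
          linarith
      · have h1 := hA.1
        push_cast at h1 h2
        have h3 : K = 0 ∨ (K : ℝ) - 1 + b < σ * (M + 1) := by
          rcases K with _ | K
          · exact Or.inl rfl
          · right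
            rcases h2 with h2 | h2
            · simp at h2
            · refine lt_of_le_of_ne h2 ?_
              have := hres K M
              push_cast
              rw [add_sub_cancel_right]
              exact this
        rw [ih K M (by omega) ⟨by nlinarith, h3⟩,
          J_stepM φ δ σ b c hφ hδ hσ hc K M h1 h3 x hx, Finset.sum_range_succ]
        ring

lemma J_series (hφ : |φ| < Real.pi / 2) (hδ : |δ| < Real.pi / 2) (hσ : 0 < σ)
    (hc : 1 < c) (hσ1 : σ < 1) (hb : 0 < b) (x : ℝ) (hx : 0 < x) :
    HasSum (fun n : ℕ => (-(ex δ)) ^ n *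
      (Real.Gamma (b + σ * n) * ex (-(φ * (b + σ * n)))) *
        ((x ^ n * (Real.Gamma (n + c))⁻¹ : ℝ) : ℂ)) (J φ δ σ b c 0 0 x) := by
  set T : ℕ → ℂ := fun n => (-(ex δ * x)) ^ n / (n.factorial : ℂ) *
      (Real.Gamma (b + σ * n) * ex (-(φ * (b + σ * n)))) with hT
  have hTs : Summable (fun n => ‖T n‖) := (G_series φ δ σ b hφ hσ hσ1 hb x hx).summable.norm
  set F : ℕ → ℝ → ℂ := fun n u => T n * ((u ^ (-(-(n:ℝ))) • wT c 0 u : ℝ) : ℂ) with hF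
  have hwi : ∀ n : ℕ, IntegrableOn (fun u : ℝ => u ^ (-(-(n:ℝ))) • wT c 0 u) (Ioi 0) := fun n =>
    wT_integrable c hc 0 (-(n:ℝ)) (by have : (0:ℝ) ≤ n := n.cast_nonneg; simp; linarith) (Or.inl rfl)
  have hFi : ∀ n, IntegrableOn (F n) (Ioi 0) := fun n => (hwi n).ofReal.const_mul (T n)
  have hb : ∀ n : ℕ, ∀ u : ℝ, 0 < u → ‖u ^ (-(-(n:ℝ))) • wT c 0 u‖ ≤ ‖u ^ (-(-((0:ℕ):ℝ))) • wT c 0 u‖ := by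
    intro n u hu
    rcases le_or_gt 1 u with h | h
    · rw [wT_zero_large c u h]; simp
    · rw [norm_smul, norm_smul]
      refine mul_le_mul_of_nonneg_right ?_ (norm_nonneg _)
      simp only [neg_neg, Real.rpow_natCast, pow_zero, norm_one]
      rw [Real.norm_of_nonneg (by positivity)]
      exact pow_le_one₀ hu.le h.le
  have hs := hasSum_integral_of_summable_integral_norm hFi (by
    refine Summable.of_nonneg_of_le (fun n => integral_nonneg fun u => norm_nonneg _) (fun n => ?_)
      (hTs.mul_right (∫ u in Ioi (0:ℝ), ‖u ^ (-(-((0:ℕ):ℝ))) • wT c 0 u‖))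
    simp only [hF, norm_mul, Complex.norm_real]
    rw [integral_const_mul]
    refine mul_le_mul_of_nonneg_left ?_ (norm_nonneg _)
    refine setIntegral_mono_on (hwi n).norm (hwi 0).norm measurableSet_Ioi fun u hu => hb n u hu)
  have e1 : ∫ u in Ioi (0:ℝ), (∑' n, F n u) = J φ δ σ b c 0 0 x := by
    unfold J
    refine setIntegral_congr_fun measurableSet_Ioi fun u hu => ?_
    have hu' : 0 < u := hu
    have h := (G_series φ δ σ b hφ hσ hσ1 ‹0 < b› (x * u) (by positivity)).mul_left
      ((wT c 0 u : ℝ) : ℂ)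
    rw [← h.tsum_eq]
    congr 1; ext n
    simp only [hF, hT, neg_neg, Real.rpow_natCast, smul_eq_mul]
    push_cast
    rw [show -(ex δ * ((x:ℂ) * u)) = -(ex δ * x) * u by ring, mul_pow (-(ex δ * (x:ℂ)))]
    ring
  rw [e1] at hs
  refine Eq.mpr (congrArg (fun f => HasSum f _) (funext fun n => ?_)) hs
  simp only [hF]
  rw [integral_const_mul, integral_complex_ofReal, wInt_zero c hc (-(n:ℝ))
    (by have : (0:ℝ) ≤ n := n.cast_nonneg; linarith)]
  rw [show 1 - -(n:ℝ) = n + 1 by ring, Real.Gamma_nat_eq_factorial, show c - -(n:ℝ) = n + c by ring]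
  have hfac : (n.factorial : ℂ) ≠ 0 := by exact_mod_cast n.factorial_ne_zero
  simp only [hT]
  rw [← neg_mul (ex δ), mul_pow]
  push_cast
  field_simp

end

/-! ### Taking imaginary parts -/

lemma ex_im (φ : ℝ) : (ex φ).im = Real.sin φ := by simp [ex, Complex.exp_ofReal_mul_I_im]

lemma ex_pow (φ : ℝ) (n : ℕ) : (ex φ) ^ n = ex (φ * n) := by
  rw [ex, ex, ← Complex.exp_nat_mul]; congr 1; push_cast; ring

lemma neg_ex (φ : ℝ) : -(ex φ) = ex (Real.pi + φ) := by
  rw [ex_add]; simp [ex, Complex.exp_pi_mul_I]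

lemma reflect (s : ℝ) (h : ∀ m : ℕ, s ≠ -m) :
    Real.Gamma s * Real.sin (Real.pi * s) = Real.pi * (Real.Gamma (1 - s))⁻¹ := by
  have h1 := Real.Gamma_mul_Gamma_one_sub s
  have h2 : Real.Gamma s ≠ 0 := Real.Gamma_ne_zero h
  by_cases h3 : Real.sin (Real.pi * s) = 0
  · rw [h3, div_zero] at h1
    rw [(mul_eq_zero.1 h1).resolve_left h2, h3]; simp
  · have h4 : Real.Gamma (1 - s) ≠ 0 := by
      intro h5; rw [h5, mul_zero] at h1
      have := div_ne_zero Real.pi_ne_zero h3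
      exact this h1.symm
    rw [eq_div_iff h3] at h1
    rw [eq_mul_inv_iff_mul_eq₀ h4]; linear_combination h1

lemma im_aux (θ z : ℝ) (w : ℂ) (a : ℝ) (h : w = (a : ℂ) * ex z) (hθ : θ = z) : w.im = a * Real.sin θ := by
  rw [h, Complex.im_ofReal_mul, ex_im, hθ]

noncomputable def Hs (σ b c x : ℝ) : ℝ :=
  ∑' n : ℕ, x ^ n * (Real.Gamma (n + c))⁻¹ * (Real.Gamma (1 - (b + σ * n)))⁻¹

section
variable (φ δ σ b c : ℝ)

lemma coA_im (hσ : 0 < σ) (hrel : σ * (Real.pi + φ) = Real.pi + δ) (k : ℕ)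
    (hres : ∀ m : ℤ, (k + b) / σ ≠ m) :
    (ex ((Real.pi + φ) * b) * coA φ δ σ b c k).im =
      Real.pi * (1 / σ * ((k.factorial : ℝ) * Real.Gamma (c - (k + b) / σ))⁻¹) := by
  set s := (k + b) / σ with hs
  have hsσ : s * σ = k + b := by rw [hs]; field_simp
  have h : ex ((Real.pi + φ) * b) * coA φ δ σ b c k =
      (((k.factorial : ℝ)⁻¹ * (1 / σ) * (Real.Gamma s * (Real.Gamma (1 - s) *
        (Real.Gamma (c - s))⁻¹)) : ℝ) : ℂ) * ex (Real.pi * s) := by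
    have : ex (Real.pi * s) = ex ((Real.pi + φ) * b) * ex ((Real.pi + φ) * k) * ex (-(δ * s)) := by
      rw [← ex_add, ← ex_add]; congr 1
      linear_combination (-s) * hrel + (Real.pi + φ) * hsσ
    rw [this, coA, neg_ex, ex_pow]
    push_cast
    ring
  rw [h, Complex.im_ofReal_mul, ex_im]
  have hr := reflect s (fun m => by have := hres (-(m:ℤ)); push_cast at this; exact this)
  have hg : Real.Gamma (1 - s) ≠ 0 := Real.Gamma_ne_zero (fun m hm => by
    have := hres (m + 1); push_cast at this; apply this; linarith)
  have e : Real.Gamma s * Real.sin (Real.pi * s) * Real.Gamma (1 - s) = Real.pi := by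
    rw [hr, mul_assoc, inv_mul_cancel₀ hg, mul_one]
  rw [mul_inv]
  linear_combination ((k.factorial : ℝ)⁻¹ * (1 / σ) * (Real.Gamma (c - s))⁻¹) * e

lemma coB_im (hrel : σ * (Real.pi + φ) = Real.pi + δ) (m : ℕ)
    (hres : ∀ k : ℕ, (k + b) ≠ σ * (m + 1)) :
    (ex ((Real.pi + φ) * b) * coB φ δ σ b c m).im =
      - (Real.pi * (Real.Gamma (c - 1 - m) * Real.Gamma (1 - b + σ * (m + 1)))⁻¹) := by
  set s := b - σ * (m + 1) with hs
  have h : ex ((Real.pi + φ) * b) * coB φ δ σ b c m =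
      ((-(Real.Gamma (c - 1 - m))⁻¹ * Real.Gamma s : ℝ) : ℂ) * ex (Real.pi * s) := by
    have h1 : ex ((Real.pi + φ) * b) * ex (-(δ * (m + 1))) * ex (-(φ * s)) =
        ex (Real.pi * s) * (-1) ^ (m + 1) := by
      have : (-1 : ℂ) = ex Real.pi := by simp [ex, Complex.exp_pi_mul_I]
      rw [this, ex_pow, ← ex_add, ← ex_add, ← ex_add]; congr 1
      push_cast
      linear_combination ((m : ℝ) + 1) * hrel - (Real.pi + φ) * hs
    have hf : (m.factorial : ℂ) ≠ 0 := by exact_mod_cast m.factorial_ne_zero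
    have h2 : ((-1 : ℂ) ^ m) * (-1) ^ (m + 1) = -1 := by
      rw [pow_succ, ← mul_assoc, ← mul_pow]; simp
    rw [coB, pc]
    rw [← hs]
    have e : ex ((Real.pi + φ) * b) * ((((-1) ^ m / (m.factorial : ℝ) * (Real.Gamma (c - 1 - m))⁻¹ : ℝ) : ℂ) *
        ((m.factorial : ℂ) * ex (-(δ * (m + 1))) * (Real.Gamma s * ex (-(φ * s))))) =
        ((Real.Gamma (c - 1 - m))⁻¹ : ℝ) * Real.Gamma s * (-1) ^ m *
          (ex ((Real.pi + φ) * b) * ex (-(δ * (m + 1))) * ex (-(φ * s))) := by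
      push_cast
      field_simp
    rw [e, h1]
    push_cast
    linear_combination (((Real.Gamma (c - 1 - m))⁻¹ : ℂ) * Real.Gamma s * ex (Real.pi * s)) * h2
  rw [h, Complex.im_ofReal_mul, ex_im]
  have hr := reflect s (fun k hk => hres k (by rw [hs] at hk; linarith))
  rw [show 1 - b + σ * (m + 1) = 1 - s by rw [hs]; ring, mul_inv]
  linear_combination (-(Real.Gamma (c - 1 - m))⁻¹) * hr

lemma H_eq (hφ : |φ| < Real.pi / 2) (hδ : |δ| < Real.pi / 2) (hσ : 0 < σ) (hσ1 : σ < 1)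
    (hc : 1 < c) (hb : 0 < b) (hrel : σ * (Real.pi + φ) = Real.pi + δ) (x : ℝ) (hx : 0 < x) :
    HasSum (fun n : ℕ => x ^ n * (Real.Gamma (n + c))⁻¹ * (Real.Gamma (1 - (b + σ * n)))⁻¹)
      (Real.pi⁻¹ * (ex ((Real.pi + φ) * b) * J φ δ σ b c 0 0 x).im) := by
  have h := ((J_series φ δ σ b c hφ hδ hσ hc hσ1 hb x hx).mul_left (ex ((Real.pi + φ) * b)))
  have h2 := (Complex.hasSum_im h).mul_left (Real.pi⁻¹)
  refine Eq.mpr (congrArg (fun f => HasSum f _) (funext fun n => ?_)) h2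
  have e : ex ((Real.pi + φ) * b) * ((-(ex δ)) ^ n *
      (Real.Gamma (b + σ * n) * ex (-(φ * (b + σ * n)))) *
        ((x ^ n * (Real.Gamma (n + c))⁻¹ : ℝ) : ℂ)) =
      ((x ^ n * (Real.Gamma (n + c))⁻¹ * Real.Gamma (b + σ * n) : ℝ) : ℂ) * ex (Real.pi * (b + σ * n)) := by
    have : ex (Real.pi * (b + σ * n)) = ex ((Real.pi + φ) * b) * ex ((Real.pi + δ) * n) *
        ex (-(φ * (b + σ * n))) := by
      rw [← ex_add, ← ex_add]; congr 1
      linear_combination (n : ℝ) * hrel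
    rw [this, neg_ex, ex_pow]
    push_cast
    ring
  have hr := reflect (b + σ * n) (fun m hm => by
    have : 0 < b + σ * n := by positivity
    have h0 : (0:ℝ) ≤ m := m.cast_nonneg
    linarith)
  rw [e, Complex.im_ofReal_mul, ex_im]
  have := Real.pi_ne_zero
  have hr' : (Real.Gamma (1 - (b + σ * n)))⁻¹ =
      Real.pi⁻¹ * (Real.Gamma (b + σ * n) * Real.sin (Real.pi * (b + σ * n))) := by
    rw [hr, inv_mul_cancel_left₀ this]
  rw [hr']; ring

end

lemma H_summable_expansion (σ b c : ℝ) (hσ0 : 1 / 3 < σ) (hσ1 : σ < 1) (hb : 0 < b) (hc : 1 < c)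
    (hres : ∀ (k : ℕ) (m : ℤ), (k + b) / σ ≠ m) (K M : ℕ) (r : ℝ)
    (hr1 : (M : ℝ) < r) (hr2 : r < M + 1)
    (h1 : σ * r ≤ K + b) (h2 : K = 0 ∨ (K : ℝ) - 1 + b < σ * r) :
    (∀ x : ℝ, 0 < x → Summable
      (fun n : ℕ => x ^ n * (Real.Gamma (n + c))⁻¹ * (Real.Gamma (1 - (b + σ * n)))⁻¹)) ∧
    ∃ C : ℝ, 0 ≤ C ∧ ∀ x : ℝ, 0 < x →
      |Hs σ b c x
        + ∑ m ∈ Finset.range M, (Real.Gamma (c - 1 - m) * Real.Gamma (1 - b + σ * (m + 1)))⁻¹ *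
            x ^ (-((m : ℝ) + 1))
        - 1 / σ * ∑ k ∈ Finset.range K, ((k.factorial : ℝ) * Real.Gamma (c - (k + b) / σ))⁻¹ *
            x ^ (-((k + b) / σ))| ≤ C * x ^ (-r) := by
  have hσ : 0 < σ := by linarith
  have hπ := Real.pi_pos
  set φ := Real.pi / 4 * (1 / σ - 1) with hφd
  set δ := -(3 * Real.pi / 4 * (1 - σ)) with hδd
  have hσ3 : 1 / σ < 3 := by rw [div_lt_iff₀ hσ]; linarith
  have hσ4 : 1 < 1 / σ := by rw [lt_div_iff₀ hσ]; linarith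
  have hφ : |φ| < Real.pi / 2 := by
    rw [abs_lt]; constructor <;> nlinarith
  have hδ : |δ| < Real.pi / 2 := by
    rw [abs_lt]; constructor <;> nlinarith
  have hrel : σ * (Real.pi + φ) = Real.pi + δ := by
    rw [hφd, hδd]; field_simp; ring
  have hres' : ∀ k m : ℕ, (k : ℝ) + b ≠ σ * (m + 1) := by
    intro k m h
    apply hres k (m + 1)
    push_cast
    rw [div_eq_iff hσ.ne', h]; ring
  refine ⟨fun x hx => (H_eq φ δ σ b c hφ hδ hσ hσ1 hc hb hrel x hx).summable, ?_⟩
  obtain ⟨C, hC, hbd⟩ := J_bound φ δ σ b c hφ hδ hσ hc K M r hr1 hr2 h1 (h2.imp id le_of_lt)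
  refine ⟨Real.pi⁻¹ * C, by positivity, fun x hx => ?_⟩
  have hA : Adm σ b K M := ⟨by nlinarith, h2.imp id fun h => by nlinarith⟩
  have hw := walk φ δ σ b c hφ hδ hσ hc hb hres' x hx (K + M) K M rfl hA
  have hH := (H_eq φ δ σ b c hφ hδ hσ hσ1 hc hb hrel x hx).tsum_eq
  set E := ex ((Real.pi + φ) * b) with hE
  have hE1 : ‖E‖ = 1 := norm_ex _
  have key : Hs σ b c x
        + ∑ m ∈ Finset.range M, (Real.Gamma (c - 1 - m) * Real.Gamma (1 - b + σ * (m + 1)))⁻¹ *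
            x ^ (-((m : ℝ) + 1))
        - 1 / σ * ∑ k ∈ Finset.range K, ((k.factorial : ℝ) * Real.Gamma (c - (k + b) / σ))⁻¹ *
            x ^ (-((k + b) / σ)) = Real.pi⁻¹ * (E * J φ δ σ b c K M x).im := by
    rw [Hs, hH, hw, mul_add, mul_add, Complex.add_im, Complex.add_im, Finset.mul_sum, Finset.mul_sum,
      Complex.im_sum, Complex.im_sum]
    have eA : ∀ k ∈ Finset.range K, (E * (coA φ δ σ b c k * (x ^ (-((k + b) / σ)) : ℝ))).im =
        Real.pi * (1 / σ) * (((k.factorial : ℝ) * Real.Gamma (c - (k + b) / σ))⁻¹ *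
            x ^ (-((k + b) / σ))) := by
      intro k _
      rw [← mul_assoc, Complex.im_mul_ofReal, coA_im φ δ σ b c hσ hrel k (hres k)]; ring
    have eB : ∀ m ∈ Finset.range M, (E * (coB φ δ σ b c m * (x ^ (-((m : ℝ) + 1)) : ℝ))).im =
        -Real.pi * ((Real.Gamma (c - 1 - m) * Real.Gamma (1 - b + σ * (m + 1)))⁻¹ *
            x ^ (-((m : ℝ) + 1))) := by
      intro m _
      rw [← mul_assoc, Complex.im_mul_ofReal, coB_im φ δ σ b c hrel m (fun k => hres' k m)]; ring
    rw [Finset.sum_congr rfl eA, Finset.sum_congr rfl eB, ← Finset.mul_sum, ← Finset.mul_sum]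
    field_simp
    ring
  rw [key, abs_mul, abs_of_pos (by positivity : 0 < Real.pi⁻¹), mul_assoc]
  refine mul_le_mul_of_nonneg_left ?_ (by positivity)
  refine (Complex.abs_im_le_norm _).trans ?_
  rw [norm_mul, hE1, one_mul]
  exact hbd x hx

/-! ### Assembly -/

lemma inv_Gamma_half (j : ℕ) : (Real.Gamma (1 / 2 - (j : ℝ)))⁻¹ =
    Real.pi⁻¹ * ((-1) ^ j * Real.Gamma ((j : ℝ) + 1 / 2)) := by
  have hr := reflect ((j : ℝ) + 1 / 2) (fun m hm => by
    have h0 : (0:ℝ) ≤ m := m.cast_nonneg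
    have h1 : (0:ℝ) ≤ j := j.cast_nonneg
    linarith)
  have hs : Real.sin (Real.pi * ((j : ℝ) + 1 / 2)) = (-1) ^ j := by
    rw [show Real.pi * ((j : ℝ) + 1 / 2) = Real.pi / 2 + j * Real.pi by ring,
      Real.sin_add_nat_mul_pi, Real.sin_pi_div_two, mul_one]
  rw [hs, show 1 - ((j : ℝ) + 1 / 2) = 1 / 2 - j by ring] at hr
  rw [mul_comm ((-1) ^ j), hr, inv_mul_cancel_left₀ Real.pi_ne_zero]

noncomputable def Fs (σ ν x : ℝ) : ℝ :=
  ∑' n : ℕ, x ^ n * (Real.Gamma (n + 3 / 2) * Real.Gamma (-σ * n + ν + 3 / 2))⁻¹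

lemma F_expansion (σ ν : ℝ) (hσ0 : 1 / 3 < σ) (hσ1 : σ < 1)
    (hks : ∀ (k : ℕ) (m : ℤ), ((k : ℝ) - ν - 1 / 2) / σ ≠ (m : ℝ)) (R : ℝ) (hR : 0 < R) :
    ∃ C : ℝ, 0 ≤ C ∧ ∀ x : ℝ, 1 ≤ x →
      |Fs σ ν x - 1 / Real.pi * ∑ j ∈ Finset.range ⌊R⌋₊, ((-1 : ℝ) ^ (j + 1) *
          Real.Gamma ((j : ℝ) + 1 / 2) * x ^ (-(j : ℝ) - 1) /
              Real.Gamma (ν + 3 / 2 + σ * ((j : ℝ) + 1)))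
        - 1 / σ * ∑ k ∈ Finset.range ⌊σ * R + ν + 1 / 2 + 1⌋₊,
          x ^ (-(((k : ℝ) - ν - 1 / 2) / σ)) /
              ((k.factorial : ℝ) * Real.Gamma (3 / 2 - ((k : ℝ) - ν - 1 / 2) / σ))|
        ≤ C * x ^ (-R) := by
  have hσ : 0 < σ := by linarith
  obtain ⟨N, hN⟩ := exists_nat_gt ((ν + 1 / 2) / σ)
  rw [div_lt_iff₀ hσ] at hN
  set P := ⌊R⌋₊ with hP
  set K := ⌊σ * R + ν + 1 / 2 + 1⌋₊ with hK
  set b := -ν - 1 / 2 + σ * N with hb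
  have hbpos : 0 < b := by rw [hb]; linarith
  have hN0 : (0:ℝ) ≤ N := N.cast_nonneg
  have hks' : ∀ k : ℕ, ((k : ℝ) + b) / σ = ((k : ℝ) - ν - 1 / 2) / σ + N := by
    intro k; rw [hb]; field_simp; ring
  have hP1 : (P : ℝ) ≤ R := Nat.floor_le hR.le
  have hP2 : R < P + 1 := Nat.lt_floor_add_one R
  have hK1 : σ * R + ν + 1 / 2 + 1 < K + 1 := Nat.lt_floor_add_one _
  have hK2 : K = 0 ∨ (K : ℝ) ≤ σ * R + ν + 1 / 2 + 1 := by
    rcases le_total 0 (σ * R + ν + 1 / 2 + 1) with h | h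
    · exact Or.inr (Nat.floor_le h)
    · exact Or.inl (Nat.floor_of_nonpos h)
  obtain ⟨r, hr1, hr2⟩ := exists_between (a₁ := R + N) (a₂ := min ((P + N : ℕ) + 1 : ℝ) ((K + b) / σ))
    (lt_min (by push_cast; linarith) (by rw [lt_div_iff₀ hσ, hb]; nlinarith))
  have hr3 := (lt_min_iff.1 hr2).1
  have hr4 := (lt_min_iff.1 hr2).2
  rw [lt_div_iff₀ hσ] at hr4
  obtain ⟨hsum, C, hC, hbd⟩ := H_summable_expansion σ b (3 / 2 + N) hσ0 hσ1 hbpos (by linarith)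
    (fun k m h => hks k (m - N) (by rw [hks'] at h; push_cast; linarith)) K (P + N) r
    (by push_cast; linarith) hr3 (by linarith) (hK2.imp id fun h => by rw [hb]; nlinarith)
  refine ⟨C, hC, fun x hx => ?_⟩
  have hx0 : 0 < x := by linarith
  have hbx := (hbd x hx0).trans (mul_le_mul_of_nonneg_left
    (Real.rpow_le_rpow_of_exponent_le hx (by linarith : -r ≤ -(R + N))) hC)
  set f : ℕ → ℝ := fun n => x ^ n * (Real.Gamma (n + 3 / 2) * Real.Gamma (-σ * n + ν + 3 / 2))⁻¹ with hf
  have hfN : ∀ n, f (n + N) = x ^ N * (x ^ n * (Real.Gamma (n + (3 / 2 + N)))⁻¹ *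
      (Real.Gamma (1 - (b + σ * n)))⁻¹) := by
    intro n
    simp only [hf]
    push_cast
    rw [show (n : ℝ) + N + 3 / 2 = n + (3 / 2 + N) by ring,
      show -σ * ((n : ℝ) + N) + ν + 3 / 2 = 1 - (b + σ * n) by rw [hb]; ring, pow_add, mul_inv]
    ring
  have hfs : Summable f := by
    rw [← summable_nat_add_iff N]
    simp only [hfN]
    exact (hsum x hx0).mul_left _
  have hF : Fs σ ν x = ∑ n ∈ Finset.range N, f n + x ^ N * Hs σ b (3 / 2 + N) x := by
    rw [Fs, ← hfs.sum_add_tsum_nat_add N, Hs, ← tsum_mul_left]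
    simp only [hfN]
  have hB : x ^ N * ∑ m ∈ Finset.range (P + N), (Real.Gamma (3 / 2 + N - 1 - m) *
      Real.Gamma (1 - b + σ * (m + 1)))⁻¹ * x ^ (-((m : ℝ) + 1)) =
      ∑ n ∈ Finset.range N, f n - 1 / Real.pi * ∑ j ∈ Finset.range P, ((-1 : ℝ) ^ (j + 1) *
          Real.Gamma ((j : ℝ) + 1 / 2) * x ^ (-(j : ℝ) - 1) /
              Real.Gamma (ν + 3 / 2 + σ * ((j : ℝ) + 1))) := by
    rw [add_comm P N, Finset.sum_range_add, mul_add, sub_eq_add_neg]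
    congr 1
    · rw [← Finset.sum_range_reflect f, Finset.mul_sum]
      refine Finset.sum_congr rfl fun m hm => ?_
      have hm' := Finset.mem_range.1 hm
      have e : ((N - 1 - m : ℕ) : ℝ) = N - 1 - m := by
        rw [Nat.cast_sub (by omega), Nat.cast_sub (by omega)]; simp
      simp only [hf]
      rw [← Real.rpow_natCast x (N - 1 - m), ← Real.rpow_natCast x N, e, mul_left_comm,
        ← Real.rpow_add hx0, mul_comm]
      congr 2
      · ring
      · congr 2
        · ring
        · rw [hb]; ring
    · rw [Finset.mul_sum, Finset.mul_sum, ← Finset.sum_neg_distrib]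
      refine Finset.sum_congr rfl fun j _ => ?_
      rw [← Real.rpow_natCast x N, mul_left_comm, ← Real.rpow_add hx0]
      simp only [Nat.cast_add]
      rw [show (3:ℝ) / 2 + N + -1 - (N + j) = 1 / 2 - j by ring,
        show 1 - b + σ * ((N:ℝ) + j + 1) = ν + 3 / 2 + σ * ((j : ℝ) + 1) by rw [hb]; ring,
        mul_inv, inv_Gamma_half, show (N:ℝ) + -((N:ℝ) + j + 1) = -(j : ℝ) - 1 by ring, pow_succ]
      ring
  have hA : x ^ N * (1 / σ * ∑ k ∈ Finset.range K, ((k.factorial : ℝ) *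
      Real.Gamma (3 / 2 + N - (k + b) / σ))⁻¹ * x ^ (-((k + b) / σ))) =
      1 / σ * ∑ k ∈ Finset.range K,
          x ^ (-(((k : ℝ) - ν - 1 / 2) / σ)) /
              ((k.factorial : ℝ) * Real.Gamma (3 / 2 - ((k : ℝ) - ν - 1 / 2) / σ)) := by
    rw [mul_left_comm, Finset.mul_sum]
    congr 1
    refine Finset.sum_congr rfl fun k _ => ?_
    rw [← Real.rpow_natCast x N, mul_left_comm, ← Real.rpow_add hx0, hks',
      show (N:ℝ) + -(((k : ℝ) - ν - 1 / 2) / σ + N) = -(((k : ℝ) - ν - 1 / 2) / σ) by ring,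
      show (3:ℝ) / 2 + N - (((k : ℝ) - ν - 1 / 2) / σ + N) = 3 / 2 - ((k : ℝ) - ν - 1 / 2) / σ by ring]
    rw [mul_comm]
    exact (div_eq_mul_inv _ _).symm
  have hxN : 0 < x ^ N := by positivity
  rw [← hA, hF]
  have hfin := mul_le_mul_of_nonneg_left hbx hxN.le
  rw [← abs_of_pos hxN, ← abs_mul, abs_of_pos hxN] at hfin
  have e1 : x ^ N * (C * x ^ (-(R + N))) = C * x ^ (-R) := by
    rw [← Real.rpow_natCast x N, mul_left_comm, ← Real.rpow_add hx0]; congr 2; ring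
  rw [e1, mul_sub, mul_add, hB] at hfin
  refine le_trans (le_of_eq ?_) hfin
  congr 1; ring

end StruveAux

/-- Purely algebraic asymptotic expansion of `L_ν(z;−σ)` for `1/3 < σ < 1` as
`z → +∞`: with `x = z²/4` and `k_s = (k−ν−1/2)/σ`,
`(z/2)^{−ν−1} L_ν(z;−σ) ∼ (1/π)Σ_k (−1)^{k+1}Γ(k+1/2)x^{−k−1}/Γ(ν+3/2+σ(k+1))
 + (1/σ)Σ_k x^{−k_s}/(k! Γ(3/2−k_s))`,
with error `O(x^{−R})` after retaining all terms with exponent at most `R`. -/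
theorem struveL_neg_sigma_algebraic_expansion (σ ν : ℝ)
    (hσ0 : 1 / 3 < σ) (hσ1 : σ < 1)
    (hreg : ∀ n m : ℕ, σ * (n : ℝ) - ν - 1 / 2 ≠ -(m : ℝ))
    (hks : ∀ (k : ℕ) (m : ℤ), ((k : ℝ) - ν - 1 / 2) / σ ≠ (m : ℝ)) :
    ∀ R : ℝ, 0 < R → ∃ C > (0 : ℝ), ∃ Z₀ > (0 : ℝ), ∀ z : ℝ, Z₀ ≤ z →
      ‖((z : ℂ) / 2) ^ (-(ν : ℂ) - 1) * struveL ν (-σ) (z : ℂ) -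
        ((1 / Real.pi * ∑' k : ℕ,
          (if (k : ℝ) + 1 ≤ R then
            (-1 : ℝ) ^ (k + 1) * Real.Gamma ((k : ℝ) + 1 / 2) *
              (z ^ 2 / 4) ^ (-(k : ℝ) - 1) /
              Real.Gamma (ν + 3 / 2 + σ * ((k : ℝ) + 1))
          else 0) : ℝ) : ℂ) -
        ((1 / σ * ∑' k : ℕ,
          (if ((k : ℝ) - ν - 1 / 2) / σ ≤ R then
            (z ^ 2 / 4) ^ (-(((k : ℝ) - ν - 1 / 2) / σ)) /
              ((k.factorial : ℝ) *
                Real.Gamma (3 / 2 - ((k : ℝ) - ν - 1 / 2) / σ))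
          else 0) : ℝ) : ℂ)‖
        ≤ C * (z ^ 2 / 4) ^ (-R) := by
  intro R hR
  have hσ : 0 < σ := by linarith
  obtain ⟨C, hC, hbd⟩ := StruveAux.F_expansion σ ν hσ0 hσ1 hks R hR
  refine ⟨C + 1, by linarith, 2, by norm_num, fun z hz => ?_⟩
  have hx : 1 ≤ z ^ 2 / 4 := by nlinarith
  have hz0 : (0:ℝ) < z := by linarith
  set x := z ^ 2 / 4 with hxd
  have hL : ((z : ℂ) / 2) ^ (-(ν : ℂ) - 1) * struveL ν (-σ) (z : ℂ) = (StruveAux.Fs σ ν x : ℂ) := by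
    have hzc : ((z : ℂ) / 2) ≠ 0 := by
      have : (z : ℂ) ≠ 0 := by exact_mod_cast hz0.ne'
      simpa using this
    rw [struveL, ← mul_assoc, ← Complex.cpow_add _ _ hzc, show -(ν : ℂ) - 1 + (ν + 1) = 0 by ring,
      Complex.cpow_zero, one_mul, StruveAux.Fs, Complex.ofReal_tsum]
    congr 1; ext n
    have e1 : (n : ℂ) + 3 / 2 = (((n : ℝ) + 3 / 2 : ℝ) : ℂ) := by push_cast; ring
    have e2 : ((-σ : ℝ) : ℂ) * (n : ℂ) + (ν : ℂ) + 3 / 2 = ((-σ * n + ν + 3 / 2 : ℝ) : ℂ) := by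
      push_cast; ring
    have e3 : ((z : ℂ) / 2) ^ (2 * n) = ((x ^ n : ℝ) : ℂ) := by
      rw [pow_mul, hxd]; push_cast; congr 1; ring
    rw [e1, e2, e3, Complex.Gamma_ofReal, Complex.Gamma_ofReal]
    push_cast
    rw [div_eq_mul_inv, mul_inv]
  rw [hL]
  have s1 : ∀ g : ℕ → ℝ, (∑' k : ℕ, if (k : ℝ) + 1 ≤ R then g k else 0) =
      ∑ k ∈ Finset.range ⌊R⌋₊, g k := by
    intro g
    have hiff : ∀ k : ℕ, k ∈ Finset.range ⌊R⌋₊ ↔ (k : ℝ) + 1 ≤ R := by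
      intro k
      rw [Finset.mem_range, ← Nat.succ_le_iff, Nat.le_floor_iff hR.le]; push_cast; rfl
    rw [tsum_eq_sum (s := Finset.range ⌊R⌋₊) (fun k hk => if_neg (fun h => hk ((hiff k).2 h)))]
    exact Finset.sum_congr rfl fun k hk => if_pos ((hiff k).1 hk)
  have s2 : ∀ g : ℕ → ℝ, (∑' k : ℕ, if ((k : ℝ) - ν - 1 / 2) / σ ≤ R then g k else 0) =
      ∑ k ∈ Finset.range ⌊σ * R + ν + 1 / 2 + 1⌋₊, g k := by
    intro g
    have hiff : ∀ k : ℕ, k ∈ Finset.range ⌊σ * R + ν + 1 / 2 + 1⌋₊ ↔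
        ((k : ℝ) - ν - 1 / 2) / σ ≤ R := by
      intro k
      rw [Finset.mem_range, ← Nat.succ_le_iff, Nat.le_floor_iff' (Nat.succ_ne_zero k),
        div_le_iff₀ hσ]
      push_cast
      constructor <;> intro h <;> linarith
    rw [tsum_eq_sum (s := Finset.range ⌊σ * R + ν + 1 / 2 + 1⌋₊)
      (fun k hk => if_neg (fun h => hk ((hiff k).2 h)))]
    exact Finset.sum_congr rfl fun k hk => if_pos ((hiff k).1 hk)
  rw [s1, s2, ← Complex.ofReal_sub, ← Complex.ofReal_sub, Complex.norm_real, Real.norm_eq_abs]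
  refine (hbd x hx).trans (mul_le_mul_of_nonneg_right (by linarith) (by positivity))
end

section
/- Let 0 < σ < 1/3 and let ν be real such that σn − ν − 1/2 is not a nonpositive integer for any natural number n. Set κ = 1 − σ, h = σ^σ, ϑ = −ν − 3/2, A₀ = √(2π)(κ/σ)^{ν+1}, and for real z > 0 set X(z) = κ (h z²/4)^{1/κ}. Then, as z → +∞ through positive real values, (z/2)^{−ν−1} L_ν(z; −σ) · X(z)^{ν+3/2} · e^{−X(z) cos(πσ/κ)} + (A₀/π) sin( X(z) sin(πσ/κ) + πϑ/κ ) → 0. In particular, since cos(πσ/κ) > 0 for 0 < σ < 1/3, L_ν(z;−σ) is exponentially large and oscillatory as z → +∞. -/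
open Filter Topology

/-- The variable `X = κ (h z²/4)^{1/κ}` with `κ = 1 − σ`, `h = σ^σ`. -/
noncomputable def struveXneg (σ z : ℝ) : ℝ :=
  (1 - σ) * (σ ^ σ * z ^ 2 / 4) ^ (1 / (1 - σ))


noncomputable def sgt (β : ℝ) (r : ℂ) (y : ℝ) : ℂ :=
  ((Real.Gamma β : ℝ) : ℂ)⁻¹ * ∫ v in (0:ℝ)..y, ((v ^ (β - 1) : ℝ) : ℂ) * Complex.exp (-r * v)

lemma sgt_intervalIntegrable_rpow (β : ℝ) (hβ : 0 < β) (a y : ℝ) :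
    IntervalIntegrable (fun v : ℝ => ((v ^ (β - 1) : ℝ) : ℂ)) MeasureTheory.volume a y :=
  have h : IntervalIntegrable (fun v : ℝ => v ^ (β - 1)) MeasureTheory.volume a y :=
    intervalIntegral.intervalIntegrable_rpow' (by linarith)
  ⟨h.1.ofReal, h.2.ofReal⟩

lemma sgt_beta (β : ℝ) (hβ : 0 < β) (y : ℝ) (hy : 0 < y) (m : ℕ) :
    ∫ v in (0:ℝ)..y, ((v ^ (β - 1) : ℝ) : ℂ) * ((y - v : ℝ) : ℂ) ^ m
      = ((y ^ β * y ^ m * (Real.Gamma β * m.factorial / Real.Gamma (m + (β + 1))) : ℝ) : ℂ) := by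
  have h := Complex.betaIntegral_scaled (β : ℂ) ((m : ℂ) + 1) hy
  rw [Complex.betaIntegral_eq_Gamma_mul_div _ _ (by simpa) (by simp; positivity)] at h
  have e : (β : ℂ) + ((m:ℂ) + 1) - 1 = ((β + m : ℝ) : ℂ) := by push_cast; ring
  rw [e, Complex.Gamma_nat_eq_factorial, ← Complex.ofReal_cpow hy.le, Complex.Gamma_ofReal,
    show (β : ℂ) + ((m:ℂ) + 1) = ((m + (β + 1) : ℝ) : ℂ) by push_cast; ring,
    Complex.Gamma_ofReal, Real.rpow_add hy, Real.rpow_natCast] at h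
  push_cast
  push_cast at h
  rw [← h]
  apply intervalIntegral.integral_congr_ae
  refine Eventually.of_forall fun v hv => ?_
  rw [Set.uIoc_of_le hy.le] at hv
  rw [Complex.ofReal_cpow hv.1.le]
  simp

lemma sgt_hasSum (β : ℝ) (hβ : 0 < β) (r : ℂ) (y : ℝ) (hy : 0 < y) :
    HasSum (fun m : ℕ => (r * y) ^ m / ((Real.Gamma (m + (β + 1)) : ℝ) : ℂ))
      (Complex.exp (r * y) * ((y ^ (-β) : ℝ) : ℂ) * sgt β r y) := by
  have hG : ((Real.Gamma β : ℝ) : ℂ) ≠ 0 := by exact_mod_cast (Real.Gamma_pos_of_pos hβ).ne'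
  have key : HasSum (fun m : ℕ => ∫ v in (0:ℝ)..y,
      ((v ^ (β - 1) : ℝ) : ℂ) * ((y - v : ℝ) : ℂ) ^ m * (r ^ m / (m.factorial : ℂ)))
      (∫ v in (0:ℝ)..y, ((v ^ (β - 1) : ℝ) : ℂ) * Complex.exp (r * (y - v))) := by
    apply intervalIntegral.hasSum_integral_of_dominated_convergence
      (fun m v => |v ^ (β - 1)| * ((‖r‖ * y) ^ m / (m.factorial : ℝ)))
    · intro m
      refine Measurable.aestronglyMeasurable ?_
      fun_prop
    · intro m
      refine Eventually.of_forall fun v hv => ?_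
      rw [Set.uIoc_of_le hy.le] at hv
      rw [norm_mul, norm_mul, norm_div, norm_pow, norm_pow, Complex.norm_real, Complex.norm_real,
        Complex.norm_natCast, Real.norm_eq_abs, Real.norm_eq_abs, mul_assoc,
        abs_of_nonneg (show 0 ≤ y - v by linarith [hv.2]), mul_pow, mul_div_assoc', mul_comm (‖r‖ ^ m)]
      have h1 := hv.1
      have h2 := hv.2
      gcongr
      linarith
    · refine Eventually.of_forall fun v hv => ?_
      exact (Real.summable_pow_div_factorial _).mul_left _
    · simp_rw [tsum_mul_left]
      exact (intervalIntegral.intervalIntegrable_rpow' (by linarith)).abs.mul_const _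
    · refine Eventually.of_forall fun v hv => ?_
      have := NormedSpace.expSeries_div_hasSum_exp (𝔸 := ℂ) (r * (y - v))
      rw [← Complex.exp_eq_exp_ℂ] at this
      convert! this.mul_left ((v ^ (β - 1) : ℝ) : ℂ) using 2 with m
      push_cast
      rw [mul_pow]; ring
  have h2 := key.mul_left (((Real.Gamma β : ℝ) : ℂ)⁻¹ * ((y ^ (-β) : ℝ) : ℂ))
  have hyb : ((y ^ β : ℝ) : ℂ) ≠ 0 := by exact_mod_cast (Real.rpow_pos_of_pos hy β).ne'
  convert! h2 using 1
  · funext m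
    rw [intervalIntegral.integral_mul_const, sgt_beta β hβ y hy m, Real.rpow_neg hy.le]
    have : (m.factorial : ℂ) ≠ 0 := by exact_mod_cast m.factorial_ne_zero
    push_cast
    field_simp
    ring
  · rw [sgt]
    have : ∀ v : ℝ, ((v ^ (β - 1) : ℝ) : ℂ) * Complex.exp (r * (y - v))
      = Complex.exp (r * y) * (((v ^ (β - 1) : ℝ) : ℂ) * Complex.exp (-r * v)) := by
      intro v
      rw [mul_left_comm, ← Complex.exp_add]; ring_nf
    simp_rw [this]
    rw [intervalIntegral.integral_const_mul]
    ring

lemma sgt_integrand (β : ℝ) (hβ : 0 < β) (r : ℂ) (a y : ℝ) :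
    IntervalIntegrable (fun v : ℝ => ((v ^ (β - 1) : ℝ) : ℂ) * Complex.exp (-r * v))
      MeasureTheory.volume a y := by
  apply (sgt_intervalIntegrable_rpow β hβ a y).mul_continuousOn
  fun_prop

lemma sgt_continuous (β : ℝ) (hβ : 0 < β) (r : ℂ) : Continuous (sgt β r) := by
  unfold sgt
  exact continuous_const.mul
    (intervalIntegral.continuous_primitive (fun a b => sgt_integrand β hβ r a b) 0)

lemma sgt_norm (β : ℝ) (r : ℂ) (v : ℝ) (hv : 0 < v) :
    ‖((v ^ (β - 1) : ℝ) : ℂ) * Complex.exp (-r * v)‖ = v ^ (β - 1) * Real.exp (-(r.re * v)) := by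
  rw [norm_mul, Complex.norm_real, Complex.norm_exp, Real.norm_eq_abs,
    abs_of_pos (Real.rpow_pos_of_pos hv _)]
  simp

lemma rpow_exp_integrableOn (β : ℝ) (hβ : 0 < β) (c : ℝ) (hc : 0 < c) :
    MeasureTheory.IntegrableOn (fun v : ℝ => v ^ (β - 1) * Real.exp (-(c * v))) (Set.Ioi 0) := by
  have := integrableOn_rpow_mul_exp_neg_mul_rpow (p := 1) (s := β - 1) (b := c) (by linarith)
    one_pos hc
  simpa using this

lemma sgt_integrableOn (β : ℝ) (hβ : 0 < β) (r : ℂ) (hr : 0 < r.re) :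
    MeasureTheory.IntegrableOn
      (fun v : ℝ => ((v ^ (β - 1) : ℝ) : ℂ) * Complex.exp (-r * v)) (Set.Ioi 0) := by
  refine MeasureTheory.Integrable.mono' (rpow_exp_integrableOn β hβ r.re hr) ?_ ?_
  · refine Measurable.aestronglyMeasurable ?_
    fun_prop
  · refine (MeasureTheory.ae_restrict_iff' measurableSet_Ioi).2 (Eventually.of_forall fun v hv => ?_)
    exact (sgt_norm β r v hv).le

lemma cexp_gamma_integral_real (β : ℝ) (hβ : 0 < β) (r : ℝ) (hr : 0 < r) :
    ∫ v in Set.Ioi (0:ℝ), ((v ^ (β - 1) : ℝ) : ℂ) * Complex.exp (-(r:ℂ) * v)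
     = (1 / (r:ℂ)) ^ (β : ℂ) * ((Real.Gamma β : ℝ) : ℂ) := by
  rw [← Complex.Gamma_ofReal, ← Complex.integral_cpow_mul_exp_neg_mul_Ioi (by simpa) hr]
  refine MeasureTheory.setIntegral_congr_fun measurableSet_Ioi (fun v hv => ?_)
  simp only [Set.mem_Ioi] at hv
  rw [Complex.ofReal_cpow hv.le]
  simp

lemma cexp_gamma_integral_hasDerivAt (β : ℝ) (hβ : 0 < β) (r : ℂ) (hr : 0 < r.re) :
    HasDerivAt (fun r : ℂ => ∫ v in Set.Ioi (0:ℝ), ((v ^ (β - 1) : ℝ) : ℂ) * Complex.exp (-r * v))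
      (∫ v in Set.Ioi (0:ℝ), ((v ^ (β - 1) : ℝ) : ℂ) * (Complex.exp (-r * v) * (-v))) r := by
  have hs : {w : ℂ | r.re / 2 < w.re} ∈ 𝓝 r :=
    (isOpen_lt continuous_const Complex.continuous_re).mem_nhds (by simp; linarith)
  refine (hasDerivAt_integral_of_dominated_loc_of_deriv_le
    (μ := MeasureTheory.volume.restrict (Set.Ioi (0:ℝ)))
    (F := fun (r : ℂ) (v : ℝ) => ((v ^ (β - 1) : ℝ) : ℂ) * Complex.exp (-r * v))
    (F' := fun (r : ℂ) (v : ℝ) => ((v ^ (β - 1) : ℝ) : ℂ) * (Complex.exp (-r * v) * (-v)))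
    (bound := fun v => v ^ ((β + 1) - 1) * Real.exp (-(r.re / 2 * v)))
    hs ?_ (sgt_integrableOn β hβ r hr) ?_ ?_ ?_ ?_).2
  · refine Eventually.of_forall fun w => Measurable.aestronglyMeasurable ?_
    fun_prop
  · refine Measurable.aestronglyMeasurable ?_
    fun_prop
  · refine (MeasureTheory.ae_restrict_iff' measurableSet_Ioi).2
      (Eventually.of_forall fun v hv w hw => ?_)
    simp only [Set.mem_Ioi] at hv
    simp only [Set.mem_ofPred_eq] at hw
    rw [← mul_assoc, norm_mul, sgt_norm β w v hv, norm_neg, Complex.norm_real, Real.norm_eq_abs,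
      abs_of_pos hv]
    have e : v ^ (β + 1 - 1) = v ^ (β - 1) * v := by
      rw [← Real.rpow_add_one hv.ne']; ring_nf
    rw [e, mul_right_comm]
    gcongr
  · exact rpow_exp_integrableOn (β + 1) (by linarith) _ (by linarith)
  · refine Eventually.of_forall fun v w hw => ?_
    refine HasDerivAt.const_mul _ ?_
    refine HasDerivAt.cexp ?_
    simpa using ((hasDerivAt_id w).neg.mul_const (v : ℂ))

lemma cexp_gamma_integral (β : ℝ) (hβ : 0 < β) (r : ℂ) (hr : 0 < r.re) :
    ∫ v in Set.Ioi (0:ℝ), ((v ^ (β - 1) : ℝ) : ℂ) * Complex.exp (-r * v)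
     = (1 / r) ^ (β : ℂ) * ((Real.Gamma β : ℝ) : ℂ) := by
  have hopen : IsOpen {w : ℂ | 0 < w.re} := isOpen_lt continuous_const Complex.continuous_re
  have h1 : AnalyticOnNhd ℂ (fun r : ℂ =>
      ∫ v in Set.Ioi (0:ℝ), ((v ^ (β - 1) : ℝ) : ℂ) * Complex.exp (-r * v)) {w : ℂ | 0 < w.re} := by
    refine DifferentiableOn.analyticOnNhd (fun w hw => ?_) hopen
    exact (cexp_gamma_integral_hasDerivAt β hβ w hw).differentiableAt.differentiableWithinAt
  have h2 : AnalyticOnNhd ℂ (fun r : ℂ =>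
      (1 / r) ^ (β : ℂ) * ((Real.Gamma β : ℝ) : ℂ)) {w : ℂ | 0 < w.re} := by
    refine DifferentiableOn.analyticOnNhd (fun w hw => ?_) hopen
    simp only [Set.mem_ofPred_eq] at hw
    have hw0 : w ≠ 0 := by rintro rfl; simp at hw
    refine DifferentiableAt.differentiableWithinAt ?_
    refine DifferentiableAt.mul_const ?_ _
    refine DifferentiableAt.cpow_const ?_ ?_
    · exact (differentiableAt_const _).div differentiableAt_id hw0
    · left
      rw [one_div, Complex.inv_re]
      exact div_pos hw (Complex.normSq_pos.2 hw0)
  refine h1.eqOn_of_preconnected_of_frequently_eq h2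
    (convex_halfSpace_re_gt 0).isPreconnected (z₀ := 1) (by simp) ?_ hr
  have ht : Tendsto (fun n : ℕ => ((1 + 1 / ((n : ℝ) + 1) : ℝ) : ℂ)) atTop (𝓝[≠] 1) := by
    refine tendsto_nhdsWithin_iff.2 ⟨?_, Eventually.of_forall fun n => ?_⟩
    · have := (tendsto_one_div_add_atTop_nhds_zero_nat (𝕜 := ℝ)).const_add 1
      rw [add_zero] at this
      have h3 := (Complex.continuous_ofReal.tendsto 1).comp this
      simpa [Function.comp_def] using h3
    · intro h
      have h : ((1 + 1 / ((n : ℝ) + 1) : ℝ) : ℂ) = ((1:ℝ):ℂ) := by simpa using h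
      rw [Complex.ofReal_inj] at h
      have : 0 < 1 / ((n : ℝ) + 1) := by positivity
      linarith
  refine ht.frequently (Eventually.of_forall fun n => ?_).frequently
  exact cexp_gamma_integral_real β hβ _ (by positivity)

lemma sgt_tendsto (β : ℝ) (hβ : 0 < β) (r : ℂ) (hr : 0 < r.re) :
    Tendsto (sgt β r) atTop (𝓝 ((1 / r) ^ (β : ℂ))) := by
  have hG : ((Real.Gamma β : ℝ) : ℂ) ≠ 0 := by exact_mod_cast (Real.Gamma_pos_of_pos hβ).ne'
  have h := MeasureTheory.intervalIntegral_tendsto_integral_Ioi 0 (sgt_integrableOn β hβ r hr)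
    tendsto_id
  rw [cexp_gamma_integral β hβ r hr] at h
  have h2 := h.const_mul ((Real.Gamma β : ℝ) : ℂ)⁻¹
  have e : ((Real.Gamma β : ℝ) : ℂ)⁻¹ * ((1 / r) ^ (β : ℂ) * ((Real.Gamma β : ℝ) : ℂ))
      = (1 / r) ^ (β : ℂ) := by
    field_simp
  rw [e] at h2
  exact h2

lemma sgt_crude (β : ℝ) (hβ : 0 < β) (r : ℂ) (hr : 0 < r.re) (y : ℝ) (hy : 0 < y) :
    ‖sgt β r y‖ ≤ (Real.Gamma β)⁻¹ * β⁻¹ * y ^ β := by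
  rw [sgt, norm_mul, norm_inv, Complex.norm_real, Real.norm_eq_abs,
    abs_of_pos (Real.Gamma_pos_of_pos hβ), mul_assoc]
  have := (Real.Gamma_pos_of_pos hβ)
  gcongr
  have h : ∫ v in (0:ℝ)..y, v ^ (β - 1) = β⁻¹ * y ^ β := by
    rw [integral_rpow (by left; linarith)]
    simp [Real.zero_rpow hβ.ne']; ring
  rw [← h]
  refine intervalIntegral.norm_integral_le_of_norm_le hy.le ?_
    (intervalIntegral.intervalIntegrable_rpow' (by linarith))
  refine Eventually.of_forall fun v hv => ?_
  rw [sgt_norm β r v hv.1]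
  have h1 : Real.exp (-(r.re * v)) ≤ 1 := by
    rw [Real.exp_le_one_iff]; have := mul_pos hr hv.1; linarith
  have h2 := Real.rpow_pos_of_pos hv.1 (β - 1)
  nlinarith

lemma sgt_bounded (β : ℝ) (hβ : 0 < β) (r : ℂ) (hr : 0 < r.re) :
    ∃ C : ℝ, 0 < C ∧ ∀ y : ℝ, 0 < y → ‖sgt β r y‖ ≤ C := by
  have hG := (Real.Gamma_pos_of_pos hβ)
  have hn : 0 ≤ ∫ v in Set.Ioi (0:ℝ), v ^ (β - 1) * Real.exp (-(r.re * v)) :=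
    MeasureTheory.setIntegral_nonneg measurableSet_Ioi
      (fun v hv => by simp only [Set.mem_Ioi] at hv; positivity)
  refine ⟨(Real.Gamma β)⁻¹ * (∫ v in Set.Ioi (0:ℝ), v ^ (β - 1) * Real.exp (-(r.re * v))) + 1, by positivity,
    fun y hy => ?_⟩
  rw [sgt, norm_mul, norm_inv, Complex.norm_real, Real.norm_eq_abs,
    abs_of_pos hG]
  refine le_trans ?_ (le_add_of_nonneg_right zero_le_one)
  gcongr
  rw [intervalIntegral.integral_of_le hy.le]
  refine (MeasureTheory.norm_integral_le_integral_norm _).trans ?_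
  have : ∫ v in Set.Ioc (0:ℝ) y, ‖((v ^ (β - 1) : ℝ) : ℂ) * Complex.exp (-r * v)‖
    = ∫ v in Set.Ioc (0:ℝ) y, v ^ (β - 1) * Real.exp (-(r.re * v)) :=
    MeasureTheory.setIntegral_congr_fun measurableSet_Ioc (fun v hv => sgt_norm β r v hv.1)
  rw [this]
  refine MeasureTheory.setIntegral_mono_set (rpow_exp_integrableOn β hβ r.re hr) ?_ ?_
  · refine (MeasureTheory.ae_restrict_iff' measurableSet_Ioi).2 (Eventually.of_forall fun v hv => ?_)
    simp only [Set.mem_Ioi] at hv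
    simp only [Pi.zero_apply]
    positivity
  · exact Set.Ioc_subset_Ioi_self.eventuallyLE

lemma gamma_factorial_le (b : ℝ) (hb : 1 ≤ b) (m : ℕ) :
    (m.factorial : ℝ) * Real.Gamma b ≤ Real.Gamma (m + b) := by
  induction m with
  | zero => simp
  | succ m ih =>
    have e : ((m + 1 : ℕ) : ℝ) + b = (m + b) + 1 := by push_cast; ring
    have hp : (0:ℝ) < m + b := by positivity
    rw [e, Real.Gamma_add_one hp.ne', Nat.factorial_succ]
    push_cast
    have hG := Real.Gamma_pos_of_pos (show 0 < b by linarith)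
    calc ((m:ℝ) + 1) * m.factorial * Real.Gamma b
        = ((m:ℝ) + 1) * (m.factorial * Real.Gamma b) := by ring
      _ ≤ (m + b) * Real.Gamma (m + b) := by gcongr

lemma rpow_le_linear (σ : ℝ) (h0 : 0 < σ) (h1 : σ < 1) (x c : ℝ) (hx : 0 < x) (hc : 0 < c) :
    ∃ K : ℝ, ∀ t : ℝ, 0 < t → x * t ^ σ ≤ c * t + K := by
  set T : ℝ := (c / x) ^ (1 / (σ - 1)) with hT
  have hTp : 0 < T := by positivity
  have hTs : T ^ (σ - 1) = c / x := by
    rw [hT, ← Real.rpow_mul (by positivity), one_div, inv_mul_cancel₀ (by linarith), Real.rpow_one]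
  refine ⟨x * T ^ σ, fun t ht => ?_⟩
  have hb := rpow_one_add_le_one_add_mul_self (s := t / T - 1)
    (by have : 0 < t / T := by positivity
        linarith) (p := σ) h0.le h1.le
  rw [add_sub_cancel, Real.div_rpow ht.le hTp.le, div_le_iff₀ (by positivity)] at hb
  have e : T ^ σ = T ^ (σ - 1) * T := by
    rw [← Real.rpow_add_one hTp.ne']; ring_nf
  have hle : t ^ σ ≤ (c / x) * t + T ^ σ := by
    refine hb.trans ?_
    have h2 : (1 + σ * (t / T - 1)) ≤ 1 + t / T := by
      have : 0 < t / T := by positivity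
      nlinarith
    calc (1 + σ * (t / T - 1)) * T ^ σ ≤ (1 + t / T) * T ^ σ := by gcongr
      _ = (c / x) * t + T ^ σ := by
        rw [e, hTs]; field_simp; ring
  calc x * t ^ σ ≤ x * ((c / x) * t + T ^ σ) := by gcongr
    _ = c * t + x * T ^ σ := by field_simp

lemma struve_series_integral (σ α β x : ℝ) (r : ℂ) (h0 : 0 < σ) (h1 : σ < 1) (hα : 0 < α)
    (hβ : 0 < β) (hx : 0 < x) (hr : 0 < r.re) (hr1 : ‖r‖ = 1) :
    HasSum (fun m : ℕ => (1 / r) ^ ((σ * m + α : ℝ) : ℂ) * ((Real.Gamma (σ * m + α) : ℝ) : ℂ)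
        * ((r * x) ^ m / ((Real.Gamma (m + (β + 1)) : ℝ) : ℂ)))
      (∫ t in Set.Ioi (0:ℝ), ((t ^ (α - 1) : ℝ) : ℂ) * Complex.exp (-r * t) *
        (Complex.exp (r * (x * t ^ σ : ℝ)) * (((x * t ^ σ) ^ (-β) : ℝ) : ℂ) *
          sgt β r (x * t ^ σ))) := by
  have key : HasSum (fun m : ℕ => ∫ t in Set.Ioi (0:ℝ),
      ((t ^ (α - 1) : ℝ) : ℂ) * Complex.exp (-r * t) *
        ((r * (x * t ^ σ : ℝ)) ^ m / ((Real.Gamma (m + (β + 1)) : ℝ) : ℂ)))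
      (∫ t in Set.Ioi (0:ℝ), ((t ^ (α - 1) : ℝ) : ℂ) * Complex.exp (-r * t) *
        (Complex.exp (r * (x * t ^ σ : ℝ)) * (((x * t ^ σ) ^ (-β) : ℝ) : ℂ) *
          sgt β r (x * t ^ σ))) := by
    have hG := Real.Gamma_pos_of_pos (show 0 < β + 1 by linarith)
    apply MeasureTheory.hasSum_integral_of_dominated_convergence
      (fun m t => t ^ (α - 1) * Real.exp (-(r.re * t)) * (Real.Gamma (β + 1))⁻¹ *
        ((x * t ^ σ) ^ m / (m.factorial : ℝ)))
    · intro m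
      refine Measurable.aestronglyMeasurable ?_
      fun_prop
    · intro m
      refine (MeasureTheory.ae_restrict_iff' measurableSet_Ioi).2 (Eventually.of_forall fun t ht => ?_)
      simp only [Set.mem_Ioi] at ht
      rw [norm_mul, sgt_norm α r t ht, norm_div, norm_pow, norm_mul, hr1, one_mul, Complex.norm_real,
        Complex.norm_real, Real.norm_of_nonneg (by positivity),
        Real.norm_of_nonneg (Real.Gamma_pos_of_pos (by positivity)).le, mul_assoc _ (Real.Gamma (β + 1))⁻¹]
      refine mul_le_mul_of_nonneg_left ?_ (by positivity)
      rw [inv_mul_eq_div, div_div]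
      gcongr
      exact gamma_factorial_le _ (by linarith) m
    · refine Eventually.of_forall fun v => ?_
      exact (Real.summable_pow_div_factorial _).mul_left _
    · simp_rw [tsum_mul_left]
      obtain ⟨K, hK⟩ := rpow_le_linear σ h0 h1 x (r.re / 2) hx (by linarith)
      refine MeasureTheory.Integrable.mono'
        (((rpow_exp_integrableOn α hα (r.re / 2) (by linarith)).mul_const
          ((Real.Gamma (β + 1))⁻¹ * Real.exp K))) ?_ ?_
      · have : ∀ t : ℝ, ∑' m : ℕ, (x * t ^ σ) ^ m / (m.factorial : ℝ) = Real.exp (x * t ^ σ) := by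
          intro t
          rw [Real.exp_eq_exp_ℝ, NormedSpace.exp_eq_tsum_div]
        simp_rw [this]
        refine Measurable.aestronglyMeasurable ?_
        fun_prop
      · refine (MeasureTheory.ae_restrict_iff' measurableSet_Ioi).2 (Eventually.of_forall fun t ht => ?_)
        simp only [Set.mem_Ioi] at ht
        have : ∑' m : ℕ, (x * t ^ σ) ^ m / (m.factorial : ℝ) = Real.exp (x * t ^ σ) := by
          rw [Real.exp_eq_exp_ℝ, NormedSpace.exp_eq_tsum_div]
        rw [this, Real.norm_of_nonneg (by positivity)]
        have h2 := Real.exp_le_exp.2 (hK t ht)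
        calc t ^ (α - 1) * Real.exp (-(r.re * t)) * (Real.Gamma (β + 1))⁻¹ * Real.exp (x * t ^ σ)
            ≤ t ^ (α - 1) * Real.exp (-(r.re * t)) * (Real.Gamma (β + 1))⁻¹ *
              Real.exp (r.re / 2 * t + K) := by gcongr
          _ = t ^ (α - 1) * (Real.Gamma (β + 1))⁻¹ *
              (Real.exp (-(r.re * t)) * Real.exp (r.re / 2 * t + K)) := by ring
          _ = _ := by
            rw [← Real.exp_add, show -(r.re * t) + (r.re / 2 * t + K) = -(r.re / 2 * t) + K by ring,
              Real.exp_add]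
            ring
    · refine (MeasureTheory.ae_restrict_iff' measurableSet_Ioi).2 (Eventually.of_forall fun t ht => ?_)
      simp only [Set.mem_Ioi] at ht
      exact (sgt_hasSum β hβ r (x * t ^ σ) (by positivity)).mul_left _
  convert! key using 1
  funext m
  rw [← cexp_gamma_integral (σ * m + α) (by positivity) r hr, ← MeasureTheory.integral_mul_const]
  refine MeasureTheory.setIntegral_congr_fun measurableSet_Ioi (fun t ht => ?_)
  simp only [Set.mem_Ioi] at ht
  have e : t ^ (σ * m + α - 1) = t ^ (α - 1) * (t ^ σ) ^ m := by
    rw [← Real.rpow_natCast, ← Real.rpow_mul ht.le, ← Real.rpow_add ht]; ring_nf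
  rw [e]
  push_cast
  rw [mul_pow, mul_pow, mul_pow]
  ring


/-- The phase function of the Laplace integral. -/
noncomputable def phq (σ y : ℝ) : ℝ := 1 + σ * (y - 1) - y ^ σ

lemma phq_lower (σ : ℝ) (h0 : 0 < σ) (h1 : σ < 1 / 3) (y : ℝ) (hy : 0 < y) :
    σ * (y - 1) ^ 2 / (2 * (1 + y)) ≤ phq σ y := by
  have hs : 0 < √y := Real.sqrt_pos.2 hy
  have hb := rpow_one_add_le_one_add_mul_self (s := √y - 1) (by linarith) (p := 2 * σ)
    (by linarith) (by linarith)
  have e : (1 + (√y - 1)) ^ (2 * σ) = y ^ σ := by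
    rw [add_sub_cancel, Real.sqrt_eq_rpow, ← Real.rpow_mul hy.le]; ring_nf
  rw [e] at hb
  have hq : σ * (√y - 1) ^ 2 ≤ phq σ y := by
    unfold phq
    nlinarith [Real.sq_sqrt hy.le]
  refine le_trans ?_ hq
  rw [div_le_iff₀ (by positivity)]
  have h2 : y = √y ^ 2 := (Real.sq_sqrt hy.le).symm
  generalize √y = w at *
  subst h2
  have : (w ^ 2 - 1) ^ 2 ≤ (w - 1) ^ 2 * (2 * (1 + w ^ 2)) := by
    nlinarith [mul_nonneg (sq_nonneg (w - 1)) (sq_nonneg (w - 1))]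
  nlinarith

lemma phq_lower_far (σ : ℝ) (h0 : 0 < σ) (h1 : σ < 1 / 3) (y : ℝ) (hy : 0 < y)
    (hf : y ∉ Set.Ioo (1 / 2 : ℝ) (3 / 2)) : σ / 50 * (1 + y) ≤ phq σ y := by
  refine le_trans ?_ (phq_lower σ h0 h1 y hy)
  rw [le_div_iff₀ (by positivity)]
  have : (1 + y) ^ 2 ≤ 25 * (y - 1) ^ 2 := by
    by_cases h : 1 / 2 < y
    · have : 3 / 2 ≤ y := by by_contra hc; exact hf ⟨h, by linarith⟩
      nlinarith
    · nlinarith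
  nlinarith

lemma phq_lower_near (σ : ℝ) (h0 : 0 < σ) (h1 : σ < 1 / 3) (y : ℝ)
    (hf : y ∈ Set.Ioo (1 / 2 : ℝ) (3 / 2)) : σ / 5 * (y - 1) ^ 2 ≤ phq σ y := by
  have := hf.1
  have := hf.2
  refine le_trans ?_ (phq_lower σ h0 h1 y (by linarith))
  rw [le_div_iff₀ (by linarith)]
  have : 0 ≤ σ * (y - 1) ^ 2 := by positivity
  nlinarith

lemma phq_lower_all (σ : ℝ) (h0 : 0 < σ) (h1 : σ < 1 / 3) (y : ℝ) (hy : 0 < y) :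
    σ / 2 * (y - 3) ≤ phq σ y := by
  refine le_trans ?_ (phq_lower σ h0 h1 y hy)
  rw [le_div_iff₀ (by positivity)]
  nlinarith

lemma phq_taylor (σ : ℝ) :
    Tendsto (fun h : ℝ => phq σ (1 + h) / h ^ 2) (𝓝[≠] 0) (𝓝 (σ * (1 - σ) / 2)) := by
  have hp : ∀ᶠ h : ℝ in 𝓝[≠] 0, 0 < 1 + h := by
    refine eventually_nhdsWithin_of_eventually_nhds ?_
    filter_upwards [lt_mem_nhds (show (-1:ℝ) < 0 by norm_num)] with h hh
    linarith
  have hd : ∀ p h : ℝ, 0 < 1 + h → HasDerivAt (fun h : ℝ => (1 + h) ^ p) (p * (1 + h) ^ (p - 1)) h := by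
    intro p h hh
    have := ((hasDerivAt_id h).const_add 1).rpow_const (p := p) (Or.inl hh.ne')
    simpa using! this
  apply HasDerivAt.lhopital_zero_nhdsNE (f' := fun h => σ - σ * (1 + h) ^ (σ - 1))
    (g' := fun h => 2 * h)
  · filter_upwards [hp] with h hh
    unfold phq
    have h1 : HasDerivAt (fun h : ℝ => 1 + σ * (1 + h - 1)) σ h := by
      have := (((hasDerivAt_id h).const_mul σ).const_add 1)
      simpa using! this
    exact h1.sub (hd σ h hh)
  · refine Eventually.of_forall fun h => ?_
    simpa using hasDerivAt_pow 2 h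
  · filter_upwards [self_mem_nhdsWithin] with h hh
    simpa using hh
  · refine tendsto_nhdsWithin_of_tendsto_nhds ?_
    have h1 : ContinuousAt (fun h : ℝ => phq σ (1 + h)) 0 := by
      unfold phq
      exact ContinuousAt.sub (by fun_prop) (hd σ 0 (by norm_num)).continuousAt
    have := h1.tendsto
    simpa [phq] using! this
  · refine tendsto_nhdsWithin_of_tendsto_nhds ?_
    have : Continuous (fun h : ℝ => h ^ 2) := by fun_prop
    simpa using! this.tendsto 0
  · have h2 := ((hd (σ - 1) 0 (by norm_num)).const_mul σ).const_sub σ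
    rw [hasDerivAt_iff_tendsto_slope] at h2
    have h3 := h2.div_const 2
    have e : -(σ * ((σ - 1) * (1 + 0) ^ (σ - 1 - 1))) / 2 = σ * (1 - σ) / 2 := by simp; ring
    rw [e] at h3
    refine h3.congr' ?_
    filter_upwards [self_mem_nhdsWithin] with h hh
    have : h ≠ 0 := hh
    simp [slope_def_field]
    field_simp

lemma phq_limit (σ v : ℝ) :
    Tendsto (fun L : ℝ => L * phq σ (1 + v / √L)) atTop (𝓝 (σ * (1 - σ) / 2 * v ^ 2)) := by
  by_cases hv : v = 0
  · subst hv
    simp [phq]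
  have ht : Tendsto (fun L : ℝ => v / √L) atTop (𝓝[≠] 0) := by
    refine tendsto_nhdsWithin_iff.2 ⟨?_, ?_⟩
    · exact tendsto_const_nhds.div_atTop Real.tendsto_sqrt_atTop
    · filter_upwards [eventually_gt_atTop 0] with L hL
      have := Real.sqrt_pos.2 hL
      simp only [Set.mem_compl_iff, Set.mem_singleton_iff]
      positivity
  have := ((phq_taylor σ).comp ht).mul_const (v ^ 2)
  refine this.congr' ?_
  filter_upwards [eventually_gt_atTop 0] with L hL
  have := Real.sqrt_pos.2 hL
  simp only [Function.comp, div_pow, Real.sq_sqrt hL.le]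
  field_simp

/-- The Laplace integrand. -/
noncomputable def lapF (σ p : ℝ) (r : ℂ) (g : ℝ → ℂ) (L y : ℝ) : ℂ :=
  ((y ^ p : ℝ) : ℂ) * g (L * y ^ σ) * Complex.exp (-r * ((L * phq σ y : ℝ) : ℂ))

lemma lapF_measurable (σ p : ℝ) (r : ℂ) (g : ℝ → ℂ) (hg : Continuous g) (L : ℝ) :
    Measurable (lapF σ p r g L) := by
  unfold lapF phq
  have : Measurable g := hg.measurable
  fun_prop

lemma lapF_norm (σ p : ℝ) (r : ℂ) (g : ℝ → ℂ) (L y : ℝ) (hy : 0 < y) :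
    ‖lapF σ p r g L y‖ = y ^ p * ‖g (L * y ^ σ)‖ * Real.exp (-(r.re * (L * phq σ y))) := by
  rw [lapF, norm_mul, norm_mul, Complex.norm_real, Complex.norm_exp,
    Real.norm_of_nonneg (by positivity)]
  congr 2
  rw [Complex.re_mul_ofReal]; simp

lemma lapF_crude (σ α β C : ℝ) (r : ℂ) (g : ℝ → ℂ)
    (hC : ∀ y, 0 < y → ‖g y‖ ≤ C * y ^ β) (L y : ℝ) (hL : 0 < L)
    (hy : 0 < y) : ‖lapF σ (α - 1 - σ * β) r g L y‖
      ≤ C * L ^ β * (y ^ (α - 1) * Real.exp (-(r.re * (L * phq σ y)))) := by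
  rw [lapF_norm _ _ _ _ _ _ hy]
  have h := hC (L * y ^ σ) (by positivity)
  rw [Real.mul_rpow hL.le (by positivity), ← Real.rpow_mul hy.le] at h
  calc _ ≤ y ^ (α - 1 - σ * β) * (C * (L ^ β * y ^ (σ * β))) *
        Real.exp (-(r.re * (L * phq σ y))) := by gcongr
    _ = C * L ^ β * ((y ^ (α - 1 - σ * β) * y ^ (σ * β)) *
        Real.exp (-(r.re * (L * phq σ y)))) := by ring
    _ = _ := by rw [← Real.rpow_add hy]; ring_nf

lemma lapF_integrable (σ α β C : ℝ) (r : ℂ) (g : ℝ → ℂ) (h0 : 0 < σ) (h1 : σ < 1 / 3)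
    (hα : 0 < α) (hr : 0 < r.re) (hC0 : 0 < C) (hg : Continuous g)
    (hC : ∀ y, 0 < y → ‖g y‖ ≤ C * y ^ β) (L : ℝ) (hL : 0 < L) :
    MeasureTheory.IntegrableOn (lapF σ (α - 1 - σ * β) r g L) (Set.Ioi 0) := by
  refine MeasureTheory.Integrable.mono' ((rpow_exp_integrableOn α hα (r.re * L * (σ / 2))
    (by positivity)).const_mul (C * L ^ β * Real.exp (r.re * L * (σ / 2) * 3)))
    (lapF_measurable _ _ _ _ hg _).aestronglyMeasurable ?_
  refine (MeasureTheory.ae_restrict_iff' measurableSet_Ioi).2 (Eventually.of_forall fun y hy => ?_)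
  simp only [Set.mem_Ioi] at hy
  refine (lapF_crude σ α β C r g hC L y hL hy).trans ?_
  rw [mul_assoc (C * L ^ β) (Real.exp _), mul_left_comm (Real.exp _), ← Real.exp_add]
  have := phq_lower_all σ h0 h1 y hy
  gcongr
  have h2 : r.re * L * (σ / 2 * (y - 3)) ≤ r.re * L * phq σ y := by gcongr
  linarith

lemma lapF_tail (σ α β C : ℝ) (r : ℂ) (g : ℝ → ℂ) (h0 : 0 < σ) (h1 : σ < 1 / 3)
    (hα : 0 < α) (hr : 0 < r.re) (hC0 : 0 < C)
    (hC : ∀ y, 0 < y → ‖g y‖ ≤ C * y ^ β) :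
    Tendsto (fun L : ℝ => ((√L : ℝ) : ℂ) *
      ∫ y in Set.Ioi 0 \ Set.Ioo (1 / 2 : ℝ) (3 / 2), lapF σ (α - 1 - σ * β) r g L y)
      atTop (𝓝 0) := by
  set c := r.re * (σ / 50) with hc
  have hcp : 0 < c := by positivity
  set I := ∫ y in Set.Ioi (0:ℝ), y ^ (α - 1) * Real.exp (-(c * y)) with hI
  have hlim : Tendsto (fun L : ℝ => C * I * (L ^ (β + 1 / 2) * Real.exp (-c * L))) atTop (𝓝 0) := by
    simpa using (tendsto_rpow_mul_exp_neg_mul_atTop_nhds_zero (β + 1 / 2) c hcp).const_mul (C * I)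
  refine squeeze_zero_norm' ?_ hlim
  filter_upwards [eventually_ge_atTop 1] with L hL
  have hL0 : 0 < L := by linarith
  have hinteg := rpow_exp_integrableOn α hα c hcp
  have hsub : Set.Ioi (0:ℝ) \ Set.Ioo (1 / 2 : ℝ) (3 / 2) ⊆ Set.Ioi 0 := Set.sdiff_subset
  have hb : ‖∫ y in Set.Ioi 0 \ Set.Ioo (1 / 2 : ℝ) (3 / 2), lapF σ (α - 1 - σ * β) r g L y‖
      ≤ ∫ y in Set.Ioi 0 \ Set.Ioo (1 / 2 : ℝ) (3 / 2),
        C * L ^ β * Real.exp (-c * L) * (y ^ (α - 1) * Real.exp (-(c * y))) := by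
    refine MeasureTheory.norm_integral_le_of_norm_le ((hinteg.mono_set hsub).const_mul _) ?_
    refine (MeasureTheory.ae_restrict_iff' (measurableSet_Ioi.diff measurableSet_Ioo)).2
      (Eventually.of_forall fun y hy => ?_)
    have hy0 : 0 < y := hy.1
    refine (lapF_crude σ α β C r g hC L y hL0 hy0).trans ?_
    rw [mul_assoc (C * L ^ β) (Real.exp _), mul_left_comm (Real.exp _), ← Real.exp_add]
    have h3 := phq_lower_far σ h0 h1 y hy0 hy.2
    gcongr
    have h2 : r.re * L * (σ / 50 * (1 + y)) ≤ r.re * L * phq σ y := by gcongr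
    have h4 : c * y ≤ c * (L * y) := by gcongr; nlinarith
    rw [hc] at *
    linarith
  rw [MeasureTheory.integral_const_mul] at hb
  have hb2 : ∫ y in Set.Ioi 0 \ Set.Ioo (1 / 2 : ℝ) (3 / 2), (y ^ (α - 1) * Real.exp (-(c * y)))
      ≤ I := by
    refine MeasureTheory.setIntegral_mono_set hinteg ?_ hsub.eventuallyLE
    refine (MeasureTheory.ae_restrict_iff' measurableSet_Ioi).2 (Eventually.of_forall fun v hv => ?_)
    simp only [Set.mem_Ioi] at hv
    simp only [Pi.zero_apply]
    positivity
  rw [norm_mul, Complex.norm_real, Real.norm_of_nonneg (Real.sqrt_nonneg L)]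
  calc _ ≤ √L * (C * L ^ β * Real.exp (-c * L) * I) := by
        gcongr
        exact hb.trans (by gcongr)
    _ = _ := by
      rw [Real.rpow_add hL0, Real.sqrt_eq_rpow]; ring

lemma lapF_main (σ p C : ℝ) (r ℓ : ℂ) (g : ℝ → ℂ) (h0 : 0 < σ) (h1 : σ < 1 / 3)
    (hr : 0 < r.re) (hC0 : 0 < C) (hg : Continuous g)
    (hC : ∀ y, 0 < y → ‖g y‖ ≤ C) (hl : Tendsto g atTop (𝓝 ℓ)) :
    Tendsto (fun L : ℝ => ((√L : ℝ) : ℂ) *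
      ∫ y in Set.Ioo (1 / 2 : ℝ) (3 / 2), lapF σ p r g L y)
      atTop (𝓝 (ℓ * (Real.pi / (r * ((σ * (1 - σ) / 2 : ℝ) : ℂ))) ^ (1 / 2 : ℂ))) := by
  have hk : 0 < σ * (1 - σ) / 2 := by
    have : 0 < 1 - σ := by linarith
    positivity
  have hre : 0 < (r * ((σ * (1 - σ) / 2 : ℝ) : ℂ)).re := by
    rw [Complex.re_mul_ofReal]; positivity
  rw [← integral_gaussian_complex hre, ← MeasureTheory.integral_const_mul]
  obtain ⟨M, hM⟩ := (isCompact_Icc (a := (1/2:ℝ)) (b := 3/2)).exists_bound_of_continuousOn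
    (f := fun y : ℝ => y ^ p) (by
      intro y hy
      have : y ≠ 0 := by have := hy.1; intro h; subst h; norm_num at this
      exact (Real.continuousAt_rpow_const _ _ (Or.inl this)).continuousWithinAt)
  have hsubst : ∀ᶠ L : ℝ in atTop, ∫ v : ℝ, (Set.Ioo (1 / 2 : ℝ) (3 / 2)).indicator
      (lapF σ p r g L) (1 + v / √L) = ((√L : ℝ) : ℂ) *
      ∫ y in Set.Ioo (1 / 2 : ℝ) (3 / 2), lapF σ p r g L y := by
    filter_upwards [eventually_gt_atTop 0] with L hL
    have h := MeasureTheory.Measure.integral_comp_div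
      (fun v => (Set.Ioo (1 / 2 : ℝ) (3 / 2)).indicator (lapF σ p r g L) (1 + v)) (√L)
    rw [h, MeasureTheory.integral_add_left_eq_self
      (f := (Set.Ioo (1 / 2 : ℝ) (3 / 2)).indicator (lapF σ p r g L)),
      MeasureTheory.integral_indicator measurableSet_Ioo, abs_of_nonneg (Real.sqrt_nonneg _)]
    simp
  refine Tendsto.congr' hsubst ?_
  refine MeasureTheory.tendsto_integral_filter_of_dominated_convergence
    (fun v => M * C * Real.exp (-(r.re * (σ / 5)) * v ^ 2)) ?_ ?_ ?_ ?_
  · refine Eventually.of_forall fun L => Measurable.aestronglyMeasurable ?_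
    exact ((lapF_measurable σ p r g hg L).indicator measurableSet_Ioo).comp (by fun_prop)
  · filter_upwards [eventually_gt_atTop 0] with L hL
    refine Eventually.of_forall fun v => ?_
    have hM0 : 0 ≤ M := (norm_nonneg _).trans (hM 1 (by norm_num))
    rw [Set.indicator]
    split_ifs with hy
    · have hy0 : 0 < 1 + v / √L := by linarith [hy.1]
      rw [lapF_norm _ _ _ _ _ _ hy0]
      have a1 := (le_abs_self _).trans (hM _ ⟨hy.1.le, hy.2.le⟩)
      have a2 := hC (L * (1 + v / √L) ^ σ) (by positivity)
      have a3 := phq_lower_near σ h0 h1 _ hy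
      have a4 : L * (σ / 5 * (1 + v / √L - 1) ^ 2) = σ / 5 * v ^ 2 := by
        have := Real.sqrt_pos.2 hL
        rw [add_sub_cancel_left, div_pow, Real.sq_sqrt hL.le]; field_simp
      gcongr
      have a5 : r.re * (L * (σ / 5 * (1 + v / √L - 1) ^ 2)) ≤ r.re * (L * phq σ (1 + v / √L)) := by
        gcongr
      rw [a4] at a5
      linarith
    · simp; positivity
  · exact (integrable_exp_neg_mul_sq (by positivity)).const_mul _
  · refine Eventually.of_forall fun v => ?_
    have ht : Tendsto (fun L : ℝ => 1 + v / √L) atTop (𝓝 1) := by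
      have : Tendsto (fun L : ℝ => v / √L) atTop (𝓝 0) :=
        tendsto_const_nhds.div_atTop Real.tendsto_sqrt_atTop
      simpa using this.const_add 1
    have hin : ∀ᶠ L : ℝ in atTop, lapF σ p r g L (1 + v / √L) =
        (Set.Ioo (1 / 2 : ℝ) (3 / 2)).indicator (lapF σ p r g L) (1 + v / √L) := by
      filter_upwards [ht.eventually (Ioo_mem_nhds (show (1/2:ℝ) < 1 by norm_num)
        (show (1:ℝ) < 3/2 by norm_num))] with L hL
      have hL' : 1 + v / √L ∈ Set.Ioo (1 / 2 : ℝ) (3 / 2) := hL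
      rw [Set.indicator_of_mem hL']
    refine Tendsto.congr' hin ?_
    unfold lapF
    have t1 : Tendsto (fun L : ℝ => (((1 + v / √L) ^ p : ℝ) : ℂ)) atTop (𝓝 1) := by
      have := ht.rpow_const (p := p) (Or.inl one_ne_zero)
      rw [Real.one_rpow] at this
      simpa using! (Complex.continuous_ofReal.tendsto 1).comp this
    have t2 : Tendsto (fun L : ℝ => g (L * (1 + v / √L) ^ σ)) atTop (𝓝 ℓ) := by
      refine hl.comp ?_
      have := ht.rpow_const (p := σ) (Or.inl one_ne_zero)
      rw [Real.one_rpow] at this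
      exact tendsto_id.atTop_mul_pos one_pos this
    have t3 : Tendsto (fun L : ℝ => Complex.exp (-r * ((L * phq σ (1 + v / √L) : ℝ) : ℂ))) atTop
        (𝓝 (Complex.exp (-(r * ((σ * (1 - σ) / 2 : ℝ) : ℂ)) * (v:ℂ) ^ 2))) := by
      have := (Complex.continuous_ofReal.tendsto _).comp (phq_limit σ v)
      have := (Complex.continuous_exp.tendsto _).comp (this.const_mul (-r))
      convert! this using 3
      push_cast; ring
    simpa using (t1.mul t2).mul t3

lemma lapF_total (σ α β C : ℝ) (r ℓ : ℂ) (g : ℝ → ℂ) (h0 : 0 < σ) (h1 : σ < 1 / 3)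
    (hα : 0 < α) (hr : 0 < r.re) (hC0 : 0 < C) (hg : Continuous g)
    (hC : ∀ y, 0 < y → ‖g y‖ ≤ C) (hC' : ∀ y, 0 < y → ‖g y‖ ≤ C * y ^ β)
    (hl : Tendsto g atTop (𝓝 ℓ)) :
    Tendsto (fun L : ℝ => ((√L : ℝ) : ℂ) *
      ∫ y in Set.Ioi 0, lapF σ (α - 1 - σ * β) r g L y)
      atTop (𝓝 (ℓ * (Real.pi / (r * ((σ * (1 - σ) / 2 : ℝ) : ℂ))) ^ (1 / 2 : ℂ))) := by
  have h := (lapF_main σ (α - 1 - σ * β) C r ℓ g h0 h1 hr hC0 hg hC hl).add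
    (lapF_tail σ α β C r g h0 h1 hα hr hC0 hC')
  rw [add_zero] at h
  refine h.congr' ?_
  filter_upwards [eventually_gt_atTop 0] with L hL
  rw [← mul_add]
  congr 1
  have hi : Set.Ioi (0:ℝ) ∩ Set.Ioo (1 / 2 : ℝ) (3 / 2) = Set.Ioo (1 / 2 : ℝ) (3 / 2) := by
    apply Set.inter_eq_right.2
    intro y hy
    exact lt_trans (by norm_num) hy.1
  have := MeasureTheory.integral_inter_add_sdiff (s := Set.Ioi (0:ℝ)) measurableSet_Ioo
    (lapF_integrable σ α β C r g h0 h1 hα hr hC0 hg hC' L hL) (t := Set.Ioo (1 / 2 : ℝ) (3 / 2))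
  rw [hi] at this
  exact this

lemma struve_scaled_integral (σ α β L : ℝ) (r : ℂ) (h0 : 0 < σ) (hL : 0 < L) :
    (∫ t in Set.Ioi (0:ℝ), ((t ^ (α - 1) : ℝ) : ℂ) * Complex.exp (-r * t) *
        (Complex.exp (r * ((L ^ (1 - σ) * σ ^ (-σ)) * t ^ σ : ℝ)) *
          ((((L ^ (1 - σ) * σ ^ (-σ)) * t ^ σ) ^ (-β) : ℝ) : ℂ) *
          sgt β r ((L ^ (1 - σ) * σ ^ (-σ)) * t ^ σ)))
      = (((σ * L) ^ α * L ^ (-β) : ℝ) : ℂ) * Complex.exp (r * ((1 - σ) * L : ℝ)) *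
        ∫ y in Set.Ioi 0, lapF σ (α - 1 - σ * β) r (sgt β r) L y := by
  have hsL : 0 < σ * L := by positivity
  have h := MeasureTheory.integral_comp_mul_left_Ioi (fun t : ℝ =>
    ((t ^ (α - 1) : ℝ) : ℂ) * Complex.exp (-r * t) *
        (Complex.exp (r * ((L ^ (1 - σ) * σ ^ (-σ)) * t ^ σ : ℝ)) *
          ((((L ^ (1 - σ) * σ ^ (-σ)) * t ^ σ) ^ (-β) : ℝ) : ℂ) *
          sgt β r ((L ^ (1 - σ) * σ ^ (-σ)) * t ^ σ))) 0 hsL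
  rw [mul_zero] at h
  have h2 : ∀ A B : ℂ, A = (σ * L)⁻¹ • B → B = ((σ * L : ℝ) : ℂ) * A := by
    intro A B hAB
    have : ((σ * L : ℝ) : ℂ) ≠ 0 := by exact_mod_cast hsL.ne'
    rw [hAB, Complex.real_smul, Complex.ofReal_inv, mul_inv_cancel_left₀ this]
  rw [h2 _ _ h, ← MeasureTheory.integral_const_mul, ← MeasureTheory.integral_const_mul]
  refine MeasureTheory.setIntegral_congr_fun measurableSet_Ioi (fun y hy => ?_)
  simp only [Set.mem_Ioi] at hy
  have e1 : (L ^ (1 - σ) * σ ^ (-σ)) * (σ * L * y) ^ σ = L * y ^ σ := by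
    rw [Real.mul_rpow hsL.le hy.le, Real.mul_rpow h0.le hL.le, Real.rpow_neg h0.le,
      Real.rpow_sub hL, Real.rpow_one]
    field_simp
  have e2 : (σ * L) ^ α = (σ * L) ^ (α - 1) * (σ * L) := by
    rw [← Real.rpow_add_one hsL.ne']; ring_nf
  have e3 : (L * y ^ σ) ^ (-β) = L ^ (-β) * y ^ (-(σ * β)) := by
    rw [Real.mul_rpow hL.le (by positivity), ← Real.rpow_mul hy.le]; ring_nf
  have e4 : y ^ (α - 1 - σ * β) = y ^ (α - 1) * y ^ (-(σ * β)) := by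
    rw [← Real.rpow_add hy]; ring_nf
  have e5 : Complex.exp (-r * ((σ * L * y : ℝ) : ℂ)) * Complex.exp (r * ((L * y ^ σ : ℝ) : ℂ))
     = Complex.exp (r * ((1 - σ) * L : ℝ)) * Complex.exp (-r * ((L * phq σ y : ℝ) : ℂ)) := by
    rw [← Complex.exp_add, ← Complex.exp_add]
    congr 1
    unfold phq
    push_cast
    ring
  rw [e1, e2, e3, lapF, e4, Real.mul_rpow hsL.le hy.le]
  calc _ = ((σ * L : ℝ) : ℂ) * (((σ * L) ^ (α - 1) * y ^ (α - 1) : ℝ) : ℂ) *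
        (Complex.exp (-r * ((σ * L * y : ℝ) : ℂ)) * Complex.exp (r * ((L * y ^ σ : ℝ) : ℂ))) *
        ((L ^ (-β) * y ^ (-(σ * β)) : ℝ) : ℂ) * sgt β r (L * y ^ σ) := by ring
    _ = _ := by
      rw [e5]
      push_cast
      ring

lemma exp_phase_cpow (φ β : ℝ) (h1 : -Real.pi < φ) (h2 : φ < Real.pi) :
    (1 / Complex.exp (φ * Complex.I)) ^ (β : ℂ) = Complex.exp ((-(φ * β) : ℝ) * Complex.I) := by
  rw [one_div, ← Complex.exp_neg, Complex.cpow_def_of_ne_zero (Complex.exp_ne_zero _),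
    Complex.log_exp (by simp; linarith) (by simp; linarith)]
  congr 1
  push_cast; ring

lemma exp_phase_sqrt (φ s : ℝ) (h1 : -Real.pi < φ) (h2 : φ < Real.pi) (hs : 0 < s) :
    (Real.pi / (Complex.exp (φ * Complex.I) * (s : ℂ))) ^ (1 / 2 : ℂ)
      = ((√(Real.pi / s) : ℝ) : ℂ) * Complex.exp ((-(φ / 2) : ℝ) * Complex.I) := by
  have hp : 0 < Real.pi / s := by positivity
  have e : (Real.pi / (Complex.exp (φ * Complex.I) * (s : ℂ)))
      = Complex.exp ((Real.log (Real.pi / s) : ℝ) + (-φ : ℝ) * Complex.I) := by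
    rw [Complex.exp_add, ← Complex.ofReal_exp, Real.exp_log hp]
    push_cast
    rw [neg_mul, Complex.exp_neg]
    have := Complex.exp_ne_zero (φ * Complex.I)
    have : (s : ℂ) ≠ 0 := by exact_mod_cast hs.ne'
    field_simp
  rw [e, Complex.cpow_def_of_ne_zero (Complex.exp_ne_zero _),
    Complex.log_exp (by simp; linarith) (by simp; linarith)]
  have e2 : √(Real.pi / s) = Real.exp (Real.log (Real.pi / s) * (1 / 2)) := by
    rw [Real.sqrt_eq_rpow, Real.rpow_def_of_pos hp]
  rw [e2, Complex.ofReal_exp, ← Complex.exp_add]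
  congr 1
  push_cast; ring

/-- Real tail term via reflection. -/
lemma struve_tail_term (σ ν x : ℝ) (N m : ℕ) (h0 : 0 < σ) (h1 : σ < 1 / 3)
    (hα : 0 < -ν - 1 / 2 + σ * N) :
    x ^ (m + N) / (Real.Gamma ((m + N : ℕ) + 3 / 2) *
      Real.Gamma (-σ * (m + N : ℕ) + ν + 3 / 2))
    = x ^ N / Real.pi * (Complex.exp ((Real.pi * (-ν - 1 / 2 + σ * N) / (1 - σ) : ℝ) * Complex.I) *
      ((1 / Complex.exp ((Real.pi * σ / (1 - σ) : ℝ) * Complex.I)) ^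
          ((σ * m + (-ν - 1 / 2 + σ * N) : ℝ) : ℂ) *
        ((Real.Gamma (σ * m + (-ν - 1 / 2 + σ * N)) : ℝ) : ℂ)
        * ((Complex.exp ((Real.pi * σ / (1 - σ) : ℝ) * Complex.I) * x) ^ m /
          ((Real.Gamma (m + ((N + 1 / 2) + 1)) : ℝ) : ℂ)))).im := by
  have hk : 0 < 1 - σ := by linarith
  have hpi := Real.pi_pos
  have hφ0 : 0 < Real.pi * σ / (1 - σ) := by positivity
  have hφ1 : Real.pi * σ / (1 - σ) < Real.pi := by
    rw [div_lt_iff₀ hk]; nlinarith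
  set s : ℝ := σ * m + (-ν - 1 / 2 + σ * N) with hs
  have hsp : 0 < s := by positivity
  have hG := Real.Gamma_pos_of_pos hsp
  have e1 : -σ * (m + N : ℕ) + ν + 3 / 2 = 1 - s := by rw [hs]; push_cast; ring
  have hrefl := Real.Gamma_mul_Gamma_one_sub s
  have e2 : (Real.Gamma (1 - s))⁻¹ = Real.Gamma s * Real.sin (Real.pi * s) / Real.pi := by
    have : Real.Gamma (1 - s) = (Real.Gamma s)⁻¹ * (Real.pi / Real.sin (Real.pi * s)) := by
      rw [← hrefl]; field_simp
    rw [this, mul_inv, inv_inv, inv_div]; ring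
  have e3 : ((m + N : ℕ) : ℝ) + 3 / 2 = m + ((N + 1 / 2) + 1) := by push_cast; ring
  rw [exp_phase_cpow _ _ (by linarith) hφ1, e1, e3, mul_pow, ← Complex.exp_nat_mul]
  have e4 : Complex.exp ((Real.pi * (-ν - 1 / 2 + σ * N) / (1 - σ) : ℝ) * Complex.I) *
      (Complex.exp ((-(Real.pi * σ / (1 - σ) * s) : ℝ) * Complex.I) * ((Real.Gamma s : ℝ) : ℂ) *
      (Complex.exp (m * ((Real.pi * σ / (1 - σ) : ℝ) * Complex.I)) * (x:ℂ) ^ m /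
        ((Real.Gamma (m + ((N + 1 / 2) + 1)) : ℝ) : ℂ)))
      = ((Real.Gamma s * x ^ m / Real.Gamma (m + ((N + 1 / 2) + 1)) : ℝ) : ℂ) *
        Complex.exp ((Real.pi * s : ℝ) * Complex.I) := by
    have e5 : Complex.exp ((Real.pi * s : ℝ) * Complex.I) =
      Complex.exp ((Real.pi * (-ν - 1 / 2 + σ * N) / (1 - σ) : ℝ) * Complex.I) *
      Complex.exp ((-(Real.pi * σ / (1 - σ) * s) : ℝ) * Complex.I) *
      Complex.exp (m * ((Real.pi * σ / (1 - σ) : ℝ) * Complex.I)) := by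
      rw [← Complex.exp_add, ← Complex.exp_add]
      congr 1
      have : Real.pi * s = Real.pi * (-ν - 1 / 2 + σ * N) / (1 - σ) + -(Real.pi * σ / (1 - σ) * s)
        + m * (Real.pi * σ / (1 - σ)) := by
        rw [hs]; field_simp; ring
      rw [this]
      push_cast
      ring
    rw [e5]
    push_cast
    ring
  rw [e4, Complex.im_ofReal_mul, Complex.exp_ofReal_mul_I_im, pow_add, div_eq_mul_inv, mul_inv, e2]
  ring



/-- Phase point `r = exp(iπσ/κ)`. -/
noncomputable def strR (σ : ℝ) : ℂ := Complex.exp ((Real.pi * σ / (1 - σ) : ℝ) * Complex.I)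

lemma strR_phase (σ : ℝ) (h0 : 0 < σ) (h1 : σ < 1 / 3) :
    0 < Real.pi * σ / (1 - σ) ∧ Real.pi * σ / (1 - σ) < Real.pi / 2 := by
  have hk : 0 < 1 - σ := by linarith
  have hpi := Real.pi_pos
  refine ⟨by positivity, ?_⟩
  rw [div_lt_iff₀ hk]; nlinarith

lemma strR_cos_pos (σ : ℝ) (h0 : 0 < σ) (h1 : σ < 1 / 3) :
    0 < Real.cos (Real.pi * σ / (1 - σ)) := by
  obtain ⟨ha, hb⟩ := strR_phase σ h0 h1
  exact Real.cos_pos_of_mem_Ioo ⟨by linarith, hb⟩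

lemma strR_re (σ : ℝ) : (strR σ).re = Real.cos (Real.pi * σ / (1 - σ)) := by
  unfold strR; rw [Complex.exp_ofReal_mul_I_re]

lemma strR_norm (σ : ℝ) : ‖strR σ‖ = 1 := by
  unfold strR; rw [Complex.norm_exp_ofReal_mul_I]

/-- The Laplace integral. -/
noncomputable def strJ (σ ν : ℝ) (N : ℕ) (L : ℝ) : ℂ :=
  ∫ y in Set.Ioi 0, lapF σ ((-ν - 1 / 2 + σ * N) - 1 - σ * (N + 1 / 2)) (strR σ)
    (sgt (N + 1 / 2) (strR σ)) L y

lemma struve_hasSum_real (σ ν L : ℝ) (N : ℕ) (h0 : 0 < σ) (h1 : σ < 1 / 3)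
    (hα : 0 < -ν - 1 / 2 + σ * N) (hL : 0 < L) :
    HasSum (fun n : ℕ => (L ^ (1 - σ) * σ ^ (-σ)) ^ n / (Real.Gamma ((n : ℝ) + 3 / 2) *
      Real.Gamma (-σ * (n : ℝ) + ν + 3 / 2)))
      ((L ^ (1 - σ) * σ ^ (-σ)) ^ N / Real.pi *
        (Complex.exp ((Real.pi * (-ν - 1 / 2 + σ * N) / (1 - σ) : ℝ) * Complex.I) *
        ((((σ * L) ^ (-ν - 1 / 2 + σ * N) * L ^ (-((N : ℝ) + 1 / 2)) : ℝ) : ℂ) *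
          Complex.exp (strR σ * ((1 - σ) * L : ℝ)) * strJ σ ν N L)).im +
       ∑ n ∈ Finset.range N, (L ^ (1 - σ) * σ ^ (-σ)) ^ n / (Real.Gamma ((n : ℝ) + 3 / 2) *
      Real.Gamma (-σ * (n : ℝ) + ν + 3 / 2))) := by
  have hx : 0 < L ^ (1 - σ) * σ ^ (-σ) := by positivity
  rw [← hasSum_nat_add_iff (f := fun n : ℕ => (L ^ (1 - σ) * σ ^ (-σ)) ^ n /
    (Real.Gamma ((n : ℝ) + 3 / 2) * Real.Gamma (-σ * (n : ℝ) + ν + 3 / 2))) N]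
  have h := struve_series_integral σ (-ν - 1 / 2 + σ * N) (N + 1 / 2) (L ^ (1 - σ) * σ ^ (-σ))
    (strR σ) h0 (by linarith) hα (by positivity) hx
    (by rw [strR_re]; exact strR_cos_pos σ h0 h1) (strR_norm σ)
  rw [struve_scaled_integral σ _ _ L _ h0 hL] at h
  have h' := (Complex.hasSum_im (h.mul_left
    (Complex.exp ((Real.pi * (-ν - 1 / 2 + σ * N) / (1 - σ) : ℝ) * Complex.I)))).mul_left
    ((L ^ (1 - σ) * σ ^ (-σ)) ^ N / Real.pi)
  convert! h' using 1
  funext m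
  exact struve_tail_term σ ν _ N m h0 h1 hα

lemma strJ_limit (σ ν : ℝ) (N : ℕ) (h0 : 0 < σ) (h1 : σ < 1 / 3)
    (hα : 0 < -ν - 1 / 2 + σ * N) :
    Tendsto (fun L : ℝ => ((√L : ℝ) : ℂ) * strJ σ ν N L) atTop
      (𝓝 (((√(2 * Real.pi / (σ * (1 - σ))) : ℝ) : ℂ) *
        Complex.exp ((-(Real.pi * σ / (1 - σ) * (N + 1)) : ℝ) * Complex.I))) := by
  have hr : 0 < (strR σ).re := by rw [strR_re]; exact strR_cos_pos σ h0 h1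
  obtain ⟨ha, hb⟩ := strR_phase σ h0 h1
  have hk : 0 < 1 - σ := by linarith
  have hpi := Real.pi_pos
  have hβ : (0:ℝ) < N + 1 / 2 := by positivity
  have hG := Real.Gamma_pos_of_pos hβ
  obtain ⟨C, hC0, hC⟩ := sgt_bounded (N + 1 / 2) hβ (strR σ) hr
  have h := lapF_total σ (-ν - 1 / 2 + σ * N) (N + 1 / 2)
    (C + (Real.Gamma (N + 1 / 2))⁻¹ * ((N : ℝ) + 1 / 2)⁻¹) (strR σ) _ (sgt (N + 1 / 2) (strR σ))
    h0 h1 hα hr (by positivity) (sgt_continuous _ hβ _)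
    (fun y hy => (hC y hy).trans (le_add_of_nonneg_right (by positivity)))
    (fun y hy => (sgt_crude _ hβ _ hr y hy).trans
      (mul_le_mul_of_nonneg_right (le_add_of_nonneg_left hC0.le) (by positivity)))
    (sgt_tendsto _ hβ _ hr)
  convert! h using 2
  unfold strR
  rw [exp_phase_cpow _ _ (by linarith) (by linarith),
    exp_phase_sqrt _ _ (by linarith) (by linarith) (by positivity)]
  have e : Real.pi / (σ * (1 - σ) / 2) = 2 * Real.pi / (σ * (1 - σ)) := by field_simp
  rw [e, mul_left_comm, ← Complex.exp_add]
  congr 2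
  push_cast; ring

lemma str_const (σ ν L : ℝ) (N : ℕ) (h0 : 0 < σ) (h1 : σ < 1 / 3) (hL : 0 < L) :
    (L ^ (1 - σ) * σ ^ (-σ)) ^ N * ((σ * L) ^ (-ν - 1 / 2 + σ * N) * L ^ (-((N : ℝ) + 1 / 2))) *
      ((1 - σ) * L) ^ (ν + 3 / 2)
      = σ ^ (-ν - 1 / 2) * (1 - σ) ^ (ν + 3 / 2) * √L := by
  have hk : 0 < 1 - σ := by linarith
  rw [Real.sqrt_eq_rpow, Real.mul_rpow hk.le hL.le, Real.mul_rpow h0.le hL.le,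
    ← Real.rpow_natCast, Real.mul_rpow (by positivity) (by positivity), ← Real.rpow_mul hL.le,
    ← Real.rpow_mul h0.le]
  have e1 : σ ^ (-σ * N) * σ ^ (-ν - 1 / 2 + σ * N) = σ ^ (-ν - 1 / 2) := by
    rw [← Real.rpow_add h0]; ring_nf
  have e2 : L ^ ((1 - σ) * N) * L ^ (-ν - 1 / 2 + σ * N) * L ^ (-((N : ℝ) + 1 / 2)) *
      L ^ (ν + 3 / 2) = L ^ (1 / 2 : ℝ) := by
    rw [← Real.rpow_add hL, ← Real.rpow_add hL, ← Real.rpow_add hL]; ring_nf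
  rw [← e1, ← e2]; ring

lemma str_const2 (σ ν : ℝ) (h0 : 0 < σ) (h1 : σ < 1 / 3) :
    σ ^ (-ν - 1 / 2) * (1 - σ) ^ (ν + 3 / 2) * √(2 * Real.pi / (σ * (1 - σ)))
      = √(2 * Real.pi) * ((1 - σ) / σ) ^ (ν + 1) := by
  have hk : 0 < 1 - σ := by linarith
  have hpi := Real.pi_pos
  rw [Real.sqrt_div (by positivity), Real.div_rpow hk.le h0.le, Real.sqrt_eq_rpow (σ * (1 - σ)),
    Real.mul_rpow h0.le hk.le]
  have e1 : σ ^ (-ν - 1 / 2) = σ ^ (1 / 2 : ℝ) / σ ^ (ν + 1) := by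
    rw [← Real.rpow_sub h0]; ring_nf
  have e2 : (1 - σ) ^ (ν + 3 / 2) = (1 - σ) ^ (1 / 2 : ℝ) * (1 - σ) ^ (ν + 1) := by
    rw [← Real.rpow_add hk]; ring_nf
  rw [e1, e2]
  field_simp

lemma str_tail (σ ν : ℝ) (N : ℕ) (h0 : 0 < σ) (h1 : σ < 1 / 3)
    (hα : 0 < -ν - 1 / 2 + σ * N) :
    Tendsto (fun L : ℝ => ((L ^ (1 - σ) * σ ^ (-σ)) ^ N / Real.pi *
        (Complex.exp ((Real.pi * (-ν - 1 / 2 + σ * N) / (1 - σ) : ℝ) * Complex.I) *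
        ((((σ * L) ^ (-ν - 1 / 2 + σ * N) * L ^ (-((N : ℝ) + 1 / 2)) : ℝ) : ℂ) *
          Complex.exp (strR σ * ((1 - σ) * L : ℝ)) * strJ σ ν N L)).im) *
        ((1 - σ) * L) ^ (ν + 3 / 2) *
        Real.exp (-((1 - σ) * L) * Real.cos (Real.pi * σ / (1 - σ))) +
        Real.sqrt (2 * Real.pi) * ((1 - σ) / σ) ^ (ν + 1) / Real.pi *
          Real.sin ((1 - σ) * L * Real.sin (Real.pi * σ / (1 - σ)) +
            Real.pi * (-ν - 3 / 2) / (1 - σ))) atTop (𝓝 0) := by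
  have hk : 0 < 1 - σ := by linarith
  have hpi := Real.pi_pos
  set φ := Real.pi * σ / (1 - σ) with hφ
  set D : ℝ := σ ^ (-ν - 1 / 2) * (1 - σ) ^ (ν + 3 / 2) with hD
  set ψ : ℝ := Real.pi * (-ν - 1 / 2 + σ * N) / (1 - σ) with hψ
  set ℓ : ℂ := ((√(2 * Real.pi / (σ * (1 - σ))) : ℝ) : ℂ) *
        Complex.exp ((-(φ * (N + 1)) : ℝ) * Complex.I) with hℓ
  have hlim : Tendsto (fun L : ℝ => ((√L : ℝ) : ℂ) * strJ σ ν N L) atTop (𝓝 ℓ) :=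
    strJ_limit σ ν N h0 h1 hα
  have hlim2 : Tendsto (fun L : ℝ => D / Real.pi * ‖((√L : ℝ) : ℂ) * strJ σ ν N L - ℓ‖)
      atTop (𝓝 0) := by
    have := ((hlim.sub_const ℓ).norm).const_mul (D / Real.pi)
    rwa [sub_self, norm_zero, mul_zero] at this
  have hD0 : 0 < D := by positivity
  refine squeeze_zero_norm' ?_ hlim2
  filter_upwards [eventually_gt_atTop 0] with L hL
  have hexp : Complex.exp (strR σ * ((1 - σ) * L : ℝ)) =
      ((Real.exp (((1 - σ) * L) * Real.cos φ) : ℝ) : ℂ) *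
        Complex.exp (((1 - σ) * L * Real.sin φ : ℝ) * Complex.I) := by
    rw [Complex.ofReal_exp, ← Complex.exp_add]
    congr 1
    unfold strR
    rw [← hφ, Complex.exp_mul_I, ← Complex.ofReal_cos, ← Complex.ofReal_sin]
    push_cast; ring
  have hEE : Real.exp (((1 - σ) * L) * Real.cos φ) * Real.exp (-((1 - σ) * L) * Real.cos φ) = 1 := by
    rw [← Real.exp_add]; simp
  have hc := str_const σ ν L N h0 h1 hL
  have hphase : Complex.exp ((ψ : ℝ) * Complex.I) *
      Complex.exp (((1 - σ) * L * Real.sin φ : ℝ) * Complex.I) *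
      Complex.exp ((-(φ * (N + 1)) : ℝ) * Complex.I) =
      -Complex.exp (((1 - σ) * L * Real.sin φ + Real.pi * (-ν - 3 / 2) / (1 - σ) : ℝ) *
        Complex.I) := by
    rw [← Complex.exp_add, ← Complex.exp_add, ← mul_neg_one (Complex.exp _),
      ← Complex.exp_pi_mul_I, ← Complex.exp_add]
    congr 1
    have : ψ + (1 - σ) * L * Real.sin φ + -(φ * (N + 1)) =
      (1 - σ) * L * Real.sin φ + Real.pi * (-ν - 3 / 2) / (1 - σ) + Real.pi := by
      rw [hψ, hφ]; field_simp; ring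
    rw [← add_mul, ← add_mul, ← add_mul]
    congr 1
    exact_mod_cast this
  have hmain : ((L ^ (1 - σ) * σ ^ (-σ)) ^ N / Real.pi *
        (Complex.exp ((ψ : ℝ) * Complex.I) *
        ((((σ * L) ^ (-ν - 1 / 2 + σ * N) * L ^ (-((N : ℝ) + 1 / 2)) : ℝ) : ℂ) *
          Complex.exp (strR σ * ((1 - σ) * L : ℝ)) * strJ σ ν N L)).im) *
        ((1 - σ) * L) ^ (ν + 3 / 2) *
        Real.exp (-((1 - σ) * L) * Real.cos φ) +
        Real.sqrt (2 * Real.pi) * ((1 - σ) / σ) ^ (ν + 1) / Real.pi *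
          Real.sin ((1 - σ) * L * Real.sin φ + Real.pi * (-ν - 3 / 2) / (1 - σ)) =
      D / Real.pi * (Complex.exp ((ψ : ℝ) * Complex.I) *
        Complex.exp (((1 - σ) * L * Real.sin φ : ℝ) * Complex.I) *
        (((√L : ℝ) : ℂ) * strJ σ ν N L - ℓ)).im := by
    have a1 : Complex.exp ((ψ : ℝ) * Complex.I) *
        ((((σ * L) ^ (-ν - 1 / 2 + σ * N) * L ^ (-((N : ℝ) + 1 / 2)) : ℝ) : ℂ) *
          Complex.exp (strR σ * ((1 - σ) * L : ℝ)) * strJ σ ν N L) =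
        (((σ * L) ^ (-ν - 1 / 2 + σ * N) * L ^ (-((N : ℝ) + 1 / 2)) *
          Real.exp (((1 - σ) * L) * Real.cos φ) : ℝ) : ℂ) * (Complex.exp ((ψ : ℝ) * Complex.I) *
        Complex.exp (((1 - σ) * L * Real.sin φ : ℝ) * Complex.I) * strJ σ ν N L) := by
      rw [hexp]; push_cast; ring
    have a2 : Complex.exp ((ψ : ℝ) * Complex.I) *
        Complex.exp (((1 - σ) * L * Real.sin φ : ℝ) * Complex.I) *
        (((√L : ℝ) : ℂ) * strJ σ ν N L - ℓ) =
        ((√L : ℝ) : ℂ) * (Complex.exp ((ψ : ℝ) * Complex.I) *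
          Complex.exp (((1 - σ) * L * Real.sin φ : ℝ) * Complex.I) * strJ σ ν N L) +
        ((√(2 * Real.pi / (σ * (1 - σ))) : ℝ) : ℂ) *
          Complex.exp (((1 - σ) * L * Real.sin φ + Real.pi * (-ν - 3 / 2) / (1 - σ) : ℝ) *
            Complex.I) := by
      rw [hℓ]
      linear_combination (-((√(2 * Real.pi / (σ * (1 - σ))) : ℝ) : ℂ)) * hphase
    rw [a1, a2, Complex.add_im, Complex.im_ofReal_mul, Complex.im_ofReal_mul, Complex.im_ofReal_mul,
      Complex.exp_ofReal_mul_I_im, ← str_const2 σ ν h0 h1]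
    set W := (Complex.exp ((ψ : ℝ) * Complex.I) *
          Complex.exp (((1 - σ) * L * Real.sin φ : ℝ) * Complex.I) * strJ σ ν N L).im
    set P := (L ^ (1 - σ) * σ ^ (-σ)) ^ N
    set Q := (σ * L) ^ (-ν - 1 / 2 + σ * N) * L ^ (-((N : ℝ) + 1 / 2))
    set R := ((1 - σ) * L) ^ (ν + 3 / 2)
    set E1 := Real.exp (((1 - σ) * L) * Real.cos φ)
    set E2 := Real.exp (-((1 - σ) * L) * Real.cos φ)
    calc _ = (P * Q * R) * (E1 * E2) * W / Real.pi + _ := by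
          congr 1
          ring
      _ = _ := by rw [hc, hEE]; ring
  rw [hmain, norm_mul, Real.norm_of_nonneg (by positivity : 0 ≤ D / Real.pi)]
  refine mul_le_mul_of_nonneg_left ?_ (by positivity)
  refine (Complex.abs_im_le_norm _).trans (le_of_eq ?_)
  rw [norm_mul, norm_mul, Complex.norm_exp_ofReal_mul_I, Complex.norm_exp_ofReal_mul_I]
  simp

lemma str_head (σ ν : ℝ) (n : ℕ) (G : ℝ) (h0 : 0 < σ) (h1 : σ < 1 / 3) :
    Tendsto (fun L : ℝ => (L ^ (1 - σ) * σ ^ (-σ)) ^ n / G *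
        ((1 - σ) * L) ^ (ν + 3 / 2) *
        Real.exp (-((1 - σ) * L) * Real.cos (Real.pi * σ / (1 - σ)))) atTop (𝓝 0) := by
  have hk : 0 < 1 - σ := by linarith
  have hc := strR_cos_pos σ h0 h1
  have h := (tendsto_rpow_mul_exp_neg_mul_atTop_nhds_zero ((1 - σ) * n + (ν + 3 / 2))
    ((1 - σ) * Real.cos (Real.pi * σ / (1 - σ))) (by positivity)).const_mul
    (σ ^ (-σ * n) / G * (1 - σ) ^ (ν + 3 / 2))
  rw [mul_zero] at h
  refine h.congr' ?_
  filter_upwards [eventually_gt_atTop 0] with L hL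
  rw [Real.mul_rpow hk.le hL.le,
    ← Real.rpow_natCast, Real.mul_rpow (by positivity) (by positivity), ← Real.rpow_mul hL.le,
    ← Real.rpow_mul h0.le, Real.rpow_add hL]
  have : -((1 - σ) * Real.cos (Real.pi * σ / (1 - σ))) * L =
    -((1 - σ) * L) * Real.cos (Real.pi * σ / (1 - σ)) := by ring
  rw [this]
  ring

lemma str_real (σ ν : ℝ) (h0 : 0 < σ) (h1 : σ < 1 / 3) :
    Tendsto (fun L : ℝ => (∑' n : ℕ, (L ^ (1 - σ) * σ ^ (-σ)) ^ n /
      (Real.Gamma ((n : ℝ) + 3 / 2) * Real.Gamma (-σ * (n : ℝ) + ν + 3 / 2))) *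
        ((1 - σ) * L) ^ (ν + 3 / 2) *
        Real.exp (-((1 - σ) * L) * Real.cos (Real.pi * σ / (1 - σ))) +
        Real.sqrt (2 * Real.pi) * ((1 - σ) / σ) ^ (ν + 1) / Real.pi *
          Real.sin ((1 - σ) * L * Real.sin (Real.pi * σ / (1 - σ)) +
            Real.pi * (-ν - 3 / 2) / (1 - σ))) atTop (𝓝 0) := by
  obtain ⟨N, hN⟩ := exists_nat_gt ((ν + 1 / 2) / σ)
  have hα : 0 < -ν - 1 / 2 + σ * N := by
    rw [div_lt_iff₀ h0] at hN; linarith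
  have ht := str_tail σ ν N h0 h1 hα
  have hh := tendsto_finsetSum (Finset.range N) (fun n _ => str_head σ ν n
    (Real.Gamma ((n : ℝ) + 3 / 2) * Real.Gamma (-σ * (n : ℝ) + ν + 3 / 2)) h0 h1)
  have h := ht.add hh
  simp only [Finset.sum_const_zero, add_zero] at h
  refine h.congr' ?_
  filter_upwards [eventually_gt_atTop 0] with L hL
  rw [(struve_hasSum_real σ ν L N h0 h1 hα hL).tsum_eq, ← Finset.sum_mul, ← Finset.sum_mul]
  ring

lemma str_final (σ ν : ℝ) (hσ0 : 0 < σ) (hσ1 : σ < 1 / 3) :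
    Tendsto (fun z : ℝ =>
      ((z : ℂ) / 2) ^ (-(ν : ℂ) - 1) * struveL ν (-σ) (z : ℂ) *
          ((struveXneg σ z ^ (ν + 3 / 2) : ℝ) : ℂ) *
          ((Real.exp (-struveXneg σ z *
            Real.cos (Real.pi * σ / (1 - σ))) : ℝ) : ℂ) +
        ((Real.sqrt (2 * Real.pi) * ((1 - σ) / σ) ^ (ν + 1) / Real.pi *
          Real.sin (struveXneg σ z * Real.sin (Real.pi * σ / (1 - σ)) +
            Real.pi * (-ν - 3 / 2) / (1 - σ)) : ℝ) : ℂ))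
      atTop (𝓝 0) := by
  have hk : 0 < 1 - σ := by linarith
  have hLt : Tendsto (fun z : ℝ => (σ ^ σ * z ^ 2 / 4) ^ (1 / (1 - σ))) atTop atTop := by
    refine (tendsto_rpow_atTop (by positivity)).comp ?_
    have h2 : Tendsto (fun z : ℝ => z ^ 2) atTop atTop := tendsto_pow_atTop (by norm_num)
    exact (h2.const_mul_atTop (by positivity : 0 < σ ^ σ)).atTop_div_const (by norm_num)
  have h := (str_real σ ν hσ0 hσ1).comp hLt
  have h' := (Complex.continuous_ofReal.tendsto 0).comp h
  rw [Complex.ofReal_zero] at h'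
  refine h'.congr' ?_
  filter_upwards [eventually_gt_atTop 0] with z hz
  simp only [Function.comp]
  have hx : ((σ ^ σ * z ^ 2 / 4) ^ (1 / (1 - σ))) ^ (1 - σ) * σ ^ (-σ) = z ^ 2 / 4 := by
    rw [← Real.rpow_mul (by positivity), one_div_mul_cancel hk.ne', Real.rpow_one,
      Real.rpow_neg hσ0.le]
    have : 0 < σ ^ σ := by positivity
    field_simp
  rw [hx]
  have hz2 : (z : ℂ) / 2 ≠ 0 := by
    have : (z : ℂ) ≠ 0 := by exact_mod_cast hz.ne'
    simpa using this
  have hS : ((z : ℂ) / 2) ^ (-(ν : ℂ) - 1) * struveL ν (-σ) (z : ℂ) =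
      ((∑' n : ℕ, (z ^ 2 / 4) ^ n /
      (Real.Gamma ((n : ℝ) + 3 / 2) * Real.Gamma (-σ * (n : ℝ) + ν + 3 / 2)) : ℝ) : ℂ) := by
    unfold struveL
    rw [← mul_assoc, ← Complex.cpow_add _ _ hz2, Complex.ofReal_tsum]
    have : -(ν : ℂ) - 1 + ((ν : ℂ) + 1) = 0 := by ring
    rw [this, Complex.cpow_zero, one_mul]
    congr 1
    funext n
    rw [Complex.ofReal_div, Complex.ofReal_mul, ← Complex.Gamma_ofReal, ← Complex.Gamma_ofReal,
      pow_mul]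
    push_cast
    congr 2
    ring
  rw [hS]
  unfold struveXneg
  push_cast
  ring

/-- Dominant oscillatory exponential asymptotics of `L_ν(z;−σ)` for
`0 < σ < 1/3` as `z → +∞`: with `κ = 1 − σ`, `ϑ = −ν−3/2`,
`A₀ = √(2π)(κ/σ)^{ν+1}`, `X = κ(hz²/4)^{1/κ}`,
`(z/2)^{−ν−1} L_ν(z;−σ) X^{ν+3/2} e^{−X cos(πσ/κ)}
  + (A₀/π) sin(X sin(πσ/κ) + πϑ/κ) → 0`. -/
theorem struveL_neg_sigma_exponential (σ ν : ℝ) (hσ0 : 0 < σ)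
    (hσ1 : σ < 1 / 3)
    (hreg : ∀ n m : ℕ, σ * (n : ℝ) - ν - 1 / 2 ≠ -(m : ℝ)) :
    Tendsto (fun z : ℝ =>
      ((z : ℂ) / 2) ^ (-(ν : ℂ) - 1) * struveL ν (-σ) (z : ℂ) *
          ((struveXneg σ z ^ (ν + 3 / 2) : ℝ) : ℂ) *
          ((Real.exp (-struveXneg σ z *
            Real.cos (Real.pi * σ / (1 - σ))) : ℝ) : ℂ) +
        ((Real.sqrt (2 * Real.pi) * ((1 - σ) / σ) ^ (ν + 1) / Real.pi *
          Real.sin (struveXneg σ z * Real.sin (Real.pi * σ / (1 - σ)) +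
            Real.pi * (-ν - 3 / 2) / (1 - σ)) : ℝ) : ℂ))
      atTop (𝓝 0) := by
  exact str_final σ ν hσ0 hσ1
end
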